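/- Every 7-edge-colorable graph with maximum degree 7 on n vertices admits a 2-bend RAC drawing of O(n²) area. -/

import Mathlib

open scoped Classical

noncomputable section

/-- A point of the Euclidean plane. -/
abbrev Pt : Type := ℝ × ℝ

/-- The segments with endpoints `a, b` and `c, d` are orthogonal:
their direction vectors have zero inner product. -/
def SegOrth (a b c d : Pt) : Prop :=
  (b.1 - a.1) * (d.1 - c.1) + (b.2 - a.2) * (d.2 - c.2) = 0

/-- The degree of a vertex in a simple graph. -/
def vdeg {V : Type*} (G : SimpleGraph V) (v : V) : ℕ := (G.neighborSet v).ncard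

/-- `M` is a matching in `G`: a set of edges of `G` that are pairwise non-adjacent. -/
def IsMatchingOn {V : Type*} (G : SimpleGraph V) (M : Set (Sym2 V)) : Prop :=
  M ⊆ G.edgeSet ∧ ∀ e ∈ M, ∀ f ∈ M, e ≠ f → ∀ v : V, v ∈ e → v ∉ f

/-- `G` is `k`-edge-colorable: its edge set is partitioned into `k` matchings. -/
def EdgeColorable {V : Type*} (G : SimpleGraph V) (k : ℕ) : Prop :=
  ∃ M : Fin k → Set (Sym2 V),
    (∀ i, IsMatchingOn G (M i)) ∧
    (∀ i j, i ≠ j → Disjoint (M i) (M j)) ∧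
    (⋃ i, M i) = G.edgeSet

/-- `p` is a straight-line RAC drawing of `G`: vertices are at pairwise distinct points,
each edge is the closed segment between its endpoints, no edge passes through another
vertex, edges sharing an endpoint meet only there, and any two edges with no common
endpoint that intersect do so orthogonally. -/
structure IsRACDrawing {V : Type*} (G : SimpleGraph V) (p : V → Pt) : Prop where
  inj : Function.Injective p
  vertex_off : ∀ u v w : V, G.Adj u v → w ≠ u → w ≠ v →
    p w ∉ segment ℝ (p u) (p v)
  shared : ∀ u v w : V, G.Adj u v → G.Adj u w → v ≠ w →
    segment ℝ (p u) (p v) ∩ segment ℝ (p u) (p w) ⊆ {p u}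
  rac : ∀ u v u' v' : V, G.Adj u v → G.Adj u' v' →
    u ≠ u' → u ≠ v' → v ≠ u' → v ≠ v' →
    (segment ℝ (p u) (p v) ∩ segment ℝ (p u') (p v')).Nonempty →
    SegOrth (p u) (p v) (p u') (p v')

/-- All points of `P` are integer grid points lying in an axis-aligned square
of side length `side`. -/
def InGridSquare (side : ℝ) (P : Set Pt) : Prop :=
  (∀ q ∈ P, ∃ a b : ℤ, q = ((a : ℝ), (b : ℝ))) ∧
  ∃ x0 y0 : ℝ, ∀ q ∈ P, x0 ≤ q.1 ∧ q.1 ≤ x0 + side ∧ y0 ≤ q.2 ∧ q.2 ≤ y0 + side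

/-- The list of consecutive segments (as pairs of endpoints) of a polyline given
by its list of points. -/
def polySegs (l : List Pt) : List (Pt × Pt) := l.zip l.tail

/-- The set of plane points covered by a polyline given by its list of points. -/
def polySet (l : List Pt) : Set Pt := ⋃ s ∈ polySegs l, segment ℝ s.1 s.2

/-- `p, poly` is a `k`-bend RAC drawing of `G`: each edge `e` is drawn as the polyline
through the list of points `poly e` (at most `k + 1` segments, i.e. at most `k + 2`
points) joining the two endpoints of `e`; no edge passes through another vertex; edges
sharing an endpoint meet only at that endpoint; any two distinct edges intersect in
finitely many points; and wherever segments of two distinct edges meet (other than at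
the point of a common endvertex) the two segments are orthogonal. -/
structure IsBendRACDrawing {V : Type*} (k : ℕ) (G : SimpleGraph V)
    (p : V → Pt) (poly : Sym2 V → List Pt) : Prop where
  inj : Function.Injective p
  ends : ∀ e ∈ G.edgeSet, ∃ u v : V, e = s(u, v) ∧
    (poly e).head? = some (p u) ∧ (poly e).getLast? = some (p v)
  nsegs : ∀ e ∈ G.edgeSet, 2 ≤ (poly e).length ∧ (poly e).length ≤ k + 2
  vertex_off : ∀ e ∈ G.edgeSet, ∀ w : V, w ∉ e → p w ∉ polySet (poly e)
  shared : ∀ e ∈ G.edgeSet, ∀ e' ∈ G.edgeSet, e ≠ e' → ∀ w : V, w ∈ e → w ∈ e' →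
    polySet (poly e) ∩ polySet (poly e') ⊆ {p w}
  fin_inter : ∀ e ∈ G.edgeSet, ∀ e' ∈ G.edgeSet, e ≠ e' →
    (polySet (poly e) ∩ polySet (poly e')).Finite
  rac : ∀ e ∈ G.edgeSet, ∀ e' ∈ G.edgeSet, e ≠ e' →
    ∀ s ∈ polySegs (poly e), ∀ s' ∈ polySegs (poly e'),
    ∀ x : Pt, x ∈ segment ℝ s.1 s.2 → x ∈ segment ℝ s'.1 s'.2 →
    (∀ w : V, w ∈ e → w ∈ e' → x ≠ p w) →
    SegOrth s.1 s.2 s'.1 s'.2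

/-- All vertex points and bend points of a polyline drawing. -/
def drawingPoints {V : Type*} (G : SimpleGraph V) (p : V → Pt)
    (poly : Sym2 V → List Pt) : Set Pt :=
  Set.range p ∪ {q | ∃ e ∈ G.edgeSet, q ∈ poly e}

/-- `F` is (the edge set of) a 2-factor of `G`: a spanning subgraph in which every
vertex has degree exactly 2. -/
def Is2Factor {V : Type*} (G : SimpleGraph V) (F : Set (Sym2 V)) : Prop :=
  F ⊆ G.edgeSet ∧ ∀ v : V, {e ∈ F | v ∈ e}.ncard = 2

/-- The connected components of the (2-regular) spanning subgraph with edge set `F`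
that are odd cycles, i.e. have an odd number of vertices. -/
def oddComps {V : Type*} (F : Set (Sym2 V)) :
    Set ((SimpleGraph.fromEdgeSet F).ConnectedComponent) :=
  {C | Odd C.supp.ncard}

/-- `G` has oddness `k`: the minimum over all 2-factors of the number of odd-cycle
components equals `k` (in particular a 2-factor exists). -/
def HasOddness {V : Type*} (G : SimpleGraph V) (k : ℕ) : Prop :=
  (∃ F, Is2Factor G F ∧ (oddComps F).ncard = k) ∧
  (∀ F, Is2Factor G F → k ≤ (oddComps F).ncard)

/-- `G` has no cut-edge. -/
def Bridgeless {V : Type*} (G : SimpleGraph V) : Prop := ∀ e, ¬ G.IsBridge e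


/-! ### Geometry: abstract layouts -/

/-- direction from `a` to `b` -/
def sg (a b : ℤ) : ℤ := if a < b then 1 else -1

structure Lay (V : Type) where
  x : V → ℤ
  y : V → ℤ
  T : V → V → Prop
  A : V → V → Prop
  B : V → V → Prop
  a : V → V → ℤ
  b : V → V → ℤ

namespace Lay
variable {V : Type} (Λ : Lay V)

def X (u : V) : ℤ := 400 * Λ.x u
def Y (u : V) : ℤ := 400 * Λ.y u

structure OK : Prop where
  xinj : Function.Injective Λ.x
  yinj : Function.Injective Λ.y
  abd : ∀ s t, Λ.T s t → -6 ≤ Λ.a s t ∧ Λ.a s t ≤ 6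
  bbd : ∀ s t, Λ.T s t → -6 ≤ Λ.b s t ∧ Λ.b s t ≤ 6
  ab : ∀ s t, Λ.T s t → Λ.a s t = 0 ∨ Λ.b s t = 0
  Tne : ∀ s t, Λ.T s t → s ≠ t
  Adx : ∀ u v, Λ.A u v → Λ.x v = Λ.x u + 1
  Bdy : ∀ u v, Λ.B u v → Λ.y v = Λ.y u + 1
  Bdx : ∀ u v, Λ.B u v → Λ.x v ≤ Λ.x u - 2 ∨ Λ.x u + 2 ≤ Λ.x v
  /-- tracks on the right / left side -/
  ane : ∀ s t t', Λ.T s t → Λ.T s t' → t ≠ t' → sg (Λ.x s) (Λ.x t) = sg (Λ.x s) (Λ.x t') →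
    Λ.a s t ≠ Λ.a s t'
  aord : ∀ s t t', Λ.T s t → Λ.T s t' → sg (Λ.x s) (Λ.x t) = sg (Λ.x s) (Λ.x t') →
    |Λ.x t - Λ.x s| < |Λ.x t' - Λ.x s| →
    (Λ.y s < Λ.y t → Λ.a s t' < Λ.a s t) ∧ (Λ.y t < Λ.y s → Λ.a s t < Λ.a s t')
  bne : ∀ s s' t, Λ.T s t → Λ.T s' t → s ≠ s' → sg (Λ.y t) (Λ.y s) = sg (Λ.y t) (Λ.y s') →
    Λ.b s t ≠ Λ.b s' t
  bord : ∀ s s' t, Λ.T s t → Λ.T s' t → sg (Λ.y t) (Λ.y s) = sg (Λ.y t) (Λ.y s') →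
    |Λ.y s - Λ.y t| < |Λ.y s' - Λ.y t| →
    (Λ.x t < Λ.x s → Λ.b s' t < Λ.b s t) ∧ (Λ.x s < Λ.x t → Λ.b s t < Λ.b s' t)
  /-- no conflicts: `v` steeper and of type H at `u`, `z` flatter and of type V at `u` -/
  conf : ∀ u v z, (Λ.T u v ∧ (Λ.T z u ∨ Λ.B u z ∨ Λ.B z u) ∨
      (Λ.A u v ∨ Λ.A v u) ∧ Λ.T z u) →
    sg (Λ.x u) (Λ.x v) = sg (Λ.x u) (Λ.x z) → sg (Λ.y u) (Λ.y v) = sg (Λ.y u) (Λ.y z) →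
    |Λ.x v - Λ.x u| < |Λ.x z - Λ.x u| → |Λ.y z - Λ.y u| < |Λ.y v - Λ.y u| → False

end Lay

inductive ERep (V : Type) : Type
  | L (s t : V) : ERep V
  | A (u v : V) : ERep V
  | B (u v : V) : ERep V

namespace ERep
variable {V : Type}

def ends : ERep V → Sym2 V
  | L s t => s(s, t)
  | A u v => s(u, v)
  | B u v => s(u, v)

def ok (Λ : Lay V) : ERep V → Prop
  | L s t => Λ.T s t
  | A u v => Λ.A u v
  | B u v => Λ.B u v

end ERep

/-- integer point -/
def ip (a b : ℤ) : Pt := ((a : ℝ), (b : ℝ))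

namespace Lay
variable {V : Type} (Λ : Lay V)

def pt (u : V) : Pt := ip (Λ.X u) (Λ.Y u)

def pts : ERep V → List Pt
  | .L s t =>
    if Λ.a s t = 0 then
      [Λ.pt s, ip (Λ.X t + Λ.b s t) (Λ.Y s),
        ip (Λ.X t + Λ.b s t) (Λ.Y t + 20 * sg (Λ.y t) (Λ.y s)), Λ.pt t]
    else
      [Λ.pt s, ip (Λ.X s + 20 * sg (Λ.x s) (Λ.x t)) (Λ.Y s + Λ.a s t),
        ip (Λ.X t) (Λ.Y s + Λ.a s t), Λ.pt t]
  | .A u v =>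
      [Λ.pt u, ip (Λ.X u + 200) (Λ.Y u + 190 * sg (Λ.y u) (Λ.y v)),
        ip (Λ.X u + 200) (Λ.Y v - 190 * sg (Λ.y u) (Λ.y v)), Λ.pt v]
  | .B u v =>
      [Λ.pt u, ip (Λ.X u + 220 * sg (Λ.x u) (Λ.x v)) (Λ.Y u + 200),
        ip (Λ.X v - 220 * sg (Λ.x u) (Λ.x v)) (Λ.Y u + 200), Λ.pt v]

/-- direction of the germ of an edge at an endpoint -/
def dir (r : ERep V) (w : V) : ℤ × ℤ :=
  match r with
  | .L s t => if w = s then (20 * sg (Λ.x s) (Λ.x t), Λ.a s t)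
      else (Λ.b s t, 20 * sg (Λ.y t) (Λ.y s))
  | .A u v => if w = u then (200, 190 * sg (Λ.y u) (Λ.y v))
      else (-200, -190 * sg (Λ.y u) (Λ.y v))
  | .B u v => if w = u then (220 * sg (Λ.x u) (Λ.x v), 200)
      else (-220 * sg (Λ.x u) (Λ.x v), -200)

def Germ (r : ERep V) (w : V) (z : Pt) : Prop :=
  ∃ θ : ℝ, 0 ≤ θ ∧ θ ≤ 1 ∧ z.1 = Λ.X w + θ * (Λ.dir r w).1 ∧ z.2 = Λ.Y w + θ * (Λ.dir r w).2

def Hp : ERep V → Pt → Prop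
  | .L s t, z => z.2 = ((Λ.Y s + Λ.a s t : ℤ) : ℝ) ∧
      20 ≤ sg (Λ.x s) (Λ.x t) * (z.1 - Λ.X s) ∧
      0 ≤ sg (Λ.x s) (Λ.x t) * (((Λ.X t + Λ.b s t : ℤ) : ℝ) - z.1)
  | .A _ _, _ => False
  | .B u v, z => z.2 = ((Λ.Y u + 200 : ℤ) : ℝ) ∧
      220 ≤ sg (Λ.x u) (Λ.x v) * (z.1 - Λ.X u) ∧
      220 ≤ sg (Λ.x u) (Λ.x v) * (Λ.X v - z.1)

def Vp : ERep V → Pt → Prop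
  | .L s t, z => z.1 = ((Λ.X t + Λ.b s t : ℤ) : ℝ) ∧
      20 ≤ sg (Λ.y t) (Λ.y s) * (z.2 - Λ.Y t) ∧
      0 ≤ sg (Λ.y t) (Λ.y s) * (((Λ.Y s + Λ.a s t : ℤ) : ℝ) - z.2)
  | .A u v, z => z.1 = ((Λ.X u + 200 : ℤ) : ℝ) ∧
      190 ≤ sg (Λ.y u) (Λ.y v) * (z.2 - Λ.Y u) ∧
      190 ≤ sg (Λ.y u) (Λ.y v) * (Λ.Y v - z.2)
  | .B _ _, _ => False

end Lay

theorem mem_seg {z : Pt} {a b c d : ℤ} (h : z ∈ segment ℝ (ip a b) (ip c d)) :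
    ∃ t : ℝ, 0 ≤ t ∧ t ≤ 1 ∧ z.1 = a + t * (c - a) ∧ z.2 = b + t * (d - b) := by
  rw [segment_eq_image'] at h
  obtain ⟨t, ⟨h0, h1⟩, rfl⟩ := h
  exact ⟨t, h0, h1, by simp [ip], by simp [ip]⟩

theorem sg_cases (a b : ℤ) : (a < b ∧ sg a b = 1) ∨ (b ≤ a ∧ sg a b = -1) := by
  unfold sg; split_ifs with h
  · exact Or.inl ⟨h, rfl⟩
  · exact Or.inr ⟨by omega, rfl⟩

theorem mem_segH {z : Pt} {a b c : ℤ} (h : z ∈ segment ℝ (ip a b) (ip c b)) :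
    z.2 = b ∧ (((a : ℝ) ≤ z.1 ∧ z.1 ≤ c) ∨ ((c : ℝ) ≤ z.1 ∧ z.1 ≤ a)) := by
  obtain ⟨t, h0, h1, e1, e2⟩ := mem_seg h
  refine ⟨by rw [e2]; ring, ?_⟩
  rcases le_total (a : ℝ) c with h | h
  · left; constructor <;> nlinarith
  · right; constructor <;> nlinarith

theorem mem_segV {z : Pt} {a b d : ℤ} (h : z ∈ segment ℝ (ip a b) (ip a d)) :
    z.1 = a ∧ (((b : ℝ) ≤ z.2 ∧ z.2 ≤ d) ∨ ((d : ℝ) ≤ z.2 ∧ z.2 ≤ b)) := by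
  obtain ⟨t, h0, h1, e1, e2⟩ := mem_seg h
  refine ⟨by rw [e1]; ring, ?_⟩
  rcases le_total (b : ℝ) d with h | h
  · left; constructor <;> nlinarith
  · right; constructor <;> nlinarith

theorem sgR {a b : ℤ} (h : a ≠ b) :
    ((a : ℝ) + 1 ≤ b ∧ sg a b = 1) ∨ ((b : ℝ) + 1 ≤ a ∧ sg a b = -1) := by
  unfold sg; split_ifs with h1
  · left; refine ⟨?_, rfl⟩; exact_mod_cast h1
  · right; refine ⟨?_, rfl⟩
    have : b + 1 ≤ a := by omega
    exact_mod_cast this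

namespace Lay
variable {V : Type} {Λ : Lay V}

theorem OK.xgap (h : Λ.OK) {u v : V} (hne : u ≠ v) : Λ.x u + 1 ≤ Λ.x v ∨ Λ.x v + 1 ≤ Λ.x u := by
  have := h.xinj.ne hne; omega

theorem OK.ygap (h : Λ.OK) {u v : V} (hne : u ≠ v) : Λ.y u + 1 ≤ Λ.y v ∨ Λ.y v + 1 ≤ Λ.y u := by
  have := h.yinj.ne hne; omega

/-- Classification predicate for a segment of an edge. -/
def Cls (Λ : Lay V) (r : ERep V) (c d : Pt) (z : Pt) : Prop :=
  (∃ w, w ∈ r.ends ∧ Λ.Germ r w z) ∨ (Λ.Hp r z ∧ c.2 = d.2) ∨ (Λ.Vp r z ∧ c.1 = d.1)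

theorem clsL (h : Λ.OK) {s t : V} (hT : Λ.T s t) :
    ∀ c ∈ polySegs (Λ.pts (.L s t)), ∀ z ∈ segment ℝ c.1 c.2, Λ.Cls (.L s t) c.1 c.2 z := by
  have hne := h.Tne s t hT
  have sX := sgR (h.xinj.ne hne)
  have sY := sgR (h.yinj.ne hne.symm)
  have ha := h.abd s t hT
  have hb := h.bbd s t hT
  have ha1 : (-6 : ℝ) ≤ Λ.a s t := by exact_mod_cast ha.1
  have ha2 : (Λ.a s t : ℝ) ≤ 6 := by exact_mod_cast ha.2
  have hb1 : (-6 : ℝ) ≤ Λ.b s t := by exact_mod_cast hb.1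
  have hb2 : (Λ.b s t : ℝ) ≤ 6 := by exact_mod_cast hb.2
  intro c hc z hz
  simp only [pts] at hc
  split_ifs at hc with h0
  · simp only [polySegs, List.tail_cons, List.zip_cons_cons, List.zip_nil_right, List.mem_cons,
      List.not_mem_nil, or_false] at hc
    rcases hc with rfl | rfl | rfl
    · obtain ⟨e2, hb⟩ := mem_segH hz
      simp only [X, Y] at e2 hb
      push_cast at e2 hb
      by_cases hnear : (sg (Λ.x s) (Λ.x t) : ℝ) * (z.1 - Λ.X s) ≤ 20
      · left
        refine ⟨s, by simp [ERep.ends], sg (Λ.x s) (Λ.x t) * (z.1 - Λ.X s) / 20, ?_, by linarith,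
          ?_, ?_⟩
        · rcases sX with ⟨hl, hs⟩ | ⟨hl, hs⟩ <;> rw [hs] <;>
            simp only [X] <;> push_cast <;>
            rcases hb with hb | hb <;> linarith
        · simp only [dir, if_true]
          rcases sX with ⟨hl, hs⟩ | ⟨hl, hs⟩ <;> rw [hs] <;> push_cast <;> ring
        · simp [dir, h0, e2, Y]
      · right; left
        push Not at hnear
        refine ⟨⟨?_, hnear.le, ?_⟩, rfl⟩
        · rw [h0, e2]; simp [Y]
        · rcases sX with ⟨hl, hs⟩ | ⟨hl, hs⟩ <;> rw [hs] at hnear ⊢ <;>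
            simp only [X] at hnear ⊢ <;> push_cast at hnear ⊢ <;>
            rcases hb with hb | hb <;> linarith
    · obtain ⟨e1, hb⟩ := mem_segV hz
      simp only [X, Y] at e1 hb
      push_cast at e1 hb
      right; right
      refine ⟨⟨?_, ?_, ?_⟩, rfl⟩
      · rw [e1]; simp [X]
      all_goals
        simp only [h0, Y]
        rcases sY with ⟨hl, hs⟩ | ⟨hl, hs⟩ <;> rw [hs] at hb ⊢ <;>
            push_cast at hb ⊢ <;>
            rcases hb with hb | hb <;> linarith
    · obtain ⟨τ, t0, t1, e1, e2⟩ := mem_seg hz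
      left
      refine ⟨t, by simp [ERep.ends], 1 - τ, by linarith, by linarith, ?_, ?_⟩
      all_goals
        simp only [e1, e2, dir, if_neg hne.symm]
        push_cast
        ring
  · have hb0 : Λ.b s t = 0 := (h.ab s t hT).resolve_left h0
    simp only [polySegs, List.tail_cons, List.zip_cons_cons, List.zip_nil_right, List.mem_cons,
      List.not_mem_nil, or_false] at hc
    rcases hc with rfl | rfl | rfl
    · obtain ⟨τ, t0, t1, e1, e2⟩ := mem_seg hz
      left
      refine ⟨s, by simp [ERep.ends], τ, t0, t1, ?_, ?_⟩
      all_goals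
        simp only [e1, e2, dir, if_true]
        push_cast
        ring
    · obtain ⟨e1, hb⟩ := mem_segH hz
      simp only [X, Y] at e1 hb
      push_cast at e1 hb
      right; left
      refine ⟨⟨?_, ?_, ?_⟩, rfl⟩
      · rw [e1]; simp [Y]
      all_goals
        simp only [hb0, X]
        rcases sX with ⟨hl, hs⟩ | ⟨hl, hs⟩ <;> rw [hs] at hb ⊢ <;>
            push_cast at hb ⊢ <;>
            rcases hb with hb | hb <;> linarith
    · obtain ⟨e2, hb⟩ := mem_segV hz
      simp only [X, Y] at e2 hb
      push_cast at e2 hb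
      by_cases hnear : (sg (Λ.y t) (Λ.y s) : ℝ) * (z.2 - Λ.Y t) ≤ 20
      · left
        refine ⟨t, by simp [ERep.ends], sg (Λ.y t) (Λ.y s) * (z.2 - Λ.Y t) / 20, ?_, by linarith,
          ?_, ?_⟩
        · rcases sY with ⟨hl, hs⟩ | ⟨hl, hs⟩ <;> rw [hs] <;>
            simp only [Y] <;> push_cast <;>
            rcases hb with hb | hb <;> linarith
        · simp [dir, hb0, e2, X, hne.symm]
        · simp only [dir, if_neg hne.symm]
          rcases sY with ⟨hl, hs⟩ | ⟨hl, hs⟩ <;> rw [hs] <;> push_cast <;> ring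
      · right; right
        push Not at hnear
        refine ⟨⟨?_, hnear.le, ?_⟩, rfl⟩
        · rw [hb0, e2]; simp [X]
        · rcases sY with ⟨hl, hs⟩ | ⟨hl, hs⟩ <;> rw [hs] at hnear ⊢ <;>
            simp only [Y] at hnear ⊢ <;> push_cast at hnear ⊢ <;>
            rcases hb with hb | hb <;> linarith

end Lay

namespace Lay
variable {V : Type} {Λ : Lay V}

theorem clsA (h : Λ.OK) {u v : V} (hA : Λ.A u v) :
    ∀ c ∈ polySegs (Λ.pts (.A u v)), ∀ z ∈ segment ℝ c.1 c.2, Λ.Cls (.A u v) c.1 c.2 z := by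
  have hx := h.Adx u v hA
  have hne : u ≠ v := by rintro rfl; omega
  have hxR : (Λ.x v : ℝ) = Λ.x u + 1 := by exact_mod_cast hx
  have sY := sgR (h.yinj.ne hne)
  intro c hc z hz
  simp only [pts] at hc
  simp only [polySegs, List.tail_cons, List.zip_cons_cons, List.zip_nil_right, List.mem_cons,
      List.not_mem_nil, or_false] at hc
  rcases hc with rfl | rfl | rfl
  · obtain ⟨τ, t0, t1, e1, e2⟩ := mem_seg hz
    left
    refine ⟨u, by simp [ERep.ends], τ, t0, t1, ?_, ?_⟩
    all_goals
      simp only [e1, e2, dir, if_true]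
      push_cast
      ring
  · obtain ⟨e1, hb⟩ := mem_segV hz
    right; right
    refine ⟨⟨e1, ?_, ?_⟩, rfl⟩
    all_goals
      simp only [Y] at hb ⊢
      rcases sY with ⟨hl, hs⟩ | ⟨hl, hs⟩ <;> rw [hs] at hb ⊢ <;>
            push_cast at hb ⊢ <;>
            rcases hb with hb | hb <;> linarith
  · obtain ⟨τ, t0, t1, e1, e2⟩ := mem_seg hz
    left
    refine ⟨v, by simp [ERep.ends], 1 - τ, by linarith, by linarith, ?_, ?_⟩
    all_goals
      simp only [e1, e2, dir, if_neg hne.symm, X, Y]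
      push_cast
      try rw [hxR]
      ring

theorem clsB (h : Λ.OK) {u v : V} (hB : Λ.B u v) :
    ∀ c ∈ polySegs (Λ.pts (.B u v)), ∀ z ∈ segment ℝ c.1 c.2, Λ.Cls (.B u v) c.1 c.2 z := by
  have hy := h.Bdy u v hB
  have hne : u ≠ v := by rintro rfl; omega
  have hyR : (Λ.y v : ℝ) = Λ.y u + 1 := by exact_mod_cast hy
  have sX : ((Λ.x u : ℝ) + 2 ≤ Λ.x v ∧ sg (Λ.x u) (Λ.x v) = 1) ∨
      ((Λ.x v : ℝ) + 2 ≤ Λ.x u ∧ sg (Λ.x u) (Λ.x v) = -1) := by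
    rcases h.Bdx u v hB with h1 | h1
    · right; refine ⟨?_, if_neg (by omega)⟩
      have : Λ.x v + 2 ≤ Λ.x u := by omega
      exact_mod_cast this
    · left; refine ⟨?_, if_pos (by omega)⟩; exact_mod_cast h1
  intro c hc z hz
  simp only [pts] at hc
  simp only [polySegs, List.tail_cons, List.zip_cons_cons, List.zip_nil_right, List.mem_cons,
      List.not_mem_nil, or_false] at hc
  rcases hc with rfl | rfl | rfl
  · obtain ⟨τ, t0, t1, e1, e2⟩ := mem_seg hz
    left
    refine ⟨u, by simp [ERep.ends], τ, t0, t1, ?_, ?_⟩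
    all_goals
      simp only [e1, e2, dir, if_true]
      push_cast
      ring
  · obtain ⟨e1, hb⟩ := mem_segH hz
    right; left
    refine ⟨⟨e1, ?_, ?_⟩, rfl⟩
    all_goals
      simp only [X] at hb ⊢
      rcases sX with ⟨hl, hs⟩ | ⟨hl, hs⟩ <;> rw [hs] at hb ⊢ <;>
            push_cast at hb ⊢ <;>
            rcases hb with hb | hb <;> linarith
  · obtain ⟨τ, t0, t1, e1, e2⟩ := mem_seg hz
    left
    refine ⟨v, by simp [ERep.ends], 1 - τ, by linarith, by linarith, ?_, ?_⟩
    all_goals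
      simp only [e1, e2, dir, if_neg hne.symm, X, Y]
      push_cast
      try rw [hyR]
      ring

theorem cls (h : Λ.OK) {r : ERep V} (hr : r.ok Λ) :
    ∀ c ∈ polySegs (Λ.pts r), ∀ z ∈ segment ℝ c.1 c.2, Λ.Cls r c.1 c.2 z := by
  cases r with
  | L s t => exact clsL h hr
  | A s t => exact clsA h hr
  | B s t => exact clsB h hr
end Lay

namespace Lay
variable {V : Type} {Λ : Lay V}

/-- The possible germs at `w`. -/
inductive DirS (Λ : Lay V) (w : V) : ERep V → ℤ → ℤ → Prop
  | Ls (t : V) (σ : ℤ) : Λ.T w t → sg (Λ.x w) (Λ.x t) = σ → DirS Λ w (.L w t) (20 * σ) (Λ.a w t)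
  | Lt (s : V) (σ : ℤ) : Λ.T s w → sg (Λ.y w) (Λ.y s) = σ → DirS Λ w (.L s w) (Λ.b s w) (20 * σ)
  | Au (v : V) (σ : ℤ) : Λ.A w v → (σ = 1 ∨ σ = -1) → DirS Λ w (.A w v) 200 (190 * σ)
  | Av (u : V) (σ : ℤ) : Λ.A u w → (σ = 1 ∨ σ = -1) → DirS Λ w (.A u w) (-200) (190 * σ)
  | Bu (v : V) (σ : ℤ) : Λ.B w v → (σ = 1 ∨ σ = -1) → DirS Λ w (.B w v) (220 * σ) 200
  | Bv (u : V) (σ : ℤ) : Λ.B u w → (σ = 1 ∨ σ = -1) → DirS Λ w (.B u w) (220 * σ) (-200)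

theorem sg_pm (a b : ℤ) : sg a b = 1 ∨ sg a b = -1 := by
  rcases sg_cases a b with h | h
  · exact Or.inl h.2
  · exact Or.inr h.2

theorem dirS (h : Λ.OK) {r : ERep V} (hr : r.ok Λ) {w : V} (hw : w ∈ r.ends) :
    DirS Λ w r (Λ.dir r w).1 (Λ.dir r w).2 := by
  cases r with
  | L s t =>
    have hne := h.Tne s t hr
    simp only [ERep.ends, Sym2.mem_iff] at hw
    rcases hw with rfl | rfl
    · simp only [dir, if_true]
      exact .Ls _ _ hr rfl
    · simp only [dir, if_neg hne.symm]
      exact .Lt _ _ hr rfl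
  | A s t =>
    have hne : s ≠ t := by rintro rfl; have := h.Adx _ _ hr; omega
    simp only [ERep.ends, Sym2.mem_iff] at hw
    rcases hw with rfl | rfl
    · simp only [dir, if_true]
      exact .Au _ _ hr (sg_pm _ _)
    · simp only [dir, if_neg hne.symm]
      rw [show ∀ q : ℤ, -190 * q = 190 * (-q) by intro q; ring]
      refine .Av _ _ hr ?_
      have := sg_pm (Λ.y s) (Λ.y w); omega
  | B s t =>
    have hne : s ≠ t := by rintro rfl; have := h.Bdy _ _ hr; omega
    simp only [ERep.ends, Sym2.mem_iff] at hw
    rcases hw with rfl | rfl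
    · simp only [dir, if_true]
      exact .Bu _ _ hr (sg_pm _ _)
    · simp only [dir, if_neg hne.symm]
      rw [show ∀ q : ℤ, -220 * q = 220 * (-q) by intro q; ring]
      refine .Bv _ _ hr ?_
      have := sg_pm (Λ.x s) (Λ.x w); omega

theorem DirS.bound (h : Λ.OK) {w : V} {r : ERep V} {p q : ℤ} (hd : DirS Λ w r p q) :
    |p| ≤ 220 ∧ |q| ≤ 200 ∧ (|q| = 200 → (∃ v, Λ.B w v ∧ r = .B w v ∧ q = 200) ∨
      ∃ u, Λ.B u w ∧ r = .B u w ∧ q = -200) := by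
  cases hd with
  | Ls t σ hT hσ =>
    have := h.abd _ _ hT
    have := sg_pm (Λ.x w) (Λ.x t)
    rw [abs_le, abs_le]
    refine ⟨by omega, by omega, ?_⟩
    intro h0
    rcases abs_eq (by norm_num) |>.1 h0 with h0 | h0 <;> omega
  | Lt t σ hT hσ =>
    have := h.bbd _ _ hT
    have := sg_pm (Λ.y w) (Λ.y t)
    rw [abs_le, abs_le]
    refine ⟨by omega, by omega, ?_⟩
    intro h0
    rcases abs_eq (by norm_num) |>.1 h0 with h0 | h0 <;> omega
  | Au v σ hT hσ =>
    rw [abs_le, abs_le]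
    refine ⟨by omega, by omega, ?_⟩
    intro h0
    rcases abs_eq (by norm_num) |>.1 h0 with h0 | h0 <;> omega
  | Av v σ hT hσ =>
    rw [abs_le, abs_le]
    refine ⟨by omega, by omega, ?_⟩
    intro h0
    rcases abs_eq (by norm_num) |>.1 h0 with h0 | h0 <;> omega
  | Bu v σ hT hσ =>
    rw [abs_le, abs_le]
    exact ⟨by omega, by omega, fun _ => Or.inl ⟨v, hT, rfl, rfl⟩⟩
  | Bv v σ hT hσ =>
    rw [abs_le, abs_le]
    exact ⟨by omega, by omega, fun _ => Or.inr ⟨v, hT, rfl, rfl⟩⟩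

theorem A_u (h : Λ.OK) {u v v' : V} (h1 : Λ.A u v) (h2 : Λ.A u v') : v = v' :=
  h.xinj (by rw [h.Adx _ _ h1, h.Adx _ _ h2])
theorem A_v (h : Λ.OK) {u v u' : V} (h1 : Λ.A u v) (h2 : Λ.A u' v) : u = u' :=
  h.xinj (by have := h.Adx _ _ h1; have := h.Adx _ _ h2; omega)
theorem B_u (h : Λ.OK) {u v v' : V} (h1 : Λ.B u v) (h2 : Λ.B u v') : v = v' :=
  h.yinj (by rw [h.Bdy _ _ h1, h.Bdy _ _ h2])
theorem B_v (h : Λ.OK) {u v u' : V} (h1 : Λ.B u v) (h2 : Λ.B u' v) : u = u' :=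
  h.yinj (by have := h.Bdy _ _ h1; have := h.Bdy _ _ h2; omega)

/-- distinct germs at one vertex are not positively parallel -/
theorem DirS.sep (h : Λ.OK) {w : V} {r r' : ERep V} {p q p' q' : ℤ} (hd : DirS Λ w r p q)
    (hd' : DirS Λ w r' p' q') (hne : r ≠ r') : p * q' - q * p' ≠ 0 ∨ p * p' + q * q' < 0 := by
  cases hd with
  | Ls t σ hT hσ =>
    have ha := h.abd _ _ hT
    have hs := sg_pm (Λ.x w) (Λ.x t)
    cases hd' with
    | Ls t' σ' hT' hσ' =>
      have ha' := h.abd _ _ hT'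
      have hs' := sg_pm (Λ.x w) (Λ.x t')
      have htt : t ≠ t' := by rintro rfl; exact hne rfl
      have := h.ane w t t' hT hT' htt
      rw [hσ] at hs this
      rw [hσ'] at hs' this
      rcases hs with rfl | rfl <;> rcases hs' with rfl | rfl
      · left; have := this rfl; omega
      · right; nlinarith
      · right; nlinarith
      · left; have := this rfl; omega
    | Lt t' σ' hT' hσ' =>
      have hb' := h.bbd _ _ hT'
      have hs' := sg_pm (Λ.y w) (Λ.y t')
      rw [hσ] at hs
      rw [hσ'] at hs'
      left
      have hab : |Λ.a w t * Λ.b t' w| ≤ 36 := by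
        rw [abs_mul]
        have h1 := abs_le.2 ha; have h2 := abs_le.2 hb'
        nlinarith [abs_nonneg (Λ.a w t), abs_nonneg (Λ.b t' w)]
      rw [abs_le] at hab
      rcases hs with rfl | rfl <;> rcases hs' with rfl | rfl <;> omega
    | _ => 
      rename_i σ' _ hs'
      left
      rw [hσ] at hs
      rcases hs with rfl | rfl <;> rcases hs' with rfl | rfl <;> omega
  | Lt t σ hT hσ =>
    have ha := h.bbd _ _ hT
    have hs := sg_pm (Λ.y w) (Λ.y t)
    cases hd' with
    | Lt t' σ' hT' hσ' =>
      have ha' := h.bbd _ _ hT'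
      have hs' := sg_pm (Λ.y w) (Λ.y t')
      have htt : t ≠ t' := by rintro rfl; exact hne rfl
      have := h.bne t t' w hT hT' htt
      rw [hσ] at hs this
      rw [hσ'] at hs' this
      rcases hs with rfl | rfl <;> rcases hs' with rfl | rfl
      · left; have := this rfl; omega
      · right; nlinarith
      · right; nlinarith
      · left; have := this rfl; omega
    | Ls t' σ' hT' hσ' =>
      have hb' := h.abd _ _ hT'
      have hs' := sg_pm (Λ.x w) (Λ.x t')
      rw [hσ] at hs
      rw [hσ'] at hs'
      left
      have hab : |Λ.b t w * Λ.a w t'| ≤ 36 := by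
        rw [abs_mul]
        have h1 := abs_le.2 ha; have h2 := abs_le.2 hb'
        nlinarith [abs_nonneg (Λ.a w t'), abs_nonneg (Λ.b t w)]
      rw [abs_le] at hab
      rcases hs with rfl | rfl <;> rcases hs' with rfl | rfl <;> omega
    | _ => 
      rename_i σ' _ hs'
      left
      rw [hσ] at hs
      rcases hs with rfl | rfl <;> rcases hs' with rfl | rfl <;> omega
  | Au v σ hT hs =>
    cases hd' with
    | Ls t' σ' hT' hσ' =>
      have hb' := h.abd _ _ hT'
      have hs' := sg_pm (Λ.x w) (Λ.x t')
      rw [hσ'] at hs'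
      left; rcases hs with rfl | rfl <;> rcases hs' with rfl | rfl <;> omega
    | Lt t' σ' hT' hσ' =>
      have hb' := h.bbd _ _ hT'
      have hs' := sg_pm (Λ.y w) (Λ.y t')
      rw [hσ'] at hs'
      left; rcases hs with rfl | rfl <;> rcases hs' with rfl | rfl <;> omega
    | Au t' σ' hT' hs' => exact absurd (by rw [A_u h hT hT']) hne
    | Av t' σ' hT' hs' =>
      right; rcases hs with rfl | rfl <;> rcases hs' with rfl | rfl <;> omega
    | _ =>
      rename_i σ' _ hs'
      left; rcases hs with rfl | rfl <;> rcases hs' with rfl | rfl <;> omega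
  | Av v σ hT hs =>
    cases hd' with
    | Ls t' σ' hT' hσ' =>
      have hb' := h.abd _ _ hT'
      have hs' := sg_pm (Λ.x w) (Λ.x t')
      rw [hσ'] at hs'
      left; rcases hs with rfl | rfl <;> rcases hs' with rfl | rfl <;> omega
    | Lt t' σ' hT' hσ' =>
      have hb' := h.bbd _ _ hT'
      have hs' := sg_pm (Λ.y w) (Λ.y t')
      rw [hσ'] at hs'
      left; rcases hs with rfl | rfl <;> rcases hs' with rfl | rfl <;> omega
    | Av t' σ' hT' hs' => exact absurd (by rw [A_v h hT hT']) hne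
    | Au t' σ' hT' hs' =>
      right; rcases hs with rfl | rfl <;> rcases hs' with rfl | rfl <;> omega
    | _ =>
      rename_i σ' _ hs'
      left; rcases hs with rfl | rfl <;> rcases hs' with rfl | rfl <;> omega
  | Bu v σ hT hs =>
    cases hd' with
    | Ls t' σ' hT' hσ' =>
      have hb' := h.abd _ _ hT'
      have hs' := sg_pm (Λ.x w) (Λ.x t')
      rw [hσ'] at hs'
      left; rcases hs with rfl | rfl <;> rcases hs' with rfl | rfl <;> omega
    | Lt t' σ' hT' hσ' =>
      have hb' := h.bbd _ _ hT'
      have hs' := sg_pm (Λ.y w) (Λ.y t')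
      rw [hσ'] at hs'
      left; rcases hs with rfl | rfl <;> rcases hs' with rfl | rfl <;> omega
    | Bu t' σ' hT' hs' => exact absurd (by rw [B_u h hT hT']) hne
    | _ =>
      rename_i σ' _ hs'
      rcases hs with rfl | rfl <;> rcases hs' with rfl | rfl <;> omega
  | Bv v σ hT hs =>
    cases hd' with
    | Ls t' σ' hT' hσ' =>
      have hb' := h.abd _ _ hT'
      have hs' := sg_pm (Λ.x w) (Λ.x t')
      rw [hσ'] at hs'
      left; rcases hs with rfl | rfl <;> rcases hs' with rfl | rfl <;> omega
    | Lt t' σ' hT' hσ' =>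
      have hb' := h.bbd _ _ hT'
      have hs' := sg_pm (Λ.y w) (Λ.y t')
      rw [hσ'] at hs'
      left; rcases hs with rfl | rfl <;> rcases hs' with rfl | rfl <;> omega
    | Bv t' σ' hT' hs' => exact absurd (by rw [B_v h hT hT']) hne
    | _ =>
      rename_i σ' _ hs'
      rcases hs with rfl | rfl <;> rcases hs' with rfl | rfl <;> omega
end Lay

namespace Lay
variable {V : Type} {Λ : Lay V}

theorem germ_bd {θ : ℝ} {d B : ℤ} (h0 : 0 ≤ θ) (h1 : θ ≤ 1) (hd : |d| ≤ B) :
    -(B : ℝ) ≤ θ * d ∧ θ * d ≤ B := by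
  rw [abs_le] at hd
  have a1 : (-B : ℝ) ≤ d := by exact_mod_cast hd.1
  have a2 : (d : ℝ) ≤ B := by exact_mod_cast hd.2
  constructor <;> nlinarith

theorem germ_germ (h : Λ.OK) {r r' : ERep V} (hr : r.ok Λ) (hr' : r'.ok Λ) (hne : r ≠ r')
    {w w' : V} (hw : w ∈ r.ends) (hw' : w' ∈ r'.ends) {z : Pt} (hz : Λ.Germ r w z)
    (hz' : Λ.Germ r' w' z) : w = w' ∧ z = Λ.pt w := by
  have hd := dirS h hr hw
  have hd' := dirS h hr' hw'
  obtain ⟨θ, t0, t1, e1, e2⟩ := hz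
  obtain ⟨θ', t0', t1', e1', e2'⟩ := hz'
  generalize (Λ.dir r w).1 = p at *
  generalize (Λ.dir r w).2 = q at *
  generalize (Λ.dir r' w').1 = p' at *
  generalize (Λ.dir r' w').2 = q' at *
  obtain ⟨hp, hq, hB⟩ := hd.bound h
  obtain ⟨hp', hq', hB'⟩ := hd'.bound h
  have g2 := germ_bd t0 t1 hq
  have g2' := germ_bd t0' t1' hq'
  simp only [X, Y] at e1 e2 e1' e2'
  push_cast at g2 g2' e1 e2 e1' e2'
  by_cases hww : w = w'
  · subst hww
    refine ⟨rfl, ?_⟩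
    have E1 : θ * p = θ' * p' := by linarith
    have E2 : θ * q = θ' * q' := by linarith
    have hθ : θ = 0 ∨ (p : ℝ) = 0 ∧ (q : ℝ) = 0 := by
      rcases hd.sep h hd' hne with hs | hs
      · have hs' : (p * q' - q * p' : ℝ) ≠ 0 := by exact_mod_cast hs
        have : θ * (p * q' - q * p' : ℝ) = 0 := by
          linear_combination E1 * q' - E2 * p'
        left; exact (mul_eq_zero.1 this).resolve_right hs'
      · have hs' : (p * p' + q * q' : ℝ) < 0 := by exact_mod_cast hs
        have e3 : θ * (p ^ 2 + q ^ 2 : ℝ) = θ' * (p * p' + q * q') := by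
          linear_combination p * E1 + q * E2
        have : θ * (p ^ 2 + q ^ 2 : ℝ) ≤ 0 := by rw [e3]; nlinarith
        by_cases h0 : θ = 0
        · exact Or.inl h0
        · right
          have hpos : 0 < θ := lt_of_le_of_ne t0 (Ne.symm h0)
          have : (p ^ 2 + q ^ 2 : ℝ) ≤ 0 := by
            by_contra hc
            push Not at hc
            nlinarith [mul_pos hpos hc]
          constructor <;> nlinarith [sq_nonneg (p : ℝ), sq_nonneg (q : ℝ)]
    have : θ * p = 0 ∧ θ * q = 0 := by
      rcases hθ with h0 | ⟨h0, h1⟩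
      · simp [h0]
      · simp [h0, h1]
    apply Prod.ext
    · simp [pt, ip, X, e1, this.1]
    · simp [pt, ip, Y, e2, this.2]
  · exfalso
    have key : ∀ {w w' : V} {r r' : ERep V} {p q p' q' : ℤ} {θ θ' : ℝ}, r ≠ r' →
        Λ.y w + 1 ≤ Λ.y w' → DirS Λ w r p q → DirS Λ w' r' p' q' → 0 ≤ θ → θ ≤ 1 → 0 ≤ θ' →
        θ' ≤ 1 → (400 * (Λ.y w : ℝ) + θ * q = 400 * (Λ.y w' : ℝ) + θ' * q') → False := by
      clear * - h
      intro w w' r r' p q p' q' θ θ' hne hy hd hd' t0 t1 t0' t1' e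
      obtain ⟨hp, hq, hB⟩ := hd.bound h
      obtain ⟨hp', hq', hB'⟩ := hd'.bound h
      have g2 := germ_bd t0 t1 hq
      have g2' := germ_bd t0' t1' hq'
      rw [abs_le] at hq hq'
      have hyR : (Λ.y w : ℝ) + 1 ≤ Λ.y w' := by exact_mod_cast hy
      push_cast at g2 g2'
      have hq200 : q = 200 := by
        by_contra hc
        have : q ≤ 199 := by omega
        have : (q : ℝ) ≤ 199 := by exact_mod_cast this
        have : θ * q < 200 := by nlinarith
        linarith
      have hq200' : q' = -200 := by
        by_contra hc
        have : -199 ≤ q' := by omega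
        have : (-199 : ℝ) ≤ q' := by exact_mod_cast this
        have : -200 < θ' * q' := by nlinarith
        linarith
      have hyy : Λ.y w' = Λ.y w + 1 := by
        have : (Λ.y w' : ℝ) ≤ Λ.y w + 1 := by linarith
        have : Λ.y w' ≤ Λ.y w + 1 := by exact_mod_cast this
        omega
      rcases hB (by rw [hq200]; rfl) with ⟨v, hv, rfl, -⟩ | ⟨_, _, _, h3⟩
      · rcases hB' (by rw [hq200']; rfl) with ⟨_, _, _, h3⟩ | ⟨u, hu, rfl, -⟩
        · omega
        · have e1 : v = w' := h.yinj (by rw [h.Bdy _ _ hv, hyy])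
          subst e1
          exact hne (by rw [B_v h hv hu])
      · omega
    rcases h.ygap hww with hy | hy
    · exact key hne hy hd hd' t0 t1 t0' t1' (by linarith)
    · exact key hne.symm hy hd' hd t0' t1' t0 t1 (by linarith)

theorem vgapR {a b : ℤ} (h : a ≠ b) : (a : ℝ) + 1 ≤ b ∨ (b : ℝ) + 1 ≤ a := by
  rcases sgR h with h | h
  · exact Or.inl h.1
  · exact Or.inr h.1

theorem germ_Hp (h : Λ.OK) {r r' : ERep V} (hr : r.ok Λ) (hr' : r'.ok Λ) (hne : r ≠ r')
    {w : V} (hw : w ∈ r.ends) {z : Pt} (hz : Λ.Germ r w z)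
    (hz' : Λ.Hp r' z) : False := by
  have hd := dirS h hr hw
  obtain ⟨θ, t0, t1, e1, e2⟩ := hz
  generalize (Λ.dir r w).1 = p at *
  generalize (Λ.dir r w).2 = q at *
  obtain ⟨hp, hq, hB⟩ := hd.bound h
  have g1 := germ_bd t0 t1 hp
  have g2 := germ_bd t0 t1 hq
  rw [abs_le] at hp hq
  cases r' with
  | A u v => exact hz'
  | L s t =>
    obtain ⟨f1, f2, f3⟩ := hz'
    have ha := h.abd _ _ hr'
    have ha1 : (-6 : ℝ) ≤ Λ.a s t := by exact_mod_cast ha.1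
    have ha2 : (Λ.a s t : ℝ) ≤ 6 := by exact_mod_cast ha.2
    simp only [X, Y] at e1 e2 f1 f2 f3
    push_cast at g1 g2 e1 e2 f1 f2 f3
    by_cases hws : w = s
    · subst hws
      have E2 : θ * q = Λ.a w t := by linarith
      have E1 : 20 ≤ (sg (Λ.x w) (Λ.x t) : ℝ) * (θ * p) := by rw [e1] at f2; linarith
      have hs' := sg_pm (Λ.x w) (Λ.x t)
      cases hd with
      | Ls t' σ hT hσ =>
        have htt : t' ≠ t := by rintro rfl; exact hne rfl
        have hs := sg_pm (Λ.x w) (Λ.x t')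
        have ht1 : θ = 1 ∧ sg (Λ.x w) (Λ.x t') = sg (Λ.x w) (Λ.x t) := by
          rw [hσ] at hs ⊢
          rcases hs with rfl | rfl <;> rcases hs' with h1 | h1 <;> rw [h1] at E1 ⊢ <;>
            push_cast at E1 <;> first | exact ⟨by linarith, rfl⟩ | (exfalso; linarith)
        refine h.ane _ _ _ hT hr' htt ht1.2 ?_
        have : (Λ.a w t' : ℝ) = Λ.a w t := by rw [← E2, ht1.1, one_mul]
        exact_mod_cast this
      | Lt s σ hT hσ =>
        have hb := h.bbd _ _ hT
        have hb' := germ_bd t0 t1 (abs_le.2 hb)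
        push_cast at hb'
        rcases hs' with h1 | h1 <;> rw [h1] at E1 <;> push_cast at E1 <;> linarith
      | _ =>
        rename_i σ _ hs
        rcases hs with rfl | rfl <;> rcases hs' with h1 | h1 <;> rw [h1] at E1 <;>
          push_cast at E1 E2 <;> linarith
    · rcases vgapR (h.yinj.ne hws) with hy | hy <;> linarith
  | B u v =>
    obtain ⟨f1, f2, f3⟩ := hz'
    simp only [X, Y] at e1 e2 f1 f2 f3
    push_cast at g1 g2 e1 e2 f1 f2 f3
    have c1 : Λ.y u ≤ Λ.y w := by
      by_contra hc
      have : Λ.y w + 1 ≤ Λ.y u := by omega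
      have : (Λ.y w : ℝ) + 1 ≤ Λ.y u := by exact_mod_cast this
      linarith
    have c2 : Λ.y w ≤ Λ.y u + 1 := by
      by_contra hc
      have : Λ.y u + 2 ≤ Λ.y w := by omega
      have : (Λ.y u : ℝ) + 2 ≤ Λ.y w := by exact_mod_cast this
      linarith
    have c3 : Λ.y w = Λ.y u ∨ Λ.y w = Λ.y u + 1 := by omega
    rcases c3 with c | c
    · have := h.yinj c
      subst this
      have hq200 : q = 200 := by
        by_contra hc
        have : q ≤ 199 := by omega
        have : (q : ℝ) ≤ 199 := by exact_mod_cast this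
        have : θ * q < 200 := by nlinarith
        linarith
      rcases hB (by rw [hq200]; rfl) with ⟨v', hv, rfl, -⟩ | ⟨_, _, _, h3⟩
      · exact hne (by rw [B_u h hv hr'])
      · omega
    · have : w = v := h.yinj (by rw [c, h.Bdy _ _ hr'])
      subst this
      have cR : (Λ.y w : ℝ) = Λ.y u + 1 := by exact_mod_cast c
      have hq200' : q = -200 := by
        by_contra hc
        have : -199 ≤ q := by omega
        have : (-199 : ℝ) ≤ q := by exact_mod_cast this
        have : -200 < θ * q := by nlinarith
        linarith
      rcases hB (by rw [hq200']; rfl) with ⟨_, _, _, h3⟩ | ⟨u, hu, rfl, -⟩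
      · omega
      · exact hne (by rw [B_v h hu hr'])

theorem germ_Vp (h : Λ.OK) {r r' : ERep V} (hr : r.ok Λ) (hr' : r'.ok Λ) (hne : r ≠ r')
    {w : V} (hw : w ∈ r.ends) {z : Pt} (hz : Λ.Germ r w z)
    (hz' : Λ.Vp r' z) : False := by
  have hd := dirS h hr hw
  obtain ⟨θ, t0, t1, e1, e2⟩ := hz
  generalize (Λ.dir r w).1 = p at *
  generalize (Λ.dir r w).2 = q at *
  obtain ⟨hp, hq, hB⟩ := hd.bound h
  have g1 := germ_bd t0 t1 hp
  have g2 := germ_bd t0 t1 hq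
  rw [abs_le] at hp hq
  cases r' with
  | B u v => exact hz'
  | L s t =>
    obtain ⟨f1, f2, f3⟩ := hz'
    have ha := h.bbd _ _ hr'
    have ha1 : (-6 : ℝ) ≤ Λ.b s t := by exact_mod_cast ha.1
    have ha2 : (Λ.b s t : ℝ) ≤ 6 := by exact_mod_cast ha.2
    simp only [X, Y] at e1 e2 f1 f2 f3
    push_cast at g1 g2 e1 e2 f1 f2 f3
    by_cases hws : w = t
    · subst hws
      have E2 : θ * p = Λ.b s w := by linarith
      have E1 : 20 ≤ (sg (Λ.y w) (Λ.y s) : ℝ) * (θ * q) := by rw [e2] at f2; linarith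
      have hs' := sg_pm (Λ.y w) (Λ.y s)
      cases hd with
      | Lt t' σ hT hσ =>
        have htt : t' ≠ s := by rintro rfl; exact hne rfl
        have hs := sg_pm (Λ.y w) (Λ.y t')
        have ht1 : θ = 1 ∧ sg (Λ.y w) (Λ.y t') = sg (Λ.y w) (Λ.y s) := by
          rw [hσ] at hs ⊢
          rcases hs with rfl | rfl <;> rcases hs' with h1 | h1 <;> rw [h1] at E1 ⊢ <;>
            push_cast at E1 <;> first | exact ⟨by linarith, rfl⟩ | (exfalso; linarith)
        refine h.bne _ _ _ hT hr' htt ht1.2 ?_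
        have : (Λ.b t' w : ℝ) = Λ.b s w := by rw [← E2, ht1.1, one_mul]
        exact_mod_cast this
      | Ls s σ hT hσ =>
        have hb := h.abd _ _ hT
        have hb' := germ_bd t0 t1 (abs_le.2 hb)
        push_cast at hb'
        rcases hs' with h1 | h1 <;> rw [h1] at E1 <;> push_cast at E1 <;> linarith
      | _ =>
        rename_i σ _ hs
        rcases hs with rfl | rfl <;> rcases hs' with h1 | h1 <;> rw [h1] at E1 <;>
          push_cast at E1 E2 <;> linarith
    · rcases vgapR (h.xinj.ne hws) with hy | hy <;> linarith
  | A u v =>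
    obtain ⟨f1, f2, f3⟩ := hz'
    have hx := h.Adx _ _ hr'
    simp only [X, Y] at e1 e2 f1 f2 f3
    push_cast at g1 g2 e1 e2 f1 f2 f3
    have c1 : Λ.x u ≤ Λ.x w := by
      by_contra hc
      have : Λ.x w + 1 ≤ Λ.x u := by omega
      have : (Λ.x w : ℝ) + 1 ≤ Λ.x u := by exact_mod_cast this
      linarith
    have c2 : Λ.x w ≤ Λ.x u + 1 := by
      by_contra hc
      have : Λ.x u + 2 ≤ Λ.x w := by omega
      have : (Λ.x u : ℝ) + 2 ≤ Λ.x w := by exact_mod_cast this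
      linarith
    have hs' := sg_pm (Λ.y u) (Λ.y v)
    have c3 : Λ.x w = Λ.x u ∨ Λ.x w = Λ.x u + 1 := by omega
    rcases c3 with c | c
    · have := h.xinj c
      subst this
      have E1 : θ * p = 200 := by linarith
      cases hd with
      | Au v' σ hT hs => exact hne (by rw [A_u h hT hr'])
      | Lt s σ hT hσ =>
        have hb' := germ_bd t0 t1 (abs_le.2 (h.bbd _ _ hT))
        push_cast at hb'
        linarith
      | Ls s σ hT hσ =>
        have hs := sg_pm (Λ.x w) (Λ.x s)
        rw [hσ] at hs
        rcases hs with rfl | rfl <;> push_cast at E1 <;> linarith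
      | Av v' σ hT hs => push_cast at E1; linarith
      | _ =>
        rename_i σ _ hs
        rcases hs with rfl | rfl <;> rcases hs' with h1 | h1 <;> rw [h1] at f2 <;>
          push_cast at E1 f2 e2 <;> linarith
    · have : w = v := h.xinj (by rw [c, hx])
      subst this
      have cR : (Λ.x w : ℝ) = Λ.x u + 1 := by exact_mod_cast c
      have E1 : θ * p = -200 := by linarith
      cases hd with
      | Av v' σ hT hs => exact hne (by rw [A_v h hT hr'])
      | Lt s σ hT hσ =>
        have hb' := germ_bd t0 t1 (abs_le.2 (h.bbd _ _ hT))
        push_cast at hb'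
        linarith
      | Ls s σ hT hσ =>
        have hs := sg_pm (Λ.x w) (Λ.x s)
        rw [hσ] at hs
        rcases hs with rfl | rfl <;> push_cast at E1 <;> linarith
      | Au v' σ hT hs => push_cast at E1; linarith
      | _ =>
        rename_i σ _ hs
        rcases hs with rfl | rfl <;> rcases hs' with h1 | h1 <;> rw [h1] at f3 <;>
          push_cast at E1 f3 e2 <;> linarith
end Lay

namespace Lay
variable {V : Type} {Λ : Lay V}

theorem Hp_Hp (h : Λ.OK) {r r' : ERep V} (hr : r.ok Λ) (hr' : r'.ok Λ) (hne : r ≠ r')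
    {z : Pt} (hz : Λ.Hp r z) (hz' : Λ.Hp r' z) : False := by
  cases r with
  | A u v => exact hz
  | L s t =>
    have ha := h.abd _ _ hr
    obtain ⟨f1, f2, f3⟩ := hz
    cases r' with
    | A u v => exact hz'
    | L s' t' =>
      have ha' := h.abd _ _ hr'
      obtain ⟨f1', f2', f3'⟩ := hz'
      rw [f1] at f1'
      norm_cast at f1'
      simp only [Y] at f1'
      have e : Λ.y s = Λ.y s' := by omega
      have := h.yinj e
      subst this
      have htt : t ≠ t' := by rintro rfl; exact hne rfl
      have hs := sg_pm (Λ.x s) (Λ.x t)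
      have hs' := sg_pm (Λ.x s) (Λ.x t')
      refine h.ane _ _ _ hr hr' htt ?_ (by omega)
      rcases hs with h1 | h1 <;> rcases hs' with h2 | h2 <;> rw [h1] at f2 ⊢ <;>
        rw [h2] at f2' ⊢ <;> push_cast at f2 f2' <;> (exfalso; linarith)
    | B u v =>
      obtain ⟨f1', f2', f3'⟩ := hz'
      rw [f1] at f1'
      norm_cast at f1'
      simp only [Y] at f1'
      omega
  | B u v =>
    obtain ⟨f1, f2, f3⟩ := hz
    cases r' with
    | A u v => exact hz'
    | L s' t' =>
      have ha' := h.abd _ _ hr'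
      obtain ⟨f1', f2', f3'⟩ := hz'
      rw [f1] at f1'
      norm_cast at f1'
      simp only [Y] at f1'
      omega
    | B u' v' =>
      obtain ⟨f1', f2', f3'⟩ := hz'
      rw [f1] at f1'
      norm_cast at f1'
      simp only [Y] at f1'
      have e : Λ.y u = Λ.y u' := by omega
      have := h.yinj e
      subst this
      exact hne (by rw [B_u h hr hr'])

theorem Vp_Vp (h : Λ.OK) {r r' : ERep V} (hr : r.ok Λ) (hr' : r'.ok Λ) (hne : r ≠ r')
    {z : Pt} (hz : Λ.Vp r z) (hz' : Λ.Vp r' z) : False := by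
  cases r with
  | B u v => exact hz
  | L s t =>
    have ha := h.bbd _ _ hr
    obtain ⟨f1, f2, f3⟩ := hz
    cases r' with
    | B u v => exact hz'
    | L s' t' =>
      have ha' := h.bbd _ _ hr'
      obtain ⟨f1', f2', f3'⟩ := hz'
      rw [f1] at f1'
      norm_cast at f1'
      simp only [X] at f1'
      have e : Λ.x t = Λ.x t' := by omega
      have := h.xinj e
      subst this
      have htt : s ≠ s' := by rintro rfl; exact hne rfl
      have hs := sg_pm (Λ.y t) (Λ.y s)
      have hs' := sg_pm (Λ.y t) (Λ.y s')
      refine h.bne _ _ _ hr hr' htt ?_ (by omega)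
      rcases hs with h1 | h1 <;> rcases hs' with h2 | h2 <;> rw [h1] at f2 ⊢ <;>
        rw [h2] at f2' ⊢ <;> push_cast at f2 f2' <;> (exfalso; linarith)
    | A u v =>
      obtain ⟨f1', f2', f3'⟩ := hz'
      rw [f1] at f1'
      norm_cast at f1'
      simp only [X] at f1'
      omega
  | A u v =>
    obtain ⟨f1, f2, f3⟩ := hz
    cases r' with
    | B u v => exact hz'
    | L s' t' =>
      have ha' := h.bbd _ _ hr'
      obtain ⟨f1', f2', f3'⟩ := hz'
      rw [f1] at f1'
      norm_cast at f1'
      simp only [X] at f1'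
      omega
    | A u' v' =>
      obtain ⟨f1', f2', f3'⟩ := hz'
      rw [f1] at f1'
      norm_cast at f1'
      simp only [X] at f1'
      have e : Λ.x u = Λ.x u' := by omega
      have := h.xinj e
      subst this
      exact hne (by rw [A_u h hr hr'])

theorem sgI {a b : ℤ} (h : a ≠ b) : (a < b ∧ sg a b = 1) ∨ (b < a ∧ sg a b = -1) := by
  rcases sg_cases a b with h1 | h1
  · exact Or.inl h1
  · exact Or.inr ⟨by omega, h1.2⟩

/-- a horizontal and a vertical part of edges with a common vertex are disjoint -/
theorem Hp_Vp (h : Λ.OK) {r r' : ERep V} (hr : r.ok Λ) (hr' : r'.ok Λ) (hne : r.ends ≠ r'.ends)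
    {w : V} (hw : w ∈ r.ends) (hw' : w ∈ r'.ends)
    {z : Pt} (hz : Λ.Hp r z) (hz' : Λ.Vp r' z) : False := by
  cases r with
  | A u v => exact hz
  | L s t =>
    have ha := h.abd _ _ hr
    have hb := h.bbd _ _ hr
    have hst := h.Tne _ _ hr
    have sx := sgI (h.xinj.ne hst)
    obtain ⟨f1, f2, f3⟩ := hz
    cases r' with
    | B u v => exact hz'
    | L s' t' =>
      have ha' := h.abd _ _ hr'
      have hb' := h.bbd _ _ hr'
      have hst' := h.Tne _ _ hr'
      have sy := sgI (h.yinj.ne hst'.symm)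
      obtain ⟨g1, g2, g3⟩ := hz'
      rw [g1] at f2 f3
      rw [f1] at g2 g3
      norm_cast at f2 f3 g2 g3
      simp only [X, Y] at f2 f3 g2 g3
      simp only [ERep.ends, Sym2.mem_iff] at hw hw'
      rcases hw with rfl | rfl <;> rcases hw' with rfl | rfl
      · -- s = s'
        have htt : t ≠ t' := by rintro rfl; exact hne rfl
        have hx := h.xinj.ne htt
        have := h.aord w t' t hr' hr
        rcases sx with ⟨l1, l2⟩ | ⟨l1, l2⟩ <;> rcases sy with ⟨m1, m2⟩ | ⟨m1, m2⟩ <;>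
          rw [l2] at this f2 f3 <;> rw [m2] at g2 g3 <;>
          rcases sg_cases (Λ.x w) (Λ.x t') with ⟨k1, k2⟩ | ⟨k1, k2⟩ <;> rw [k2] at this
        all_goals first
          | (exfalso; omega)
          | (have := this rfl (by
              first
              | (rw [abs_of_pos (by omega), abs_of_pos (by omega)]; omega)
              | (rw [abs_of_neg (by omega), abs_of_neg (by omega)]; omega))
             omega)
      · -- s = t'
        rcases sx with ⟨l1, l2⟩ | ⟨l1, l2⟩ <;> rw [l2] at f2 <;> omega
      · -- t = s'
        have hts : t' ≠ s := by rintro rfl; exact hne (by simp [ERep.ends, Sym2.eq_swap])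
        have hx := h.xinj.ne hts
        have hy := h.yinj.ne hts
        have := h.conf w t' s (Or.inl ⟨hr', Or.inl hr⟩)
        have hx' := h.xinj.ne hst'
        have hy' := h.yinj.ne hst
        rcases sx with ⟨l1, l2⟩ | ⟨l1, l2⟩ <;> rcases sy with ⟨m1, m2⟩ | ⟨m1, m2⟩ <;>
          rw [l2] at f2 f3 <;> rw [m2] at g2 g3 <;>
          rcases sgI hx' with ⟨k1, k2⟩ | ⟨k1, k2⟩ <;>
          rcases sgI hy' with ⟨n1, n2⟩ | ⟨n1, n2⟩
        all_goals first
          | (exfalso; omega)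
          | (refine this ?_ ?_ ?_ ?_
             · unfold sg; split_ifs <;> omega
             · unfold sg; split_ifs <;> omega
             · first
               | (rw [abs_of_pos (by omega), abs_of_pos (by omega)]; omega)
               | (rw [abs_of_neg (by omega), abs_of_neg (by omega)]; omega)
             · first
               | (rw [abs_of_pos (by omega), abs_of_pos (by omega)]; omega)
               | (rw [abs_of_neg (by omega), abs_of_neg (by omega)]; omega))
      · -- t = t'
        have htt : s ≠ s' := by rintro rfl; exact hne rfl
        have hx := h.yinj.ne htt
        have := h.bord s s' w hr hr'
        rcases sx with ⟨l1, l2⟩ | ⟨l1, l2⟩ <;> rcases sy with ⟨m1, m2⟩ | ⟨m1, m2⟩ <;>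
          rw [l2] at f2 f3 <;> rw [m2] at g2 g3 this <;>
          rcases sg_cases (Λ.y w) (Λ.y s) with ⟨k1, k2⟩ | ⟨k1, k2⟩ <;> rw [k2] at this
        all_goals first
          | (exfalso; omega)
          | (have := this rfl (by
              first
              | (rw [abs_of_pos (by omega), abs_of_pos (by omega)]; omega)
              | (rw [abs_of_neg (by omega), abs_of_neg (by omega)]; omega))
             omega)
    | A u v =>
      have hx := h.Adx _ _ hr'
      have huv : u ≠ v := by rintro rfl; omega
      have sy := sgI (h.yinj.ne huv)
      obtain ⟨g1, g2, g3⟩ := hz'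
      rw [g1] at f2 f3
      rw [f1] at g2 g3
      norm_cast at f2 f3 g2 g3
      simp only [X, Y] at f2 f3 g2 g3
      simp only [ERep.ends, Sym2.mem_iff] at hw hw'
      have hyst := h.yinj.ne hst
      rcases hw with rfl | rfl
      · rcases hw' with rfl | rfl <;> rcases sy with ⟨m1, m2⟩ | ⟨m1, m2⟩ <;>
          rw [m2] at g2 g3 <;> omega
      · rcases hw' with rfl | rfl
        · have htt : s ≠ v := by rintro rfl; exact hne (by simp [ERep.ends, Sym2.eq_swap])
          have hxx := h.xinj.ne htt
          have hyy := h.yinj.ne htt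
          have := h.conf w v s (Or.inr ⟨Or.inl hr', hr⟩)
          rcases sx with ⟨l1, l2⟩ | ⟨l1, l2⟩ <;> rcases sy with ⟨m1, m2⟩ | ⟨m1, m2⟩ <;>
            rw [l2] at f2 f3 <;> rw [m2] at g2 g3
          all_goals first
          | (exfalso; omega)
          | (refine this ?_ ?_ ?_ ?_
             · unfold sg; split_ifs <;> omega
             · unfold sg; split_ifs <;> omega
             · first
               | (rw [abs_of_pos (by omega), abs_of_pos (by omega)]; omega)
               | (rw [abs_of_neg (by omega), abs_of_neg (by omega)]; omega)
             · first
               | (rw [abs_of_pos (by omega), abs_of_pos (by omega)]; omega)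
               | (rw [abs_of_neg (by omega), abs_of_neg (by omega)]; omega))
        · have htt : s ≠ u := by rintro rfl; exact hne (by simp [ERep.ends])
          have hxx := h.xinj.ne htt
          have hyy := h.yinj.ne htt
          have := h.conf w u s (Or.inr ⟨Or.inr hr', hr⟩)
          rcases sx with ⟨l1, l2⟩ | ⟨l1, l2⟩ <;> rcases sy with ⟨m1, m2⟩ | ⟨m1, m2⟩ <;>
            rw [l2] at f2 f3 <;> rw [m2] at g2 g3
          all_goals first
          | (exfalso; omega)
          | (refine this ?_ ?_ ?_ ?_
             · unfold sg; split_ifs <;> omega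
             · unfold sg; split_ifs <;> omega
             · first
               | (rw [abs_of_pos (by omega), abs_of_pos (by omega)]; omega)
               | (rw [abs_of_neg (by omega), abs_of_neg (by omega)]; omega)
             · first
               | (rw [abs_of_pos (by omega), abs_of_pos (by omega)]; omega)
               | (rw [abs_of_neg (by omega), abs_of_neg (by omega)]; omega))
  | B u v =>
    have hy := h.Bdy _ _ hr
    have huv : u ≠ v := by rintro rfl; omega
    have sx := sgI (h.xinj.ne huv)
    obtain ⟨f1, f2, f3⟩ := hz
    cases r' with
    | B u v => exact hz'
    | A u' v' =>
      have hx := h.Adx _ _ hr'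
      obtain ⟨g1, g2, g3⟩ := hz'
      rw [g1] at f2 f3
      norm_cast at f2 f3
      simp only [X, Y] at f2 f3
      simp only [ERep.ends, Sym2.mem_iff] at hw hw'
      rcases hw with rfl | rfl <;> rcases hw' with rfl | rfl <;>
        rcases sx with ⟨l1, l2⟩ | ⟨l1, l2⟩ <;> rw [l2] at f2 f3 <;> omega
    | L s t =>
      have ha' := h.abd _ _ hr'
      have hb' := h.bbd _ _ hr'
      have hst' := h.Tne _ _ hr'
      have sy := sgI (h.yinj.ne hst'.symm)
      obtain ⟨g1, g2, g3⟩ := hz'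
      rw [g1] at f2 f3
      rw [f1] at g2 g3
      norm_cast at f2 f3 g2 g3
      simp only [X, Y] at f2 f3 g2 g3
      simp only [ERep.ends, Sym2.mem_iff] at hw hw'
      have hxst := h.xinj.ne hst'
      rcases hw' with rfl | rfl
      · rcases hw with rfl | rfl
        · have htt : t ≠ v := by rintro rfl; exact hne (by simp [ERep.ends])
          have hxx := h.xinj.ne htt
          have hyy := h.yinj.ne htt
          have := h.conf w t v (Or.inl ⟨hr', Or.inr (Or.inl hr)⟩)
          rcases sx with ⟨l1, l2⟩ | ⟨l1, l2⟩ <;> rcases sy with ⟨m1, m2⟩ | ⟨m1, m2⟩ <;>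
            rw [l2] at f2 f3 <;> rw [m2] at g2 g3
          all_goals first
          | (exfalso; omega)
          | (refine this ?_ ?_ ?_ ?_
             · unfold sg; split_ifs <;> omega
             · unfold sg; split_ifs <;> omega
             · first
               | (rw [abs_of_pos (by omega), abs_of_pos (by omega)]; omega)
               | (rw [abs_of_neg (by omega), abs_of_neg (by omega)]; omega)
             · first
               | (rw [abs_of_pos (by omega), abs_of_pos (by omega)]; omega)
               | (rw [abs_of_neg (by omega), abs_of_neg (by omega)]; omega))
        · have htt : t ≠ u := by rintro rfl; exact hne (by simp [ERep.ends, Sym2.eq_swap])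
          have hxx := h.xinj.ne htt
          have hyy := h.yinj.ne htt
          have := h.conf w t u (Or.inl ⟨hr', Or.inr (Or.inr hr)⟩)
          rcases sx with ⟨l1, l2⟩ | ⟨l1, l2⟩ <;> rcases sy with ⟨m1, m2⟩ | ⟨m1, m2⟩ <;>
            rw [l2] at f2 f3 <;> rw [m2] at g2 g3
          all_goals first
          | (exfalso; omega)
          | (refine this ?_ ?_ ?_ ?_
             · unfold sg; split_ifs <;> omega
             · unfold sg; split_ifs <;> omega
             · first
               | (rw [abs_of_pos (by omega), abs_of_pos (by omega)]; omega)
               | (rw [abs_of_neg (by omega), abs_of_neg (by omega)]; omega)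
             · first
               | (rw [abs_of_pos (by omega), abs_of_pos (by omega)]; omega)
               | (rw [abs_of_neg (by omega), abs_of_neg (by omega)]; omega))
      · rcases hw with rfl | rfl <;> rcases sx with ⟨m1, m2⟩ | ⟨m1, m2⟩ <;>
          rw [m2] at f2 f3 <;> omega
end Lay

namespace Lay
variable {V : Type} {Λ : Lay V}

theorem off (h : Λ.OK) {r : ERep V} (hr : r.ok Λ) {w : V} (hw : w ∉ r.ends) {c d : Pt}
    (hc : Λ.Cls r c d (Λ.pt w)) : False := by
  rcases hc with ⟨w0, hw0, hg⟩ | ⟨hz, -⟩ | ⟨hz, -⟩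
  · have hne : w ≠ w0 := by rintro rfl; exact hw hw0
    have hd := dirS h hr hw0
    obtain ⟨θ, t0, t1, e1, e2⟩ := hg
    have g2 := germ_bd t0 t1 (hd.bound h).2.1
    simp only [pt, ip, X, Y] at e2
    push_cast at g2 e2
    rcases vgapR (h.yinj.ne hne) with hy | hy <;> linarith
  · cases r with
    | A u v => exact hz
    | L s t =>
      have ha := h.abd _ _ hr
      obtain ⟨f1, -, -⟩ := hz
      simp only [pt, ip, Y] at f1
      norm_cast at f1
      have : w = s := h.yinj (by omega)
      exact hw (by simp [ERep.ends, this])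
    | B u v =>
      obtain ⟨f1, -, -⟩ := hz
      simp only [pt, ip, Y] at f1
      norm_cast at f1
      omega
  · cases r with
    | B u v => exact hz
    | L s t =>
      have ha := h.bbd _ _ hr
      obtain ⟨f1, -, -⟩ := hz
      simp only [pt, ip, X] at f1
      norm_cast at f1
      have : w = t := h.xinj (by omega)
      exact hw (by simp [ERep.ends, this])
    | A u v =>
      obtain ⟨f1, -, -⟩ := hz
      simp only [pt, ip, X] at f1
      norm_cast at f1
      omega

theorem mem_polySet {l : List Pt} {z : Pt} (hz : z ∈ polySet l) :
    ∃ c ∈ polySegs l, z ∈ segment ℝ c.1 c.2 := by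
  simpa [polySet] using hz

/-- Summary of how two distinct edges can meet. -/
theorem meet (h : Λ.OK) {r r' : ERep V} (hr : r.ok Λ) (hr' : r'.ok Λ) (hne : r.ends ≠ r'.ends)
    {c d c' d' z : Pt} (hz : Λ.Cls r c d z) (hz' : Λ.Cls r' c' d' z) :
    (∃ w, w ∈ r.ends ∧ w ∈ r'.ends ∧ z = Λ.pt w) ∨
    ((∀ w, w ∈ r.ends → w ∉ r'.ends) ∧
      ((Λ.Hp r z ∧ c.2 = d.2 ∧ Λ.Vp r' z ∧ c'.1 = d'.1) ∨
       (Λ.Vp r z ∧ c.1 = d.1 ∧ Λ.Hp r' z ∧ c'.2 = d'.2))) := by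
  have hrr : r ≠ r' := by rintro rfl; exact hne rfl
  rcases hz with ⟨w, hw, hg⟩ | ⟨hh, h2⟩ | ⟨hh, h2⟩ <;>
    rcases hz' with ⟨w', hw', hg'⟩ | ⟨hh', h2'⟩ | ⟨hh', h2'⟩
  · obtain ⟨rfl, e⟩ := germ_germ h hr hr' hrr hw hw' hg hg'
    exact Or.inl ⟨w, hw, hw', e⟩
  · exact (germ_Hp h hr hr' hrr hw hg hh').elim
  · exact (germ_Vp h hr hr' hrr hw hg hh').elim
  · exact (germ_Hp h hr' hr hrr.symm hw' hg' hh).elim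
  · exact (Hp_Hp h hr hr' hrr hh hh').elim
  · right
    exact ⟨fun w hw hw' => Hp_Vp h hr hr' hne hw hw' hh hh', Or.inl ⟨hh, h2, hh', h2'⟩⟩
  · exact (germ_Vp h hr' hr hrr.symm hw' hg' hh).elim
  · right
    exact ⟨fun w hw hw' => Hp_Vp h hr' hr hne.symm hw' hw hh' hh, Or.inr ⟨hh, h2, hh', h2'⟩⟩
  · exact (Vp_Vp h hr hr' hrr hh hh').elim

theorem Hp_row {r : ERep V} {z z' : Pt} (h : Λ.Hp r z) (h' : Λ.Hp r z') : z.2 = z'.2 := by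
  cases r with
  | A u v => exact h.elim
  | L s t => rw [h.1, h'.1]
  | B s t => rw [h.1, h'.1]

theorem Vp_col {r : ERep V} {z z' : Pt} (h : Λ.Vp r z) (h' : Λ.Vp r z') : z.1 = z'.1 := by
  cases r with
  | B u v => exact h.elim
  | L s t => rw [h.1, h'.1]
  | A s t => rw [h.1, h'.1]

theorem pts_len (r : ERep V) : (Λ.pts r).length = 4 := by
  cases r with
  | L s t => simp only [pts]; split_ifs <;> rfl
  | A s t => rfl
  | B s t => rfl

theorem pts_ends (r : ERep V) : ∃ u v : V, r.ends = s(u, v) ∧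
    (Λ.pts r).head? = some (Λ.pt u) ∧ (Λ.pts r).getLast? = some (Λ.pt v) := by
  cases r with
  | L s t => refine ⟨s, t, rfl, ?_⟩; simp only [pts]; split_ifs <;> exact ⟨rfl, rfl⟩
  | A s t => exact ⟨s, t, rfl, rfl, rfl⟩
  | B s t => exact ⟨s, t, rfl, rfl, rfl⟩

theorem pts_bd (h : Λ.OK) {r : ERep V} (hr : r.ok Λ) {q : Pt} (hq : q ∈ Λ.pts r) :
    ∃ (w w' : V) (i j : ℤ), q = ip (Λ.X w + i) (Λ.Y w' + j) ∧ |i| ≤ 220 ∧ |j| ≤ 220 := by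
  have z0 : |(0 : ℤ)| ≤ 220 := by norm_num
  cases r with
  | L s t =>
    have ha := h.abd _ _ hr
    have hb := h.bbd _ _ hr
    have s1 := sg_pm (Λ.x s) (Λ.x t)
    have s2 := sg_pm (Λ.y t) (Λ.y s)
    simp only [pts] at hq
    split_ifs at hq with h0
    · simp only [List.mem_cons, List.not_mem_nil, or_false] at hq
      rcases hq with rfl | rfl | rfl | rfl
      · exact ⟨s, s, 0, 0, by simp [pt], z0, z0⟩
      · exact ⟨t, s, Λ.b s t, 0, by simp, abs_le.2 ⟨by omega, by omega⟩, z0⟩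
      · exact ⟨t, t, _, _, rfl, abs_le.2 ⟨by omega, by omega⟩, abs_le.2 ⟨by omega, by omega⟩⟩
      · exact ⟨t, t, 0, 0, by simp [pt], z0, z0⟩
    · simp only [List.mem_cons, List.not_mem_nil, or_false] at hq
      rcases hq with rfl | rfl | rfl | rfl
      · exact ⟨s, s, 0, 0, by simp [pt], z0, z0⟩
      · exact ⟨s, s, _, _, rfl, abs_le.2 ⟨by omega, by omega⟩, abs_le.2 ⟨by omega, by omega⟩⟩
      · exact ⟨t, s, 0, Λ.a s t, by simp, z0, abs_le.2 ⟨by omega, by omega⟩⟩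
      · exact ⟨t, t, 0, 0, by simp [pt], z0, z0⟩
  | A s t =>
    have s2 := sg_pm (Λ.y s) (Λ.y t)
    simp only [pts, List.mem_cons, List.not_mem_nil, or_false] at hq
    rcases hq with rfl | rfl | rfl | rfl
    · exact ⟨s, s, 0, 0, by simp [pt], z0, z0⟩
    · exact ⟨s, s, _, _, rfl, abs_le.2 ⟨by omega, by omega⟩, abs_le.2 ⟨by omega, by omega⟩⟩
    · exact ⟨s, t, _, _, by rw [sub_eq_add_neg], abs_le.2 ⟨by omega, by omega⟩,
        abs_le.2 ⟨by omega, by omega⟩⟩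
    · exact ⟨t, t, 0, 0, by simp [pt], z0, z0⟩
  | B s t =>
    have s2 := sg_pm (Λ.x s) (Λ.x t)
    simp only [pts, List.mem_cons, List.not_mem_nil, or_false] at hq
    rcases hq with rfl | rfl | rfl | rfl
    · exact ⟨s, s, 0, 0, by simp [pt], z0, z0⟩
    · exact ⟨s, s, _, _, rfl, abs_le.2 ⟨by omega, by omega⟩, abs_le.2 ⟨by omega, by omega⟩⟩
    · exact ⟨t, s, _, _, by rw [sub_eq_add_neg], abs_le.2 ⟨by omega, by omega⟩,
        abs_le.2 ⟨by omega, by omega⟩⟩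
    · exact ⟨t, t, 0, 0, by simp [pt], z0, z0⟩

theorem main [Fintype V] (h : Λ.OK) (G : SimpleGraph V)
    (hG : ∀ u v, G.Adj u v → ∃ r : ERep V, r.ok Λ ∧ r.ends = s(u, v))
    (hx : ∀ u, 0 ≤ Λ.x u ∧ Λ.x u < 8 * Fintype.card V)
    (hy : ∀ u, 0 ≤ Λ.y u ∧ Λ.y u < 8 * Fintype.card V) :
    ∃ (p : V → Pt) (poly : Sym2 V → List Pt), IsBendRACDrawing 2 G p poly ∧
          InGridSquare (5000 * (Fintype.card V : ℝ)) (drawingPoints G p poly) := by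
  have hG' : ∀ e : Sym2 V, e ∈ G.edgeSet → ∃ r : ERep V, r.ok Λ ∧ r.ends = e := by
    intro e
    induction e with
    | _ u v => exact hG u v
  let R : Sym2 V → ERep V := fun e => if he : e ∈ G.edgeSet then (hG' e he).choose else
    ERep.L e.out.1 e.out.1
  have R1 : ∀ e ∈ G.edgeSet, (R e).ok Λ := by
    intro e he
    simp only [R, dif_pos he]
    exact (hG' e he).choose_spec.1
  have R2 : ∀ e ∈ G.edgeSet, (R e).ends = e := by
    intro e he
    simp only [R, dif_pos he]
    exact (hG' e he).choose_spec.2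
  refine ⟨Λ.pt, fun e => Λ.pts (R e), ?_, ?_⟩
  · constructor
    · intro u v huv
      simp only [pt, ip, Prod.mk.injEq, X] at huv
      have := huv.1
      norm_cast at this
      exact h.xinj (by omega)
    · intro e he
      obtain ⟨u, v, h1, h2, h3⟩ := pts_ends (Λ := Λ) (R e)
      exact ⟨u, v, by rw [← h1, R2 e he], h2, h3⟩
    · intro e he
      simp only [pts_len]
      omega
    · intro e he w hw hz
      obtain ⟨c, hc, hz⟩ := mem_polySet hz
      exact off h (R1 e he) (by rw [R2 e he]; exact hw) (cls h (R1 e he) c hc _ hz)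
    · rintro e he e' he' hne w hw hw' z ⟨hz, hz'⟩
      obtain ⟨c, hc, hz⟩ := mem_polySet hz
      obtain ⟨c', hc', hz'⟩ := mem_polySet hz'
      have hne' : (R e).ends ≠ (R e').ends := by rw [R2 e he, R2 e' he']; exact hne
      rcases meet h (R1 e he) (R1 e' he') hne' (cls h (R1 e he) c hc _ hz)
        (cls h (R1 e' he') c' hc' _ hz') with ⟨w', h1, h2, h3⟩ | ⟨h1, -⟩
      · rw [R2 e he] at h1
        rw [R2 e' he'] at h2
        have : w' = w := by
          by_contra hc
          apply hne
          rw [(Sym2.mem_and_mem_iff hc).1 ⟨h1, hw⟩, (Sym2.mem_and_mem_iff hc).1 ⟨h2, hw'⟩]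
        rw [h3, this]; rfl
      · exact (h1 w (by rw [R2 e he]; exact hw) (by rw [R2 e' he']; exact hw')).elim
    · intro e he e' he' hne
      have hne' : (R e).ends ≠ (R e').ends := by rw [R2 e he, R2 e' he']; exact hne
      have f1 : ({z | Λ.Hp (R e) z ∧ Λ.Vp (R e') z} : Set Pt).Finite :=
        Set.Subsingleton.finite fun z hz z' hz' =>
          Prod.ext (Vp_col hz.2 hz'.2) (Hp_row hz.1 hz'.1)
      have f2 : ({z | Λ.Vp (R e) z ∧ Λ.Hp (R e') z} : Set Pt).Finite :=
        Set.Subsingleton.finite fun z hz z' hz' =>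
          Prod.ext (Vp_col hz.1 hz'.1) (Hp_row hz.2 hz'.2)
      refine ((f1.union f2).union (Set.finite_range Λ.pt)).subset ?_
      rintro z ⟨hz, hz'⟩
      obtain ⟨c, hc, hz⟩ := mem_polySet hz
      obtain ⟨c', hc', hz'⟩ := mem_polySet hz'
      rcases meet h (R1 e he) (R1 e' he') hne' (cls h (R1 e he) c hc _ hz)
        (cls h (R1 e' he') c' hc' _ hz') with ⟨w', h1, h2, h3⟩ | ⟨-, h1 | h1⟩
      · exact Or.inr ⟨w', h3.symm⟩
      · exact Or.inl (Or.inl ⟨h1.1, h1.2.2.1⟩)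
      · exact Or.inl (Or.inr ⟨h1.1, h1.2.2.1⟩)
    · intro e he e' he' hne c hc c' hc' z hz hz' hw
      have hne' : (R e).ends ≠ (R e').ends := by rw [R2 e he, R2 e' he']; exact hne
      rcases meet h (R1 e he) (R1 e' he') hne' (cls h (R1 e he) c hc _ hz)
        (cls h (R1 e' he') c' hc' _ hz') with ⟨w', h1, h2, h3⟩ | ⟨-, h1 | h1⟩
      · rw [R2 e he] at h1
        rw [R2 e' he'] at h2
        exact (hw w' h1 h2 h3).elim
      · simp [SegOrth, h1.2.1, h1.2.2.2]
      · simp [SegOrth, h1.2.1, h1.2.2.2]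
  · have key : ∀ q ∈ drawingPoints G Λ.pt (fun e => Λ.pts (R e)),
        ∃ (w w' : V) (i j : ℤ), q = ip (Λ.X w + i) (Λ.Y w' + j) ∧ |i| ≤ 220 ∧ |j| ≤ 220 := by
      rintro q (⟨w, rfl⟩ | ⟨e, he, hq⟩)
      · exact ⟨w, w, 0, 0, by simp [pt], by norm_num, by norm_num⟩
      · exact pts_bd h (R1 e he) hq
    refine ⟨fun q hq => ?_, -300, -300, fun q hq => ?_⟩
    · obtain ⟨w, w', i, j, rfl, -, -⟩ := key q hq
      exact ⟨_, _, rfl⟩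
    · obtain ⟨w, w', i, j, rfl, hi, hj⟩ := key q hq
      have hxw := hx w
      have hyw := hy w'
      rw [abs_le] at hi hj
      have hc : 0 < Fintype.card V := Fintype.card_pos_iff.2 ⟨w⟩
      simp only [ip, X, Y]
      refine ⟨?_, ?_, ?_, ?_⟩
      · have : (-300 : ℤ) ≤ 400 * Λ.x w + i := by omega
        exact_mod_cast this
      · have : 400 * Λ.x w + i ≤ -300 + 5000 * Fintype.card V := by omega
        exact_mod_cast this
      · have : (-300 : ℤ) ≤ 400 * Λ.y w' + j := by omega
        exact_mod_cast this
      · have : 400 * Λ.y w' + j ≤ -300 + 5000 * Fintype.card V := by omega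
        exact_mod_cast this
end Lay

/-! ### Offsets -/

theorem rank_exists {V : Type} (D : Finset V) (hD : D.card ≤ 7) (κ : V → ℤ)
    (hκ : ∀ s ∈ D, ∀ t ∈ D, κ s = κ t → s = t) (E : V → Prop)
    (hE : ∀ s ∈ D, ∀ t ∈ D, E s → E t → s = t) :
    ∃ f : V → ℤ, (∀ t ∈ D, -6 ≤ f t ∧ f t ≤ 6) ∧ (∀ t ∈ D, E t → f t = 0) ∧
      ∀ s ∈ D, ∀ t ∈ D, κ s < κ t → f s < f t := by
  let rk : V → ℤ := fun t => ((D.filter fun u => κ u < κ t).card : ℤ)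
  have h0 : ∀ t ∈ D, 0 ≤ rk t ∧ rk t ≤ 6 := by
    intro t ht
    refine ⟨Int.natCast_nonneg _, ?_⟩
    have : (D.filter fun u => κ u < κ t).card < D.card := by
      apply Finset.card_lt_card
      refine Finset.filter_ssubset.2 ⟨t, ht, by simp⟩
    simp only [rk]
    omega
  have h1 : ∀ s ∈ D, ∀ t ∈ D, κ s < κ t → rk s < rk t := by
    intro s hs t ht hst
    simp only [rk]
    have : (D.filter fun u => κ u < κ s).card < (D.filter fun u => κ u < κ t).card := by
      apply Finset.card_lt_card
      rw [Finset.ssubset_iff_of_subset]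
      · exact ⟨s, by simp [hs, hst], by simp⟩
      · intro u hu
        simp only [Finset.mem_filter] at hu ⊢
        exact ⟨hu.1, hu.2.trans hst⟩
    exact_mod_cast this
  by_cases hex : ∃ e ∈ D, E e
  · obtain ⟨e, he, hEe⟩ := hex
    refine ⟨fun t => rk t - rk e, ?_, ?_, ?_⟩
    · intro t ht
      have := h0 t ht
      have := h0 e he
      constructor <;> simp only <;> omega
    · intro t ht hEt
      rw [hE t ht e he hEt hEe]; simp
    · intro s hs t ht hst
      have := h1 s hs t ht hst
      simp only; omega
  · refine ⟨rk, ?_, ?_, h1⟩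
    · intro t ht
      have := h0 t ht
      omega
    · intro t ht hEt
      exact (hex ⟨t, ht, hEt⟩).elim

theorem offsets {V : Type} [Fintype V] (x y : V → ℤ) (hx : Function.Injective x)
    (hy : Function.Injective y) (T E : V → V → Prop)
    (hT : ∀ s t, T s t → s ≠ t)
    (hdeg : ∀ s, (Finset.univ.filter fun t => T s t).card ≤ 7)
    (hE : ∀ s t t', T s t → T s t' → E s t → E s t' → sg (x s) (x t) = sg (x s) (x t') → t = t') :
    ∃ a : V → V → ℤ,
      (∀ s t, T s t → -6 ≤ a s t ∧ a s t ≤ 6) ∧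
      (∀ s t, T s t → E s t → a s t = 0) ∧
      (∀ s t t', T s t → T s t' → t ≠ t' → sg (x s) (x t) = sg (x s) (x t') → a s t ≠ a s t') ∧
      (∀ s t t', T s t → T s t' → sg (x s) (x t) = sg (x s) (x t') →
        |x t - x s| < |x t' - x s| →
        (y s < y t → a s t' < a s t) ∧ (y t < y s → a s t < a s t')) := by
  obtain ⟨N, hN⟩ : ∃ N : ℤ, ∀ s t, |x t - x s| < N := by
    refine ⟨(∑ s, ∑ t, |x t - x s|) + 1, fun s t => ?_⟩
    have h1 : |x t - x s| ≤ ∑ t, |x t - x s| :=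
      Finset.single_le_sum (f := fun t => |x t - x s|) (fun _ _ => abs_nonneg _)
        (Finset.mem_univ t)
    have h2 : (∑ t, |x t - x s|) ≤ ∑ s, ∑ t, |x t - x s| :=
      Finset.single_le_sum (f := fun s => ∑ t, |x t - x s|)
        (fun _ _ => Finset.sum_nonneg fun _ _ => abs_nonneg _) (Finset.mem_univ s)
    omega
  let κ : V → V → ℤ := fun s t => sg (y s) (y t) * (N - |x t - x s|)
  have hκ : ∀ s t t', sg (x s) (x t) = sg (x s) (x t') → s ≠ t → s ≠ t' → κ s t = κ s t' →
      t = t' := by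
    intro s t t' h1 h2 h3 h4
    have n1 := hN s t
    have n2 := hN s t'
    simp only [κ] at h4
    have h2' := hx.ne h2
    have h3' := hx.ne h3
    apply hx
    have : |x t - x s| = |x t' - x s| := by
      rcases Lay.sg_pm (y s) (y t) with e | e <;> rcases Lay.sg_pm (y s) (y t') with e' | e' <;>
        rw [e, e'] at h4 <;> omega
    rcases Lay.sgI h2' with ⟨k1, k2⟩ | ⟨k1, k2⟩ <;> rcases Lay.sgI h3' with ⟨m1, m2⟩ | ⟨m1, m2⟩ <;>
      rw [k2, m2] at h1
    · rw [abs_of_pos (by omega), abs_of_pos (by omega)] at this; omega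
    · omega
    · omega
    · rw [abs_of_neg (by omega), abs_of_neg (by omega)] at this; omega
  have key := fun (s : V) (σ : ℤ) => rank_exists
    (Finset.univ.filter fun t => T s t ∧ sg (x s) (x t) = σ)
    ((Finset.card_le_card (fun t ht => by simp at ht ⊢; exact ht.1)).trans (hdeg s)) (κ s)
    (by
      intro t ht t' ht' h
      simp only [Finset.mem_filter, Finset.mem_univ, true_and] at ht ht'
      exact hκ s t t' (ht.2.trans ht'.2.symm) (hT _ _ ht.1) (hT _ _ ht'.1) h) (E s)
    (by
      intro t ht t' ht' h h'
      simp only [Finset.mem_filter, Finset.mem_univ, true_and] at ht ht'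
      exact hE s t t' ht.1 ht'.1 h h' (ht.2.trans ht'.2.symm))
  choose F F1 F2 F3 using key
  simp only [Finset.mem_filter, Finset.mem_univ, true_and] at F1 F2 F3
  refine ⟨fun s t => F s (sg (x s) (x t)) t, fun s t h => F1 _ _ _ ⟨h, rfl⟩,
    fun s t h => F2 _ _ _ ⟨h, rfl⟩, ?_, ?_⟩
  · intro s t t' h h' hne hs
    simp only
    rw [← hs]
    have hk : κ s t ≠ κ s t' := fun hk => hne (hκ s t t' hs (hT _ _ h) (hT _ _ h') hk)
    rcases lt_or_gt_of_ne hk with hk | hk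
    · exact (F3 s _ t ⟨h, rfl⟩ t' ⟨h', hs.symm⟩ hk).ne
    · exact (F3 s _ t' ⟨h', hs.symm⟩ t ⟨h, rfl⟩ hk).ne'
  · intro s t t' h h' hs hd
    simp only
    rw [← hs]
    have n1 := hN s t
    have n2 := hN s t'
    have s' := Lay.sg_pm (y s) (y t')
    constructor
    · intro hyy
      refine F3 s _ t' ⟨h', hs.symm⟩ t ⟨h, rfl⟩ ?_
      simp only [κ]
      rw [show sg (y s) (y t) = 1 from if_pos hyy]
      rcases s' with e | e <;> rw [e] <;> omega
    · intro hyy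
      refine F3 s _ t ⟨h, rfl⟩ t' ⟨h', hs.symm⟩ ?_
      simp only [κ]
      rw [show sg (y s) (y t) = -1 from if_neg (by omega)]
      rcases s' with e | e <;> rw [e] <;> omega

/-- From a combinatorial layout to a drawing. -/
theorem draw_of_claims {V : Type} [Fintype V] (G : SimpleGraph V) (hdeg : ∀ v, vdeg G v ≤ 7)
    (x y : V → ℤ) (T A B Es Et : V → V → Prop)
    (hx : Function.Injective x) (hy : Function.Injective y)
    (hxb : ∀ u, 0 ≤ x u ∧ x u < 8 * Fintype.card V)
    (hyb : ∀ u, 0 ≤ y u ∧ y u < 8 * Fintype.card V)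
    (TG : ∀ s t, T s t → G.Adj s t)
    (cover : ∀ u v, G.Adj u v → T u v ∨ T v u ∨ A u v ∨ A v u ∨ B u v ∨ B v u)
    (Adx : ∀ u v, A u v → x v = x u + 1)
    (Bdy : ∀ u v, B u v → y v = y u + 1)
    (Bdx : ∀ u v, B u v → x v ≤ x u - 2 ∨ x u + 2 ≤ x v)
    (ex : ∀ s t, T s t → Es s t ∨ Et s t)
    (hEs : ∀ s t t', T s t → T s t' → Es s t → Es s t' → sg (x s) (x t) = sg (x s) (x t') → t = t')
    (hEt : ∀ s s' t, T s t → T s' t → Et s t → Et s' t → sg (y t) (y s) = sg (y t) (y s') → s = s')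
    (conf : ∀ u v z, (T u v ∧ (T z u ∨ B u z ∨ B z u) ∨ (A u v ∨ A v u) ∧ T z u) →
      sg (x u) (x v) = sg (x u) (x z) → sg (y u) (y v) = sg (y u) (y z) →
      |x v - x u| < |x z - x u| → |y z - y u| < |y v - y u| → False) :
    ∃ (p : V → Pt) (poly : Sym2 V → List Pt), IsBendRACDrawing 2 G p poly ∧
          InGridSquare (5000 * (Fintype.card V : ℝ)) (drawingPoints G p poly) := by
  have dg : ∀ s, (Finset.univ.filter fun t => G.Adj s t).card ≤ 7 := by
    intro s
    have := hdeg s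
    rw [vdeg, Set.ncard_eq_toFinset_card'] at this
    refine (Finset.card_le_card ?_).trans this
    intro t ht
    simpa using ht
  obtain ⟨a, a1, a2, a3, a4⟩ := offsets x y hx hy T Es (fun s t h => (TG s t h).ne)
    (fun s => (Finset.card_le_card (fun t ht => by simp at ht ⊢; exact TG _ _ ht)).trans (dg s)) hEs
  obtain ⟨b, b1, b2, b3, b4⟩ := offsets y x hy hx (fun t s => T s t) (fun t s => Et s t)
    (fun s t h => (TG t s h).ne')
    (fun s => (Finset.card_le_card (fun t ht => by simp at ht ⊢; exact (TG _ _ ht).symm)).trans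
      (dg s)) (fun t s s' h1 h2 h3 h4 h5 => hEt s s' t h1 h2 h3 h4 h5)
  let Λ : Lay V := ⟨x, y, T, A, B, a, fun s t => b t s⟩
  have hOK : Λ.OK := by
    refine ⟨hx, hy, a1, fun s t h => b1 t s h, ?_, fun s t h => (TG s t h).ne, Adx, Bdy, Bdx, a3, a4,
      fun s s' t h1 h2 h3 h4 => b3 t s s' h1 h2 h3 h4, fun s s' t h1 h2 h3 h4 => b4 t s s' h1 h2 h3 h4,
      conf⟩
    intro s t h
    rcases ex s t h with h' | h'
    · exact Or.inl (a2 s t h h')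
    · exact Or.inr (b2 t s h h')
  refine Lay.main hOK G ?_ hxb hyb
  intro u v h
  rcases cover u v h with h | h | h | h | h | h
  · exact ⟨.L u v, h, rfl⟩
  · exact ⟨.L v u, h, Sym2.eq_swap⟩
  · exact ⟨.A u v, h, rfl⟩
  · exact ⟨.A v u, h, Sym2.eq_swap⟩
  · exact ⟨.B u v, h, rfl⟩
  · exact ⟨.B v u, h, Sym2.eq_swap⟩

/-! ### Deficiency of a relation -/

set_option linter.unusedSectionVars false
section Deficiency
variable {V : Type} [Fintype V]

def ee (R : V → V → Prop) (P Q : Finset V) : ℕ := ∑ a ∈ P, ∑ b ∈ Q, if R a b then 1 else 0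

def df (R : V → V → Prop) : ℕ :=
  (Finset.univ : Finset (Finset V × Finset V)).sup fun T => ee R T.1 T.2 - 2 * (T.1.card + T.2.card)

theorem le_df (R : V → V → Prop) (P Q : Finset V) :
    ee R P Q ≤ df R + 2 * (P.card + Q.card) := by
  have : ee R P Q - 2 * (P.card + Q.card) ≤ df R :=
    Finset.le_sup (f := fun T : Finset V × Finset V => ee R T.1 T.2 - 2 * (T.1.card + T.2.card))
      (Finset.mem_univ (P, Q))
  omega

theorem df_le {R : V → V → Prop} {n : ℕ} (h : ∀ P Q : Finset V, ee R P Q ≤ n + 2 * (P.card + Q.card)) :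
    df R ≤ n := by
  apply Finset.sup_le
  intro T _
  have := h T.1 T.2
  omega

theorem df_attained (R : V → V → Prop) : ∃ P Q : Finset V, ee R P Q = df R + 2 * (P.card + Q.card) := by
  obtain ⟨T, -, hT⟩ := Finset.exists_mem_eq_sup (Finset.univ : Finset (Finset V × Finset V))
    ⟨(∅, ∅), Finset.mem_univ _⟩ fun T => ee R T.1 T.2 - 2 * (T.1.card + T.2.card)
  by_cases h0 : df R = 0
  · exact ⟨∅, ∅, by simp [ee, h0]⟩
  · refine ⟨T.1, T.2, ?_⟩
    have : df R = ee R T.1 T.2 - 2 * (T.1.card + T.2.card) := hT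
    omega

theorem ee_comm (R : V → V → Prop) (P Q : Finset V) :
    ee R P Q = ee (fun a b => R b a) Q P := by
  unfold ee; rw [Finset.sum_comm]

theorem df_flip (R : V → V → Prop) : df (fun a b => R b a) = df R := by
  apply le_antisymm
  · apply df_le; intro P Q
    have h : ee (fun a b => R b a) P Q = ee R Q P := ee_comm _ _ _
    have := le_df R Q P
    omega
  · apply df_le; intro P Q; rw [ee_comm]
    have := le_df (fun a b => R b a) Q P
    omega

theorem ee_erase_left (R : V → V → Prop) {P Q : Finset V} {a : V} (ha : a ∈ P) :
    ee R P Q = ee R (P.erase a) Q + (Q.filter fun b => R a b).card := by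
  unfold ee
  rw [← Finset.sum_erase_add P _ ha, Finset.card_filter]

theorem ee_erase_right (R : V → V → Prop) {P Q : Finset V} {b : V} (hb : b ∈ Q) :
    ee R P Q = ee R P (Q.erase b) + (P.filter fun a => R a b).card := by
  rw [ee_comm, ee_erase_left _ hb, ← ee_comm]

theorem ee_super (R : V → V → Prop) (P Q P' Q' : Finset V) :
    ee R P Q + ee R P' Q' ≤ ee R (P ∪ P') (Q ∪ Q') + ee R (P ∩ P') (Q ∩ Q') := by
  have key : ∀ P Q : Finset V, ee R P Q =
      ∑ a, ∑ b, if R a b ∧ a ∈ P ∧ b ∈ Q then 1 else 0 := by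
    intro P Q
    unfold ee
    rw [← Finset.sum_filter_add_sum_filter_not Finset.univ (fun a => a ∈ P)]
    rw [Finset.sum_eq_zero (s := Finset.univ.filter fun a => a ∉ P), add_zero]
    · rw [Finset.filter_mem_eq_inter, Finset.univ_inter]
      refine Finset.sum_congr rfl fun a ha => ?_
      rw [← Finset.sum_filter_add_sum_filter_not Finset.univ (fun a => a ∈ Q)]
      rw [Finset.sum_eq_zero (s := Finset.univ.filter fun a => a ∉ Q), add_zero]
      · rw [Finset.filter_mem_eq_inter, Finset.univ_inter]
        refine Finset.sum_congr rfl fun b hb => ?_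
        simp [ha, hb]
      · intro b hb
        simp at hb; simp [hb]
    · intro a ha
      simp at ha; simp [ha]
  rw [key, key, key, key, ← Finset.sum_add_distrib, ← Finset.sum_add_distrib]
  refine Finset.sum_le_sum fun a _ => ?_
  rw [← Finset.sum_add_distrib, ← Finset.sum_add_distrib]
  refine Finset.sum_le_sum fun b _ => ?_
  simp only [Finset.mem_union, Finset.mem_inter]
  by_cases h1 : R a b <;> by_cases h2 : a ∈ P <;> by_cases h3 : a ∈ P' <;> by_cases h4 : b ∈ Q <;>
    by_cases h5 : b ∈ Q' <;> simp [h1, h2, h3, h4, h5]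

theorem ee_mono {R R' : V → V → Prop} {P Q : Finset V} (h : ∀ a ∈ P, ∀ b ∈ Q, R' a b → R a b) :
    ee R' P Q ≤ ee R P Q := by
  refine Finset.sum_le_sum fun a ha => Finset.sum_le_sum fun b hb => ?_
  by_cases h1 : R' a b
  · simp [h1, h a ha b hb h1]
  · simp [h1]

/-- a critical pair of node sets -/
structure Crit (R : V → V → Prop) (P Q : Finset V) : Prop where
  up : ∀ a ∈ P, 3 ≤ (Q.filter fun b => R a b).card
  dn : ∀ b ∈ Q, 3 ≤ (P.filter fun a => R a b).card
  sub : ∀ P' Q' : Finset V, ee R P' Q' = df R + 2 * (P'.card + Q'.card) → P ⊆ P' ∧ Q ⊆ Q'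

theorem exists_crit (R : V → V → Prop) (h0 : 0 < df R)
    (hdeg : ∀ v, (Finset.univ.filter fun b => R v b).card +
      (Finset.univ.filter fun a => R a v).card ≤ 7) :
    ∃ P Q, Crit R P Q ∧ ((∃ v ∈ P, v ∉ Q ∧ 5 ≤ (Q.filter fun b => R v b).card) ∨
      (∃ v ∈ Q, v ∉ P ∧ 5 ≤ (P.filter fun a => R a v).card)) := by
  let M : Set (Finset V × Finset V) := {T | ee R T.1 T.2 = df R + 2 * (T.1.card + T.2.card)}
  have hM : M.Nonempty := by
    obtain ⟨P, Q, h⟩ := df_attained R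
    exact ⟨(P, Q), h⟩
  obtain ⟨⟨P, Q⟩, hPQ, hmin⟩ : ∃ T ∈ M, ∀ T' ∈ M, T.1.card + T.2.card ≤ T'.1.card + T'.2.card := by
    obtain ⟨T, hT, h⟩ := (measure fun T : Finset V × Finset V => T.1.card + T.2.card).wf.has_min M hM
    exact ⟨T, hT, fun T' hT' => not_lt.1 (h T' hT')⟩
  change ee R P Q = df R + 2 * (P.card + Q.card) at hPQ
  have hmin' : ∀ P' Q' : Finset V, ee R P' Q' = df R + 2 * (P'.card + Q'.card) →
      P.card + Q.card ≤ P'.card + Q'.card := fun P' Q' h => hmin (P', Q') h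
  have hup : ∀ a ∈ P, 3 ≤ (Q.filter fun b => R a b).card := by
    intro a ha
    by_contra hc
    have e1 := ee_erase_left R (Q := Q) ha
    have e2 := le_df R (P.erase a) Q
    have e3 := Finset.card_erase_of_mem ha
    have e4 : 0 < P.card := Finset.card_pos.2 ⟨a, ha⟩
    have := hmin' (P.erase a) Q (by omega)
    omega
  have hdn : ∀ b ∈ Q, 3 ≤ (P.filter fun a => R a b).card := by
    intro a ha
    by_contra hc
    have e1 := ee_erase_right R (P := P) ha
    have e2 := le_df R P (Q.erase a)
    have e3 := Finset.card_erase_of_mem ha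
    have e4 : 0 < Q.card := Finset.card_pos.2 ⟨a, ha⟩
    have := hmin' P (Q.erase a) (by omega)
    omega
  refine ⟨P, Q, ⟨hup, hdn, ?_⟩, ?_⟩
  · intro P' Q' h
    have e1 := ee_super R P Q P' Q'
    have e2 := le_df R (P ∪ P') (Q ∪ Q')
    have e3 := le_df R (P ∩ P') (Q ∩ Q')
    have e4 := Finset.card_union_add_card_inter P P'
    have e5 := Finset.card_union_add_card_inter Q Q'
    have e6 := hmin' (P ∩ P') (Q ∩ Q') (by omega)
    have e7 := Finset.card_le_card (Finset.inter_subset_left (s₁ := P) (s₂ := P'))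
    have e8 := Finset.card_le_card (Finset.inter_subset_left (s₁ := Q) (s₂ := Q'))
    have e9 : P ∩ P' = P := Finset.eq_of_subset_of_card_le Finset.inter_subset_left (by omega)
    have e10 : Q ∩ Q' = Q := Finset.eq_of_subset_of_card_le Finset.inter_subset_left (by omega)
    exact ⟨Finset.inter_eq_left.1 e9, Finset.inter_eq_left.1 e10⟩
  · by_contra hc
    push Not at hc
    obtain ⟨c1, c2⟩ := hc
    have s1 : ee R P Q = ∑ v, if v ∈ P then (Q.filter fun b => R v b).card else 0 := by
      rw [← Finset.sum_filter, Finset.filter_mem_eq_inter, Finset.univ_inter]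
      unfold ee
      refine Finset.sum_congr rfl fun a _ => ?_
      rw [Finset.card_filter]
    have s2 : ee R P Q = ∑ v, if v ∈ Q then (P.filter fun a => R a v).card else 0 := by
      rw [← Finset.sum_filter, Finset.filter_mem_eq_inter, Finset.univ_inter]
      unfold ee
      rw [Finset.sum_comm]
      refine Finset.sum_congr rfl fun a _ => ?_
      rw [Finset.card_filter]
    have s3 : P.card = ∑ v, if v ∈ P then 1 else 0 := by
      rw [← Finset.sum_filter, Finset.filter_mem_eq_inter, Finset.univ_inter, Finset.card_eq_sum_ones]
    have s4 : Q.card = ∑ v, if v ∈ Q then 1 else 0 := by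
      rw [← Finset.sum_filter, Finset.filter_mem_eq_inter, Finset.univ_inter, Finset.card_eq_sum_ones]
    have : ee R P Q + ee R P Q ≤ 4 * (P.card + Q.card) := by
      conv_lhs => rw [s2]
      conv_lhs => enter [1]; rw [← s2, s1]
      rw [s3, s4, ← Finset.sum_add_distrib, ← Finset.sum_add_distrib, Finset.mul_sum]
      refine Finset.sum_le_sum fun v _ => ?_
      have d := hdeg v
      have d1 : (Q.filter fun b => R v b).card ≤ (Finset.univ.filter fun b => R v b).card :=
        Finset.card_le_card (Finset.filter_subset_filter _ (Finset.subset_univ _))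
      have d2 : (P.filter fun b => R b v).card ≤ (Finset.univ.filter fun b => R b v).card :=
        Finset.card_le_card (Finset.filter_subset_filter _ (Finset.subset_univ _))
      have c1' := c1 v
      have c2' := c2 v
      by_cases hp : v ∈ P <;> by_cases hq : v ∈ Q <;> simp [hp, hq] at c1' c2' ⊢ <;> omega
    omega

/-- removing low degree nodes -/
theorem ee_low (R : V → V → Prop) (Hu Hd : Finset V)
    (h1 : ∀ a ∈ Hu, (Finset.univ.filter fun b => R a b).card ≤ 2)
    (h2 : ∀ b ∈ Hd, (Finset.univ.filter fun a => R a b).card ≤ 2) (P Q : Finset V) :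
    ee R P Q + 2 * ((P \ Hu).card + (Q \ Hd).card) ≤
      ee R (P \ Hu) (Q \ Hd) + 2 * (P.card + Q.card) := by
  have st1 : ∀ P Q : Finset V, ee R P Q ≤ ee R (P \ Hu) Q + 2 * (P ∩ Hu).card := by
    intro P Q
    unfold ee
    rw [← Finset.sum_sdiff (Finset.inter_subset_left (s₁ := P) (s₂ := Hu)), Finset.sdiff_inter_self_left]
    gcongr
    rw [mul_comm, ← smul_eq_mul]
    apply Finset.sum_le_card_nsmul
    intro a ha
    rw [← Finset.card_filter]
    exact (Finset.card_le_card (Finset.filter_subset_filter _ (Finset.subset_univ _))).trans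
      (h1 a (Finset.mem_inter.1 ha).2)
  have st2 : ∀ P Q : Finset V, ee R P Q ≤ ee R P (Q \ Hd) + 2 * (Q ∩ Hd).card := by
    intro P Q
    rw [ee_comm, ee_comm R P]
    unfold ee
    rw [← Finset.sum_sdiff (Finset.inter_subset_left (s₁ := Q) (s₂ := Hd)), Finset.sdiff_inter_self_left]
    gcongr
    rw [mul_comm, ← smul_eq_mul]
    apply Finset.sum_le_card_nsmul
    intro a ha
    rw [← Finset.card_filter]
    exact (Finset.card_le_card (Finset.filter_subset_filter _ (Finset.subset_univ _))).trans
      (h2 a (Finset.mem_inter.1 ha).2)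
  have a1 := st1 P Q
  have a2 := st2 (P \ Hu) Q
  have a3 := Finset.card_sdiff_add_card_inter P Hu
  have a4 := Finset.card_sdiff_add_card_inter Q Hd
  omega

theorem ee_extra {R R' : V → V → Prop} {P Q : Finset V} (X : Finset (V × V))
    (h : ∀ a ∈ P, ∀ b ∈ Q, R' a b → R a b ∨ (a, b) ∈ X) :
    ee R' P Q ≤ ee R P Q + X.card := by
  have : X.card ≥ ∑ a ∈ P, ∑ b ∈ Q, if (a, b) ∈ X then 1 else 0 := by
    rw [← Finset.sum_product', ← Finset.card_filter]
    apply Finset.card_le_card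
    intro p hp
    exact (Finset.mem_filter.1 hp).2
  refine le_trans ?_ (Nat.add_le_add_left this _)
  unfold ee
  rw [← Finset.sum_add_distrib]
  refine Finset.sum_le_sum fun a ha => ?_
  rw [← Finset.sum_add_distrib]
  refine Finset.sum_le_sum fun b hb => ?_
  by_cases h1 : R' a b
  · rcases h a ha b hb h1 with h2 | h2 <;> simp [h1, h2]
  · simp [h1]

theorem df_weak {R R' : V → V → Prop} (Hu Hd : Finset V)
    (h1 : ∀ a ∈ Hu, (Finset.univ.filter fun b => R' a b).card ≤ 2)
    (h2 : ∀ b ∈ Hd, (Finset.univ.filter fun a => R' a b).card ≤ 2)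
    (h : ∀ a b, R' a b → a ∉ Hu → b ∉ Hd → R a b) : df R' ≤ df R := by
  apply df_le
  intro P Q
  have e1 := ee_low R' Hu Hd h1 h2 P Q
  have e2 := le_df R (P \ Hu) (Q \ Hd)
  have e3 : ee R' (P \ Hu) (Q \ Hd) ≤ ee R (P \ Hu) (Q \ Hd) := by
    apply ee_mono
    intro a ha b hb hab
    exact h a b hab (Finset.mem_sdiff.1 ha).2 (Finset.mem_sdiff.1 hb).2
  omega

theorem df_drop {R R' : V → V → Prop} {P Q : Finset V} (hC : Crit R P Q) (Hu Hd : Finset V)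
    (X : Finset (V × V))
    (h1 : ∀ a ∈ Hu, (Finset.univ.filter fun b => R' a b).card ≤ 2)
    (h2 : ∀ b ∈ Hd, (Finset.univ.filter fun a => R' a b).card ≤ 2)
    (h : ∀ a b, R' a b → a ∉ Hu → b ∉ Hd → R a b ∨ (a, b) ∈ X)
    {a0 b0 : V} (ha0 : a0 ∈ P) (hb0 : b0 ∈ Q) (hR : R a0 b0) (hR' : ¬ R' a0 b0) (h0 : 0 < df R) :
    df R' + 1 ≤ df R + X.card := by
  have : df R' ≤ df R + X.card - 1 := by
    apply df_le
    intro P' Q'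
    have e1 := ee_low R' Hu Hd h1 h2 P' Q'
    generalize hP1 : P' \ Hu = P1 at *
    generalize hQ1 : Q' \ Hd = Q1 at *
    have hh : ∀ a ∈ P1, ∀ b ∈ Q1, R' a b → R a b ∨ (a, b) ∈ X := by
      intro a ha b hb hab
      rw [← hP1] at ha
      rw [← hQ1] at hb
      exact h a b hab (Finset.mem_sdiff.1 ha).2 (Finset.mem_sdiff.1 hb).2
    have e2 := le_df R P1 Q1
    by_cases hm : ee R P1 Q1 = df R + 2 * (P1.card + Q1.card)
    · obtain ⟨s1, s2⟩ := hC.sub _ _ hm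
      have e3 : ee R' P1 Q1 ≤ ee (fun a b => R a b ∧ ¬ (a = a0 ∧ b = b0)) P1 Q1 + X.card := by
        apply ee_extra
        intro a ha b hb hab
        rcases hh a ha b hb hab with h3 | h3
        · left
          refine ⟨h3, ?_⟩
          rintro ⟨rfl, rfl⟩
          exact hR' hab
        · exact Or.inr h3
      have e4 : ee (fun a b => R a b ∧ ¬ (a = a0 ∧ b = b0)) P1 Q1 < ee R P1 Q1 := by
        unfold ee
        apply Finset.sum_lt_sum
        · intro a _
          refine Finset.sum_le_sum fun b _ => ?_
          by_cases h5 : R a b <;> simp [h5]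
          split_ifs <;> simp
        · refine ⟨a0, s1 ha0, ?_⟩
          apply Finset.sum_lt_sum
          · intro b _
            by_cases h5 : R a0 b <;> simp [h5]
            split_ifs <;> simp
          · refine ⟨b0, s2 hb0, ?_⟩
            simp [hR]
      omega
    · have e3 := ee_extra X hh
      omega
  omega

end Deficiency

/-! ### Block layouts -/

def frb (m n : ℕ) : Bool :=
  (decide (m < 4) && decide (n < 4) && (n == m + 1 || m == n + 1)) ||
  (decide (4 ≤ m) && decide (4 ≤ n) && (m == 7 || n == 7))

def frq (m n : ℕ) : Bool := (m / 8 == n / 8) && frb (m % 8) (n % 8)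

/-- position `m` lies properly below position `n` -/
def up (m n : ℕ) : Bool := decide (m < n) && !frq m n

def wtb (r : ℕ) : Bool := r == 0 || r == 3 || decide (4 ≤ r)

set_option linter.unusedSectionVars false
section Layout
variable {V : Type} [Fintype V] (G : SimpleGraph V)

def UU (k : V → ℤ × ℕ) (a b : V) : Prop :=
  G.Adj a b ∧ ((k a).1 < (k b).1 ∨ (k a).1 = (k b).1 ∧ up (k a).2 (k b).2 = true)

structure St (k : V → ℤ × ℕ) : Prop where
  inj : Function.Injective k
  lt : ∀ a, (k a).2 < 8
  full : ∀ a, 4 ≤ (k a).2 → ∀ j, 4 ≤ j → j < 8 → ∃ b, k b = ((k a).1, j)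
  nopath : ∀ a b, (k a).1 = (k b).1 → 4 ≤ (k a).2 → 4 ≤ (k b).2
  adj : ∀ a b, (k a).1 = (k b).1 → (k a).2 = 7 → 4 ≤ (k b).2 → a ≠ b → G.Adj a b

def Psi (k : V → ℤ × ℕ) : ℕ := (Finset.univ.filter fun a => wtb (k a).2 = true).card

def pot (k : V → ℤ × ℕ) : ℕ := df (UU G k) * (Fintype.card V + 1) + Psi k

structure Mn (k : V → ℤ × ℕ) : Prop where
  st : St G k
  mn : ∀ k', St G k' → pot G k ≤ pot G k'

theorem exists_mn : ∃ k, Mn G k := by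
  have h1 : ∃ k, St G k := by
    let e := Fintype.equivFin V
    refine ⟨fun a => ((e a : ℕ), 1), ?_, ?_, ?_, ?_, ?_⟩
    · intro a b h
      simp only [Prod.mk.injEq, and_true] at h
      exact e.injective (Fin.ext (by exact_mod_cast h))
    all_goals intros; simp at *
  obtain ⟨k, hk, h⟩ := (measure (pot G)).wf.has_min {k | St G k} h1
  exact ⟨k, hk, fun k' hk' => not_lt.1 (h k' hk')⟩

def rvr (r : ℕ) : ℕ := if r < 4 then 3 - r else if r < 7 then 10 - r else r

def rvk (k : V → ℤ × ℕ) : V → ℤ × ℕ := fun a => (-(k a).1, rvr (k a).2)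

theorem rvr_lt : ∀ r < 8, rvr r < 8 := by decide
theorem rvr_rvr : ∀ r < 8, rvr (rvr r) = r := by decide
theorem rvr_up : ∀ r < 8, ∀ r' < 8, (4 ≤ r ↔ 4 ≤ r') → up (rvr r) (rvr r') = up r' r := by decide
theorem rvr_wt : ∀ r < 8, wtb (rvr r) = wtb r := by decide

variable {G}

theorem rvk_rvk {k : V → ℤ × ℕ} (h : St G k) : rvk (rvk k) = k := by
  funext a
  simp [rvk, rvr_rvr _ (h.lt a)]

theorem rvk_UU {k : V → ℤ × ℕ} (h : St G k) : UU G (rvk k) = fun a b => UU G k b a := by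
  funext a b
  simp only [UU, rvk, neg_lt_neg_iff, neg_inj, G.adj_comm a b]
  rw [eq_comm (a := (k a).1)]
  by_cases hb : (k b).1 = (k a).1
  · rw [rvr_up _ (h.lt a) _ (h.lt b) ⟨h.nopath a b hb.symm, h.nopath b a hb⟩]
  · simp [hb]

theorem rvk_St {k : V → ℤ × ℕ} (h : St G k) : St G (rvk k) := by
  have ge4 : ∀ r < 8, (4 ≤ rvr r ↔ 4 ≤ r) := by decide
  have e7 : ∀ r < 8, (rvr r = 7 ↔ r = 7) := by decide
  refine ⟨?_, fun a => rvr_lt _ (h.lt a), ?_, ?_, ?_⟩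
  · intro a b hab
    have h1 := congrFun (rvk_rvk h) a
    have h2 := congrFun (rvk_rvk h) b
    apply h.inj
    rw [← h1, ← h2]
    have : rvk k a = rvk k b := hab
    unfold rvk at this ⊢
    simp only [Prod.mk.injEq] at this
    simp [this.1, this.2]
  · intro a ha j h4 h8
    obtain ⟨b, hb⟩ := h.full a ((ge4 _ (h.lt a)).1 ha) (rvr j) ((ge4 _ h8).2 h4) (rvr_lt _ h8)
    refine ⟨b, ?_⟩
    simp [rvk, hb, rvr_rvr _ h8]
  · intro a b hab ha
    simp only [rvk, neg_inj] at *
    exact (ge4 _ (h.lt b)).2 (h.nopath a b hab ((ge4 _ (h.lt a)).1 ha))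
  · intro a b hab ha hb
    simp only [rvk, neg_inj] at *
    exact h.adj a b hab ((e7 _ (h.lt a)).1 ha) ((ge4 _ (h.lt b)).1 hb)

theorem rvk_Psi {k : V → ℤ × ℕ} (h : St G k) : Psi (rvk k) = Psi k := by
  unfold Psi rvk
  congr 1
  apply Finset.filter_congr
  intro a _
  rw [rvr_wt _ (h.lt a)]

theorem rvk_pot {k : V → ℤ × ℕ} (h : St G k) : pot G (rvk k) = pot G k := by
  unfold pot
  rw [rvk_Psi h, rvk_UU h, df_flip]

theorem rvk_Mn {k : V → ℤ × ℕ} (h : Mn G k) : Mn G (rvk k) := by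
  refine ⟨rvk_St h.st, fun k' hk' => ?_⟩
  rw [rvk_pot h.st]
  exact h.mn _ hk'

theorem Psi_le (k : V → ℤ × ℕ) : Psi k ≤ Fintype.card V := by
  unfold Psi
  exact Finset.card_le_univ _

/-- A minimal state admits no improvement. -/
theorem Mn.absurd_df {k k' : V → ℤ × ℕ} (h : Mn G k) (h' : St G k') (hd : df (UU G k') < df (UU G k)) :
    False := by
  have h1 := h.mn k' h'
  have h2 := Psi_le k'
  unfold pot at h1
  have : (df (UU G k') + 1) * (Fintype.card V + 1) ≤ df (UU G k) * (Fintype.card V + 1) :=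
    Nat.mul_le_mul_right _ hd
  nlinarith

theorem Mn.absurd_Psi {k k' : V → ℤ × ℕ} (h : Mn G k) (h' : St G k') (hd : df (UU G k') ≤ df (UU G k))
    (hp : Psi k' < Psi k) : False := by
  have h1 := h.mn k' h'
  unfold pot at h1
  have : df (UU G k') * (Fintype.card V + 1) ≤ df (UU G k) * (Fintype.card V + 1) :=
    Nat.mul_le_mul_right _ hd
  omega

/-- table lookup -/
def lk (tb : List (ℕ × ℕ)) (r : ℕ) : ℕ := ((tb.find? fun e => e.1 == r).map Prod.snd).getD 0

/-- static consistency of a table -/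
def ck1 (tb : List (ℕ × ℕ)) (adjp : List (ℕ × ℕ)) (prs : List ℕ) : Bool :=
  tb.all fun e => decide (e.2 < 32) && lk tb e.1 == e.2 &&
    (tb.all fun e' => (e.2 != e'.2 || e.1 == e'.1)) &&
    (decide (e.2 % 8 < 4) ||
      (prs.elem e.1 && ([4, 5, 6, 7].all fun j => tb.any fun e' => e'.2 == 8 * (e.2 / 8) + j) &&
       (tb.all fun e' => e.2 / 8 != e'.2 / 8 || decide (4 ≤ e'.2 % 8)) &&
       (e.2 % 8 != 7 || tb.all fun e' => e.2 / 8 != e'.2 / 8 || e.1 == e'.1 || adjp.elem (e.1, e'.1))))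

structure CK1 (tb : List (ℕ × ℕ)) (adjp : List (ℕ × ℕ)) (prs : List ℕ) : Prop where
  lt : ∀ e ∈ tb, e.2 < 32
  lk : ∀ e ∈ tb, lk tb e.1 = e.2
  inj : ∀ e ∈ tb, ∀ e' ∈ tb, e.2 = e'.2 → e.1 = e'.1
  prs : ∀ e ∈ tb, 4 ≤ e.2 % 8 → e.1 ∈ prs
  full : ∀ e ∈ tb, 4 ≤ e.2 % 8 → ∀ j, 4 ≤ j → j < 8 → ∃ e' ∈ tb, e'.2 = 8 * (e.2 / 8) + j
  nopath : ∀ e ∈ tb, 4 ≤ e.2 % 8 → ∀ e' ∈ tb, e.2 / 8 = e'.2 / 8 → 4 ≤ e'.2 % 8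
  adj : ∀ e ∈ tb, e.2 % 8 = 7 → ∀ e' ∈ tb, e.2 / 8 = e'.2 / 8 → e.1 ≠ e'.1 → (e.1, e'.1) ∈ adjp

theorem CK1.of {tb adjp prs} (h : ck1 tb adjp prs = true) : CK1 tb adjp prs := by
  simp only [ck1, List.all_eq_true, Bool.and_eq_true, Bool.or_eq_true, decide_eq_true_eq, beq_iff_eq,
    bne_iff_ne, List.any_eq_true, List.elem_eq_mem] at h
  refine ⟨fun e he => (h e he).1.1.1, fun e he => (h e he).1.1.2, ?_, ?_, ?_, ?_, ?_⟩
  · intro e he e' he' heq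
    rcases (h e he).1.2 e' he' with h1 | h1
    · exact absurd heq h1
    · exact h1
  · intro e he h4
    rcases (h e he).2 with h1 | h1
    · omega
    · exact h1.1.1.1
  · intro e he h4 j hj hj'
    rcases (h e he).2 with h1 | h1
    · omega
    · obtain ⟨e', h2, h3⟩ := h1.1.1.2 j (by simp; omega)
      exact ⟨e', h2, h3⟩
  · intro e he h4 e' he' hb
    rcases (h e he).2 with h1 | h1
    · omega
    · rcases h1.1.2 e' he' with h2 | h2
      · exact absurd hb h2
      · exact h2
  · intro e he h4 e' he' hb hne
    rcases (h e he).2 with h1 | h1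
    · omega
    · rcases h1.2 with h2 | h2
      · exact absurd h4 h2
      · rcases h2 e' he' with (h3 | h3) | h3
        · exact absurd hb h3
        · exact absurd h3 hne
        · exact h3

/-- Conditions on the rearrangement of the block left by `v`. -/
structure Own (k : V → ℤ × ℕ) (v : V) (g : ℕ → ℕ) : Prop where
  rg : ∀ a, a ≠ v → (k a).1 = (k v).1 → 8 ≤ g (k a).2 ∧ g (k a).2 < 12
  inj : ∀ a b, a ≠ v → b ≠ v → (k a).1 = (k v).1 → (k b).1 = (k v).1 → g (k a).2 = g (k b).2 → a = b
  tr : ∀ a b, a ≠ v → b ≠ v → (k a).1 = (k v).1 → (k b).1 = (k v).1 → up (g (k a).2) (g (k b).2) = true →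
    up (k a).2 (k b).2 = true
  wt : ∀ a, a ≠ v → (k a).1 = (k v).1 → wtb (g (k a).2 % 8) = true → wtb (k a).2 = true

/-- positions after a move -/
def ps (s s0 : ℤ) (tb : List (ℕ × ℕ)) (g : ℕ → ℕ) (z : ℤ) (r : ℕ) : ℕ :=
  if z = s then lk tb r else if z = s0 then g r else 8 + r

def mv (loc : V → ℤ × ℕ) (s s0 : ℤ) (tb : List (ℕ × ℕ)) (g : ℕ → ℕ) : V → ℤ × ℕ := fun a =>
  (8 * (loc a).1 + (ps s s0 tb g (loc a).1 (loc a).2 / 8 : ℕ), ps s s0 tb g (loc a).1 (loc a).2 % 8)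

structure MvData (k : V → ℤ × ℕ) (v : V) (s : ℤ) (vr : ℕ) (loc : V → ℤ × ℕ) (g : ℕ → ℕ) : Prop where
  loc_ne : ∀ a, a ≠ v → loc a = k a
  loc_v : loc v = (s, vr)
  kind : (k v).1 = s ∧ (k v).2 = vr ∨ (k v).1 < s ∧ vr = 8 ∧ Own k v g

theorem up_eq {m n : ℕ} : up m n = true ↔ m < n ∧ ¬ frq m n = true := by
  simp [up]

theorem frq8 : ∀ m < 8, ∀ n < 8, frq (8 + m) (8 + n) = frq m n := by decide

theorem up8 {m n : ℕ} (hm : m < 8) (hn : n < 8) (h : up (8 + m) (8 + n) = true) : up m n = true := by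
  rw [up_eq, frq8 m hm n hn] at h
  rw [up_eq]
  exact ⟨by omega, h.2⟩

section Move
variable {k : V → ℤ × ℕ} {v : V} {s : ℤ} {vr : ℕ} {loc : V → ℤ × ℕ} {g : ℕ → ℕ}
  {tb adjp : List (ℕ × ℕ)} {prs : List ℕ}

theorem MvData.loc_inj (hk : St G k) (D : MvData k v s vr loc g) : Function.Injective loc := by
  have key : ∀ a, a ≠ v → loc a ≠ loc v := by
    intro a ha h
    rw [D.loc_ne a ha, D.loc_v] at h
    rcases D.kind with h1 | h1
    · apply ha
      apply hk.inj
      rw [h]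
      exact Prod.ext h1.1.symm h1.2.symm
    · have := hk.lt a
      rw [h] at this
      simp only at this
      omega
  intro a b hab
  by_cases ha : a = v <;> by_cases hb : b = v
  · rw [ha, hb]
  · subst ha; exact absurd hab.symm (key b hb)
  · subst hb; exact absurd hab (key a ha)
  · rw [D.loc_ne a ha, D.loc_ne b hb] at hab
    exact hk.inj hab

theorem MvData.ps_lt (hk : St G k) (D : MvData k v s vr loc g) (C : CK1 tb adjp prs)
    (hkey : ∀ a, (loc a).1 = s → ∃ e ∈ tb, e.1 = (loc a).2) (a : V) :
    ps s (k v).1 tb g (loc a).1 (loc a).2 < 32 := by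
  unfold ps
  split_ifs with h1 h2
  · obtain ⟨e, he, h⟩ := hkey a h1
    rw [← h, C.lk e he]
    exact C.lt e he
  · by_cases hav : a = v
    · rw [hav, D.loc_v] at h1; simp at h1
    · rw [D.loc_ne a hav] at h1 h2 ⊢
      rcases D.kind with h3 | h3
      · exact absurd (h2.trans h3.1) h1
      · have := (h3.2.2.rg a hav h2).2
        omega
  · by_cases hav : a = v
    · rw [hav, D.loc_v] at h1; simp at h1
    · rw [D.loc_ne a hav]
      have := hk.lt a
      omega

theorem MvData.ps_inj (hk : St G k) (D : MvData k v s vr loc g) (C : CK1 tb adjp prs)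
    (hkey : ∀ a, (loc a).1 = s → ∃ e ∈ tb, e.1 = (loc a).2) (a b : V) (h0 : (loc a).1 = (loc b).1)
    (h : ps s (k v).1 tb g (loc a).1 (loc a).2 = ps s (k v).1 tb g (loc b).1 (loc b).2) : a = b := by
  rw [← h0] at h
  unfold ps at h
  split_ifs at h with h1 h2
  · obtain ⟨e, he, h2⟩ := hkey a h1
    obtain ⟨e', he', h2'⟩ := hkey b (h0 ▸ h1)
    rw [← h2, ← h2', C.lk e he, C.lk e' he'] at h
    have := C.inj e he e' he' h
    apply D.loc_inj hk
    exact Prod.ext h0 (by rw [← h2, ← h2', this])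
  · have hav : a ≠ v := by rintro rfl; rw [D.loc_v] at h1; simp at h1
    have hbv : b ≠ v := by rintro rfl; rw [h0, D.loc_v] at h1; simp at h1
    rw [D.loc_ne a hav] at h h1 h2 h0
    rw [D.loc_ne b hbv] at h h0
    rcases D.kind with h3 | h3
    · exact absurd (h2.trans h3.1) h1
    · exact h3.2.2.inj a b hav hbv h2 (h0 ▸ h2) h
  · apply D.loc_inj hk
    exact Prod.ext h0 (by omega)

theorem MvData.mv_UU (hk : St G k) (D : MvData k v s vr loc g) (C : CK1 tb adjp prs)
    (hkey : ∀ a, (loc a).1 = s → ∃ e ∈ tb, e.1 = (loc a).2) (a b : V) :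
    UU G (mv loc s (k v).1 tb g) a b ↔ G.Adj a b ∧ ((loc a).1 < (loc b).1 ∨ (loc a).1 = (loc b).1 ∧
      up (ps s (k v).1 tb g (loc a).1 (loc a).2) (ps s (k v).1 tb g (loc b).1 (loc b).2) = true) := by
  have la := D.ps_lt hk C hkey a
  have lb := D.ps_lt hk C hkey b
  unfold UU mv
  simp only
  generalize ps s (k v).1 tb g (loc a).1 (loc a).2 = p at *
  generalize ps s (k v).1 tb g (loc b).1 (loc b).2 = q at *
  have e1 : (((p / 8 : ℕ) : ℤ)) < 4 := by omega
  have e2 : (((q / 8 : ℕ) : ℤ)) < 4 := by omega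
  have key : up p q = true ↔ (p / 8 < q / 8 ∨ p / 8 = q / 8 ∧ up (p % 8) (q % 8) = true) := by
    have m1 : p % 8 / 8 = 0 := by omega
    have m2 : q % 8 / 8 = 0 := by omega
    simp only [up_eq, frq, Bool.and_eq_true, beq_iff_eq, m1, m2, Nat.mod_mod, true_and]
    constructor
    · rintro ⟨h1, h2⟩
      by_cases h3 : p / 8 = q / 8
      · right; exact ⟨h3, by omega, fun h => h2 ⟨h3, h⟩⟩
      · left; omega
    · rintro (h1 | ⟨h1, h2, h3⟩)
      · exact ⟨by omega, by omega⟩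
      · exact ⟨by omega, fun h => h3 h.2⟩
  rw [key]
  constructor
  · rintro ⟨hA, h | ⟨h1, h2⟩⟩
    · refine ⟨hA, ?_⟩
      by_cases h0 : (loc a).1 = (loc b).1
      · right; refine ⟨h0, Or.inl ?_⟩; omega
      · left; omega
    · exact ⟨hA, Or.inr ⟨by omega, Or.inr ⟨by omega, h2⟩⟩⟩
  · rintro ⟨hA, h | ⟨h1, h2 | h2⟩⟩
    · exact ⟨hA, Or.inl (by omega)⟩
    · exact ⟨hA, Or.inl (by omega)⟩
    · exact ⟨hA, Or.inr ⟨by omega, h2.2⟩⟩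

theorem MvData.mv_St (hk : St G k) (D : MvData k v s vr loc g) (C : CK1 tb adjp prs)
    (hkey : ∀ a, (loc a).1 = s → ∃ e ∈ tb, e.1 = (loc a).2)
    (hprs : ∀ r ∈ prs, ∃ a, loc a = (s, r))
    (hadj : ∀ r r', (r, r') ∈ adjp → ∀ a b, loc a = (s, r) → loc b = (s, r') → G.Adj a b) :
    St G (mv loc s (k v).1 tb g) := by
  have L := D.ps_lt hk C hkey
  have blk : ∀ a b, (mv loc s (k v).1 tb g a).1 = (mv loc s (k v).1 tb g b).1 → (loc a).1 = (loc b).1 ∧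
      ps s (k v).1 tb g (loc a).1 (loc a).2 / 8 = ps s (k v).1 tb g (loc b).1 (loc b).2 / 8 := by
    intro a b h
    have h1 := L a
    have h2 := L b
    unfold mv at h
    simp only at h
    constructor <;> omega
  have pss : ∀ a, (loc a).1 = s → ∃ e ∈ tb, e.1 = (loc a).2 ∧
      ps s (k v).1 tb g (loc a).1 (loc a).2 = e.2 := by
    intro a ha
    obtain ⟨e, he, h⟩ := hkey a ha
    refine ⟨e, he, h, ?_⟩
    unfold ps
    rw [if_pos ha, ← h, C.lk e he]
  have oth : ∀ a, (loc a).1 ≠ s → 4 ≤ ps s (k v).1 tb g (loc a).1 (loc a).2 % 8 →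
      a ≠ v ∧ loc a = k a ∧ (k a).1 ≠ (k v).1 ∧ 4 ≤ (k a).2 := by
    intro a ha h4
    have hav : a ≠ v := by rintro rfl; rw [D.loc_v] at ha; simp at ha
    rw [D.loc_ne a hav] at h4 ha
    unfold ps at h4
    rw [if_neg ha] at h4
    split_ifs at h4 with h5
    · rcases D.kind with h3 | h3
      · exact absurd (h5.trans h3.1) ha
      · have := h3.2.2.rg a hav h5
        omega
    · refine ⟨hav, D.loc_ne a hav, h5, ?_⟩
      have := hk.lt a
      omega
  have oth2 : ∀ a, (k a).1 ≠ s → (k a).1 ≠ (k v).1 → loc a = k a ∧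
      ps s (k v).1 tb g (loc a).1 (loc a).2 = 8 + (k a).2 := by
    intro a h1 h2
    have hav : a ≠ v := by rintro rfl; exact h2 rfl
    rw [D.loc_ne a hav]
    refine ⟨rfl, ?_⟩
    unfold ps
    rw [if_neg h1, if_neg h2]
  refine ⟨?_, ?_, ?_, ?_, ?_⟩
  · intro a b hab
    obtain ⟨h1, h2⟩ := blk a b (congrArg Prod.fst hab)
    apply D.ps_inj hk C hkey a b h1
    have h3 := congrArg Prod.snd hab
    unfold mv at h3
    simp only at h3
    omega
  · intro a
    unfold mv
    simp only
    omega
  · intro a h4 j hj hj'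
    unfold mv at h4
    simp only at h4
    by_cases ha : (loc a).1 = s
    · obtain ⟨e, he, h1, h2⟩ := pss a ha
      rw [h2] at h4
      obtain ⟨e', he', h3⟩ := C.full e he h4 j hj hj'
      obtain ⟨b, hb⟩ := hprs _ (C.prs e' he' (by omega))
      refine ⟨b, ?_⟩
      have hb1 : ps s (k v).1 tb g (loc b).1 (loc b).2 = e'.2 := by
        unfold ps
        rw [hb, if_pos rfl, C.lk e' he']
      unfold mv
      rw [h2, hb1, ha, hb]
      ext <;> simp only <;> omega
    · obtain ⟨h1, h2, h3, h5⟩ := oth a ha h4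
      obtain ⟨b, hb⟩ := hk.full a h5 j hj hj'
      have hb1 : (k b).1 = (k a).1 := by rw [hb]
      have hb2 : (k b).2 = j := by rw [hb]
      rw [h2] at ha
      obtain ⟨h6, h7⟩ := oth2 b (by rw [hb1]; exact ha) (by rw [hb1]; exact h3)
      obtain ⟨-, h8⟩ := oth2 a ha h3
      refine ⟨b, ?_⟩
      unfold mv
      have := hk.lt a
      rw [h7, h8, h6, h2, hb]
      ext <;> simp only <;> omega
  · intro a b hab h4
    obtain ⟨h1, h2⟩ := blk a b hab
    unfold mv at h4 ⊢
    simp only at h4 ⊢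
    by_cases ha : (loc a).1 = s
    · obtain ⟨e, he, h5, h6⟩ := pss a ha
      obtain ⟨e', he', h5', h6'⟩ := pss b (h1 ▸ ha)
      rw [h6] at h4 h2
      rw [h6'] at h2 ⊢
      exact C.nopath e he h4 e' he' h2
    · obtain ⟨h5, h6, h7, h8⟩ := oth a ha h4
      have hbv : b ≠ v := by
        rintro rfl
        rw [h1, D.loc_v] at ha
        simp at ha
      rw [h6] at h1 ha
      rw [D.loc_ne b hbv] at h1
      obtain ⟨h9, h10⟩ := oth2 b (h1 ▸ ha) (h1 ▸ h7)
      rw [h10]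
      have := hk.nopath a b h1 h8
      have := hk.lt b
      omega
  · intro a b hab h7 h4 hne
    obtain ⟨h1, h2⟩ := blk a b hab
    unfold mv at h4 h7
    simp only at h4 h7
    by_cases ha : (loc a).1 = s
    · obtain ⟨e, he, h5, h6⟩ := pss a ha
      obtain ⟨e', he', h5', h6'⟩ := pss b (h1 ▸ ha)
      rw [h6] at h7 h2
      rw [h6'] at h2
      refine hadj _ _ (C.adj e he h7 e' he' h2 ?_) a b (Prod.ext ha h5.symm) (Prod.ext (h1 ▸ ha) h5'.symm)
      intro heq
      apply hne
      apply D.loc_inj hk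
      exact Prod.ext h1 (by rw [← h5, ← h5', heq])
    · obtain ⟨h5, h6, h8, h9⟩ := oth a ha (by omega)
      obtain ⟨h5', h6', h8', h9'⟩ := oth b (h1 ▸ ha) h4
      rw [h6] at ha h1
      rw [h6'] at h1
      obtain ⟨-, h10⟩ := oth2 a ha h8
      rw [h10] at h7
      have := hk.lt a
      exact hk.adj a b h1 (by omega) h9' hne

/-- new relations come from old ones, pairs of the table, or go into `v` -/
theorem MvData.mv_tr (hk : St G k) (D : MvData k v s vr loc g) (C : CK1 tb adjp prs)
    (hkey : ∀ a, (loc a).1 = s → ∃ e ∈ tb, e.1 = (loc a).2) (a b : V)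
    (h : UU G (mv loc s (k v).1 tb g) a b) :
    UU G k a b ∨ (b = v ∧ vr = 8) ∨ (G.Adj a b ∧ (loc a).1 = s ∧ (loc b).1 = s ∧ (loc a).2 ≠ 8 ∧
      ∃ e ∈ tb, ∃ e' ∈ tb, e.1 = (loc a).2 ∧ e'.1 = (loc b).2 ∧ up e.2 e'.2 = true) := by
  rw [D.mv_UU hk C hkey] at h
  obtain ⟨hA, h⟩ := h
  by_cases hb : b = v ∧ vr = 8
  · exact Or.inr (Or.inl hb)
  have hlb : loc b = k b := by
    by_cases hbv : b = v
    · rcases D.kind with h1 | h1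
      · rw [hbv, D.loc_v]; exact Prod.ext h1.1.symm h1.2.symm
      · exact absurd ⟨hbv, h1.2.1⟩ hb
    · exact D.loc_ne b hbv
  have hla : loc a = k a ∨ a = v ∧ (k v).1 < s ∧ (loc a).1 = s ∧ (loc a).2 = 8 := by
    by_cases hav : a = v
    · rcases D.kind with h1 | h1
      · left; rw [hav, D.loc_v]; exact Prod.ext h1.1.symm h1.2.symm
      · right; refine ⟨hav, h1.1, ?_, ?_⟩
        · rw [hav, D.loc_v]
        · rw [hav, D.loc_v]; exact h1.2.1
    · left; exact D.loc_ne a hav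
  rcases hla with hla | ⟨rfl, h1, h2, h3⟩
  · rcases h with h | ⟨h0, h⟩
    · left
      rw [hla, hlb] at h
      exact ⟨hA, Or.inl h⟩
    · by_cases hs : (loc a).1 = s
      · right; right
        obtain ⟨e, he, h1⟩ := hkey a hs
        obtain ⟨e', he', h1'⟩ := hkey b (h0 ▸ hs)
        refine ⟨hA, hs, h0 ▸ hs, ?_, e, he, e', he', h1, h1', ?_⟩
        · rw [hla]; have := hk.lt a; omega
        · unfold ps at h
          rw [if_pos hs, if_pos (h0 ▸ hs), ← h1, ← h1', C.lk e he, C.lk e' he'] at h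
          exact h
      · left
        rw [hla, hlb] at h h0
        rw [hla] at hs
        have hs' := hs
        rw [h0] at hs'
        refine ⟨hA, Or.inr ⟨h0, ?_⟩⟩
        unfold ps at h
        rw [if_neg hs, if_neg hs'] at h
        have hav : a ≠ v := by rintro rfl; rw [← hla, D.loc_v] at hs; exact hs rfl
        have hbv : b ≠ v := by rintro rfl; rw [← hlb, D.loc_v] at hs'; exact hs' rfl
        by_cases h5 : (k a).1 = (k v).1
        · rw [if_pos h5, if_pos (h0 ▸ h5)] at h
          rcases D.kind with h6 | h6
          · exact absurd (h5.trans h6.1) hs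
          · exact h6.2.2.tr a b hav hbv h5 (h0 ▸ h5) h
        · rw [if_neg h5, if_neg (h0 ▸ h5)] at h
          exact up8 (hk.lt a) (hk.lt b) h
  · left
    refine ⟨hA, Or.inl ?_⟩
    rw [← hlb]
    rcases h with h | h
    · omega
    · omega

end Move
end Layout

set_option linter.unusedSectionVars false
section Layout
variable {V : Type} [Fintype V] {G : SimpleGraph V}

theorem card_nb {v : V} (hdeg : vdeg G v ≤ 7) (S : Finset V) (h : ∀ b ∈ S, G.Adj v b) : S.card ≤ 7 := by
  refine le_trans ?_ hdeg
  unfold vdeg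
  rw [← Set.ncard_coe_finset]
  exact Set.ncard_le_ncard (fun b hb => h b hb) (Set.toFinite _)

theorem UU.ne {k : V → ℤ × ℕ} {a b : V} (h : UU G k a b) : ¬ UU G k b a := by
  rintro ⟨-, h1⟩
  obtain ⟨-, h2⟩ := h
  rw [up_eq] at h1 h2
  rcases h1 with h1 | h1 <;> rcases h2 with h2 | h2 <;> omega

section Move
variable {k : V → ℤ × ℕ} {v : V} {s : ℤ} {vr : ℕ} {loc : V → ℤ × ℕ} {g : ℕ → ℕ}
  {tb adjp : List (ℕ × ℕ)} {prs : List ℕ}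

def ck3 (tb : List (ℕ × ℕ)) (vr : ℕ) (El : List ℕ) : Bool :=
  (tb.all fun e => !wtb (e.2 % 8) || (!El.elem e.1 && (wtb e.1 || e.1 == vr))) &&
  (El.all fun r => wtb r && r != 8) && decide El.Nodup &&
  (decide (2 ≤ El.length) || (decide (1 ≤ El.length) &&
    (tb.all fun e => e.1 != vr || !wtb (e.2 % 8) || (vr != 8 && wtb vr))))

theorem MvData.Psi_drop (hk : St G k) (D : MvData k v s vr loc g) (C : CK1 tb adjp prs)
    (hkey : ∀ a, (loc a).1 = s → ∃ e ∈ tb, e.1 = (loc a).2) (El : List ℕ)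
    (h3 : ck3 tb vr El = true) (hE : ∀ r ∈ El, ∃ a, k a = (s, r)) :
    Psi (mv loc s (k v).1 tb g) < Psi k := by
  simp only [ck3, List.all_eq_true, Bool.and_eq_true, Bool.or_eq_true, decide_eq_true_eq, beq_iff_eq,
    bne_iff_ne, List.any_eq_true, Bool.not_eq_true'] at h3
  obtain ⟨⟨⟨t1, t2⟩, t3⟩, t4⟩ := h3
  have t1' : ∀ e ∈ tb, wtb (e.2 % 8) = true → e.1 ∉ El ∧ (wtb e.1 = true ∨ e.1 = vr) := by
    intro e he hw
    rcases t1 e he with h | h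
    · rw [hw] at h; cases h
    · refine ⟨fun h' => ?_, h.2⟩
      have := List.elem_eq_true_of_mem h'
      rw [this] at h; cases h.1
  haveI : Nonempty V := ⟨v⟩
  choose! f hf using hE
  have finj : Set.InjOn f (El.toFinset : Set ℕ) := by
    intro a ha b hb hab
    have h1 := hf a (by simpa using ha)
    have h2 := hf b (by simpa using hb)
    rw [hab, h2] at h1
    simpa using h1.symm
  have hcard : (El.toFinset.image f).card = El.length := by
    rw [Finset.card_image_of_injOn finj, List.toFinset_card_of_nodup t3]
  have tbl : ∀ a, (loc a).1 = s → ∃ e ∈ tb, e.1 = (loc a).2 ∧ (mv loc s (k v).1 tb g a).2 = e.2 % 8 := by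
    intro a ha
    obtain ⟨e, he, h⟩ := hkey a ha
    refine ⟨e, he, h, ?_⟩
    unfold mv ps
    simp only
    rw [if_pos ha, ← h, C.lk e he]
  have key : ∀ a, a ≠ v → wtb (mv loc s (k v).1 tb g a).2 = true → wtb (k a).2 = true := by
    intro a hav hw
    by_cases ha : (loc a).1 = s
    · obtain ⟨e, he, h, h'⟩ := tbl a ha
      rw [h'] at hw
      rcases (t1' e he hw).2 with h5 | h5
      · rw [h, D.loc_ne a hav] at h5; exact h5
      · exfalso; apply hav; apply D.loc_inj hk
        rw [D.loc_v]; exact Prod.ext ha (by rw [← h, h5])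
    · unfold mv ps at hw
      simp only at hw
      rw [if_neg ha] at hw
      rw [D.loc_ne a hav] at hw ha
      split_ifs at hw with h5
      · rcases D.kind with h6 | h6
        · exact absurd (h5.trans h6.1) ha
        · exact h6.2.2.wt a hav h5 hw
      · have := hk.lt a
        rw [Nat.add_mod_left, Nat.mod_eq_of_lt this] at hw
        exact hw
  have keyE : ∀ a ∈ El.toFinset.image f, wtb (k a).2 = true ∧ ¬ wtb (mv loc s (k v).1 tb g a).2 = true := by
    intro a ha
    simp only [Finset.mem_image, List.mem_toFinset] at ha
    obtain ⟨r, hr, rfl⟩ := ha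
    have h1 := hf r hr
    refine ⟨by rw [h1]; exact (t2 r hr).1, ?_⟩
    intro hw
    have hl : loc (f r) = (s, r) ∨ f r = v := by
      by_cases hv : f r = v
      · exact Or.inr hv
      · left; rw [D.loc_ne _ hv, h1]
    have hl' : loc (f r) = (s, r) := by
      rcases hl with h | h
      · exact h
      · rcases D.kind with h6 | h6
        · rw [h, D.loc_v]
          rw [h] at h1
          rw [h1] at h6
          exact Prod.ext rfl h6.2.symm
        · exfalso
          rw [h] at h1
          rw [h1] at h6
          exact lt_irrefl _ h6.1
    obtain ⟨e, he, h, h'⟩ := tbl (f r) (by rw [hl'])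
    rw [h'] at hw
    have := (t1' e he hw).1
    rw [h, hl'] at this
    exact this hr
  set A' := Finset.univ.filter fun a => wtb (mv loc s (k v).1 tb g a).2 = true with hA'
  set A := Finset.univ.filter fun a => wtb (k a).2 = true with hA
  change A'.card < A.card
  have hsub : El.toFinset.image f ⊆ A := fun a ha => by
    rw [hA, Finset.mem_filter]; exact ⟨Finset.mem_univ _, (keyE a ha).1⟩
  have hc := Finset.card_sdiff_add_card_eq_card hsub
  rw [hcard] at hc
  rcases t4 with t4 | ⟨t4, t5⟩
  · have : A' ⊆ insert v (A \ El.toFinset.image f) := by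
      intro a ha
      rw [hA', Finset.mem_filter] at ha
      rw [Finset.mem_insert, Finset.mem_sdiff, hA, Finset.mem_filter]
      by_cases hav : a = v
      · exact Or.inl hav
      · right
        exact ⟨⟨Finset.mem_univ _, key a hav ha.2⟩, fun h => (keyE a h).2 ha.2⟩
    have h1 := Finset.card_le_card this
    have h2 := Finset.card_insert_le v (A \ El.toFinset.image f)
    omega
  · have : A' ⊆ (A \ El.toFinset.image f) := by
      intro a ha
      rw [hA', Finset.mem_filter] at ha
      rw [Finset.mem_sdiff, hA, Finset.mem_filter]
      refine ⟨⟨Finset.mem_univ _, ?_⟩, fun h => (keyE a h).2 ha.2⟩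
      by_cases hav : a = v
      · obtain ⟨e, he, h, h'⟩ := tbl a (by rw [hav, D.loc_v])
        rw [hav, D.loc_v] at h
        rcases t5 e he with (h7 | h7) | h7
        · exact absurd h h7
        · rw [← h', ha.2] at h7; cases h7
        · rcases D.kind with h6 | h6
          · rw [hav, h6.2]; exact h7.2
          · exact absurd h6.2.1 h7.1
      · exact key a hav ha.2
    have h1 := Finset.card_le_card this
    omega

structure Ctx (G : SimpleGraph V) (k : V → ℤ × ℕ) (v : V) (P Q : Finset V) : Prop where
  mn : Mn G k
  deg : ∀ a, vdeg G a ≤ 7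
  crit : Crit (UU G k) P Q
  vP : v ∈ P
  five : 5 ≤ (Q.filter fun b => UU G k v b).card
  pos : 0 < df (UU G k)

def ck2 (tb : List (ℕ × ℕ)) (vr : ℕ) (um : List ℕ) (X : List (ℕ × ℕ)) (r0 : ℕ) : Bool :=
  tb.all fun e => tb.all fun e' => !up e.2 e'.2 ||
    ((e'.1 == vr || e.1 == 8 || up e.1 e'.1 || X.elem (e.1, e'.1)) &&
     !(um.elem e.1 && e'.1 == vr) && !(e.1 == vr && e'.1 == r0))

theorem Ctx.drop {P Q : Finset V} (c : Ctx G k v P Q) (D : MvData k v s vr loc g) (C : CK1 tb adjp prs)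
    (hkey : ∀ a, (loc a).1 = s → ∃ e ∈ tb, e.1 = (loc a).2)
    (um : List ℕ) (Xc Y : List (ℕ × ℕ)) (r0 : ℕ) (h2 : ck2 tb vr um (Xc ++ Y) r0 = true)
    (hum : ∀ u ∈ Q, UU G k v u → s ≤ (k u).1 ∧ ((k u).1 = s → (k u).2 ∈ um))
    (u0 : V) (hu0 : u0 ∈ Q) (hvu0 : UU G k v u0) (hk0 : k u0 = (s, r0))
    (hY : Y = [] ∨ Y = [(7, 6)] ∧ Xc = [] ∧ r0 = 7 ∧
      (Finset.univ.filter fun b => UU G k u0 b).card ≤ 1) :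
    df (UU G (mv loc s (k v).1 tb g)) + 1 ≤ df (UU G k) + Xc.length := by
  have hk := c.mn.st
  simp only [ck2, List.all_eq_true, Bool.and_eq_true, Bool.or_eq_true, decide_eq_true_eq, beq_iff_eq,
    bne_iff_ne, List.any_eq_true, Bool.not_eq_true', List.elem_eq_mem, List.mem_append] at h2
  have tr := D.mv_tr (G := G) hk C hkey
  have vne : ∀ u, UU G k v u → u ≠ v := by
    rintro u h rfl
    exact G.loopless.irrefl _ h.1
  let X : Finset (V × V) := Finset.univ.filter fun p =>
    ((loc p.1).1 = s ∧ (loc p.2).1 = s) ∧ ((loc p.1).2, (loc p.2).2) ∈ Xc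
  have hX : X.card ≤ Xc.length := by
    refine le_trans ?_ (List.toFinset_card_le Xc)
    refine Finset.card_le_card_of_injOn (fun p => ((loc p.1).2, (loc p.2).2)) ?_ ?_
    · intro p hp
      simp only [X, Finset.coe_filter, Set.mem_ofPred_eq] at hp
      simpa using hp.2.2
    · intro p hp q hq hpq
      simp only [X, Finset.coe_filter, Set.mem_ofPred_eq] at hp hq
      simp only [Prod.mk.injEq] at hpq
      refine Prod.ext ?_ ?_
      · exact D.loc_inj hk (Prod.ext (hp.2.1.1.trans hq.2.1.1.symm) hpq.1)
      · exact D.loc_inj hk (Prod.ext (hp.2.1.2.trans hq.2.1.2.symm) hpq.2)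
  have loc0 : ∀ u, UU G k v u → loc u = k u := fun u hu => D.loc_ne u (vne u hu)
  -- nobody of the upper neighbourhood is below `v`
  have nd : ∀ u ∈ Q, UU G k v u → ¬ UU G (mv loc s (k v).1 tb g) u v := by
    intro u hu hvu hc
    have hc0 := hc
    rw [D.mv_UU hk C hkey, loc0 u hvu, D.loc_v] at hc
    obtain ⟨hm1, hm2⟩ := hum u hu hvu
    obtain ⟨-, h | ⟨h, h'⟩⟩ := hc
    · simp only at h; omega
    · simp only at h h'
      obtain ⟨e, he, h4⟩ := hkey u (by rw [loc0 u hvu]; exact h)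
      obtain ⟨e', he', h5⟩ := hkey v (by rw [D.loc_v])
      rw [loc0 u hvu] at h4
      rw [D.loc_v] at h5
      unfold ps at h'
      rw [if_pos h, if_pos rfl, ← h4, C.lk e he] at h'
      simp only at h5
      rw [← h5, C.lk e' he'] at h'
      have h6 := h2 e he e' he'
      rcases h6 with h6 | h6
      · rw [h'] at h6; cases h6
      · have h7 := h6.1.2
        rw [h4, h5] at h7
        simp [hm2 h] at h7
  have nu : ¬ UU G (mv loc s (k v).1 tb g) v u0 := by
    intro hc
    rw [D.mv_UU hk C hkey, loc0 u0 hvu0, D.loc_v, hk0] at hc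
    obtain ⟨-, h | ⟨h, h'⟩⟩ := hc
    · simp at h
    · obtain ⟨e, he, h4⟩ := hkey u0 (by rw [loc0 u0 hvu0, hk0])
      obtain ⟨e', he', h5⟩ := hkey v (by rw [D.loc_v])
      rw [loc0 u0 hvu0, hk0] at h4
      rw [D.loc_v] at h5
      unfold ps at h'
      simp only at h4 h5 h'
      rw [if_pos True.intro, if_pos True.intro, ← h4, C.lk e he, ← h5, C.lk e' he'] at h'
      rcases h2 e' he' e he with h6 | h6
      · rw [h'] at h6; cases h6
      · have h7 := h6.2
        rw [h4, h5] at h7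
        simp at h7
  have hd : (Finset.univ.filter fun a => UU G (mv loc s (k v).1 tb g) a v).card ≤ 2 := by
    have h1 := card_nb (c.deg v) ((Finset.univ.filter fun a => UU G (mv loc s (k v).1 tb g) a v) ∪
      (Q.filter fun b => UU G k v b)) (by
        intro b hb
        rw [Finset.mem_union, Finset.mem_filter, Finset.mem_filter] at hb
        rcases hb with hb | hb
        · exact hb.2.1.symm
        · exact hb.2.1)
    rw [Finset.card_union_of_disjoint] at h1
    · have := c.five; omega
    · rw [Finset.disjoint_left]
      intro a ha hb
      rw [Finset.mem_filter] at ha hb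
      exact nd a hb.1 hb.2 ha.2
  have main : ∀ a b, UU G (mv loc s (k v).1 tb g) a b → b ≠ v →
      UU G k a b ∨ (a, b) ∈ X ∨ ((loc a).1 = s ∧ (loc b).1 = s ∧ ((loc a).2, (loc b).2) ∈ Y) := by
    intro a b hab hbv
    rcases tr a b hab with h | h | h
    · exact Or.inl h
    · exact absurd h.1 hbv
    · obtain ⟨hA, ha, hb, h8, e, he, e', he', h4, h5, h6⟩ := h
      rcases h2 e he e' he' with h7 | h7
      · rw [h6] at h7; cases h7
      · rcases h7.1.1 with ((h9 | h9) | h9) | h9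
        · exfalso; apply hbv; apply D.loc_inj hk
          rw [D.loc_v]; exact Prod.ext hb (by rw [← h5, h9])
        · exact absurd (h4.symm.trans h9) h8
        · left
          have hlb : loc b = k b := D.loc_ne b hbv
          have hla : loc a = k a := by
            by_cases hav : a = v
            · rcases D.kind with h1 | h1
              · rw [hav, D.loc_v]; exact Prod.ext h1.1.symm h1.2.symm
              · rw [hav, D.loc_v] at h8; exact absurd h1.2.1 h8
            · exact D.loc_ne a hav
          rw [h4, h5, hla, hlb] at h9
          rw [hla] at ha
          rw [hlb] at hb
          exact ⟨hA, Or.inr ⟨ha.trans hb.symm, h9⟩⟩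
        · right
          rw [h4, h5] at h9
          rcases h9 with h9 | h9
          · left
            simp only [X, Finset.mem_filter]
            exact ⟨Finset.mem_univ _, ⟨ha, hb⟩, by simpa using h9⟩
          · right; exact ⟨ha, hb, by simpa using h9⟩
  rcases hY with rfl | ⟨rfl, hz, hr7, hz1⟩
  · have := df_drop c.crit ∅ {v} X (by simp) (by simpa using hd)
      (by
        intro a b hab _ hb
        rcases main a b hab (by simpa using hb) with h | h | h
        · exact Or.inl h
        · exact Or.inr h
        · simp at h)
      c.vP hu0 hvu0 nu c.pos
    omega
  · have hX0 : X = ∅ := by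
      rw [← Finset.card_eq_zero]
      rw [hz, List.length_nil] at hX
      omega
    have hzup : (Finset.univ.filter fun b => UU G (mv loc s (k v).1 tb g) u0 b).card ≤ 2 := by
      have ms : ∀ b, UU G (mv loc s (k v).1 tb g) u0 b → UU G k u0 b ∨ loc b = (s, 6) := by
        intro b hb
        by_cases hbv : b = v
        · rw [hbv] at hb; exact absurd hb (nd u0 hu0 hvu0)
        rcases main u0 b hb hbv with h | h | h
        · exact Or.inl h
        · rw [hX0] at h; simp at h
        · right
          refine Prod.ext h.2.1 ?_
          have := h.2.2
          simp at this
          exact this.2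
      by_cases h6 : ∃ w, loc w = (s, 6)
      · obtain ⟨w, hw⟩ := h6
        have : (Finset.univ.filter fun b => UU G (mv loc s (k v).1 tb g) u0 b) ⊆
            insert w (Finset.univ.filter fun b => UU G k u0 b) := by
          intro b hb
          rw [Finset.mem_filter] at hb
          rw [Finset.mem_insert, Finset.mem_filter]
          rcases ms b hb.2 with h | h
          · exact Or.inr ⟨Finset.mem_univ _, h⟩
          · left
            apply D.loc_inj hk
            rw [hw, h]
        have h1 := Finset.card_le_card this
        have h2 := Finset.card_insert_le w (Finset.univ.filter fun b => UU G k u0 b)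
        omega
      · refine le_trans (Finset.card_le_card ?_) (hz1.trans (by norm_num))
        intro b hb
        rw [Finset.mem_filter] at hb ⊢
        rcases ms b hb.2 with h | h
        · exact ⟨Finset.mem_univ _, h⟩
        · exact absurd ⟨b, h⟩ h6
    have := df_drop c.crit (Finset.univ.filter fun a => loc a = (s, 7) ∧ a = u0) {v} ∅ (by
        intro a ha
        rw [Finset.mem_filter] at ha
        rw [ha.2.2]; exact hzup) (by simpa using hd)
      (by
        intro a b hab ha hb
        rcases main a b hab (by simpa using hb) with h | h | h
        · exact Or.inl h
        · rw [hX0] at h; exact Or.inr h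
        · exfalso
          apply ha
          rw [Finset.mem_filter]
          have h7 := h.2.2
          simp at h7
          have h8 : loc a = (s, 7) := Prod.ext h.1 h7.1
          refine ⟨Finset.mem_univ _, h8, ?_⟩
          apply D.loc_inj hk
          rw [h8, loc0 u0 hvu0, hk0, hr7])
      c.vP hu0 hvu0 nu c.pos
    simp at this
    omega

end Move
end Layout

set_option linter.unusedSectionVars false
section Layout
variable {V : Type} [Fintype V] {G : SimpleGraph V}
variable {k : V → ℤ × ℕ} {v : V} {s : ℤ} {g : ℕ → ℕ} {P Q : Finset V}

def ckw (tb X : List (ℕ × ℕ)) : Bool :=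
  tb.all fun e => tb.all fun e' => !up e.2 e'.2 || up e.1 e'.1 || X.elem (e.1, e'.1)

theorem mvTriv {vr : ℕ} (hv : k v = (s, vr)) : MvData k v s vr k id :=
  ⟨fun _ _ => rfl, hv, Or.inl (by rw [hv]; exact ⟨rfl, rfl⟩)⟩

theorem keyOf {tb : List (ℕ × ℕ)} {L : List ℕ} (h : (L.all fun r => tb.any fun e => e.1 == r) = true) :
    ∀ r ∈ L, ∃ e ∈ tb, e.1 = r := by
  simpa only [List.all_eq_true, List.any_eq_true, beq_iff_eq] using h

theorem weak_tr (hk : St G k) {vr : ℕ} (hv : k v = (s, vr)) {tb X adjp : List (ℕ × ℕ)} {prs L : List ℕ}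
    (h1 : ck1 tb adjp prs = true) (h2 : ckw tb X = true)
    (hL : ∀ a, (k a).1 = s → (k a).2 ∈ L) (hLk : (L.all fun r => tb.any fun e => e.1 == r) = true)
    (a b : V) (h : UU G (mv k s (k v).1 tb id) a b) :
    UU G k a b ∨ G.Adj a b ∧ ∃ x ∈ X, k a = (s, x.1) ∧ k b = (s, x.2) := by
  have hkey : ∀ a, (k a).1 = s → ∃ e ∈ tb, e.1 = (k a).2 := fun a ha => keyOf hLk _ (hL a ha)
  rcases (mvTriv hv).mv_tr hk (CK1.of h1) hkey a b h with h | h | ⟨hA, ha, hb, -, e, he, e', he', h4, h5, h6⟩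
  · exact Or.inl h
  · have := hk.lt v
    rw [hv] at this
    simp only at this
    omega
  · simp only [ckw, List.all_eq_true, Bool.or_eq_true, Bool.not_eq_true', List.elem_eq_mem,
      decide_eq_true_eq] at h2
    rcases h2 e he e' he' with (h7 | h7) | h7
    · rw [h6] at h7; cases h7
    · left; rw [h4, h5] at h7; exact ⟨hA, Or.inr ⟨ha.trans hb.symm, h7⟩⟩
    · right; exact ⟨hA, _, h7, Prod.ext ha h4.symm, Prod.ext hb h5.symm⟩

theorem Mn.weak (hm : Mn G k) {vr : ℕ} (hv : k v = (s, vr)) {tb : List (ℕ × ℕ)} {L : List ℕ}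
    (h1 : ck1 tb [] [] = true)
    (hL : ∀ a, (k a).1 = s → (k a).2 ∈ L) (hLk : (L.all fun r => tb.any fun e => e.1 == r) = true)
    (El : List ℕ) (h3 : ck3 tb vr El = true) (hE : ∀ r ∈ El, ∃ a, k a = (s, r))
    (h : df (UU G (mv k s (k v).1 tb id)) ≤ df (UU G k)) : False := by
  have hkey : ∀ a, (k a).1 = s → ∃ e ∈ tb, e.1 = (k a).2 := fun a ha => keyOf hLk _ (hL a ha)
  refine hm.absurd_Psi ((mvTriv hv).mv_St hm.st (CK1.of h1) hkey (by simp) (by simp)) h ?_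
  exact (mvTriv hv).Psi_drop hm.st (CK1.of h1) hkey El h3 hE

theorem path_roles (hk : St G k) {a : V} (ha : (k a).1 = s) (h4 : (k a).2 < 4) :
    ∀ b, (k b).1 = s → (k b).2 ∈ [0, 1, 2, 3] := by
  intro b hb
  have : ¬ 4 ≤ (k b).2 := fun h => by
    have := hk.nopath b a (hb.trans ha.symm) h
    omega
  simp; omega

theorem star_roles (hk : St G k) {a : V} (ha : (k a).1 = s) (h4 : 4 ≤ (k a).2) :
    ∀ b, (k b).1 = s → (k b).2 ∈ [4, 5, 6, 7] := by
  intro b hb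
  have := hk.nopath a b (ha.trans hb.symm) h4
  have := hk.lt b
  simp; omega

theorem Mn.n1 (hm : Mn G k) {a : V} (ha : k a = (s, 0)) :
    ∃ b c, k b = (s, 1) ∧ k c = (s, 2) ∧ G.Adj a b ∧ G.Adj b c := by
  have hk := hm.st
  have hL := path_roles hk (s := s) (a := a) (by rw [ha]) (by rw [ha]; simp)
  have h1 : ∃ b, k b = (s, 1) ∧ G.Adj a b := by
    by_contra hc
    push Not at hc
    refine hm.weak ha (tb := [(0, 1), (1, 9), (2, 10), (3, 11)]) (L := [0, 1, 2, 3]) (by decide) hL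
      (by decide) [0] (by decide) (by simp; exact ⟨a, ha⟩) ?_
    apply df_weak ∅ ∅ (by simp) (by simp)
    intro x y hxy _ _
    rcases weak_tr (X := [(0, 1)]) (L := [0, 1, 2, 3]) hk ha (adjp := []) (prs := []) (by decide) (by decide)
      hL (by decide) x y hxy with h | ⟨hA, p, hp, h1, h2⟩
    · exact h
    · simp at hp; subst hp
      have : x = a := hk.inj (h1.trans ha.symm)
      subst this
      exact absurd hA (hc y h2)
  obtain ⟨b, hb, hab⟩ := h1
  refine ⟨b, ?_⟩
  by_contra hc
  push Not at hc
  refine hm.weak ha (tb := [(0, 1), (1, 2), (2, 10), (3, 11)]) (L := [0, 1, 2, 3]) (by decide) hL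
    (by decide) [0] (by decide) (by simp; exact ⟨a, ha⟩) ?_
  apply df_weak ∅ ∅ (by simp) (by simp)
  intro x y hxy _ _
  rcases weak_tr (X := [(1, 2)]) (L := [0, 1, 2, 3]) hk ha (adjp := []) (prs := []) (by decide) (by decide)
    hL (by decide) x y hxy with h | ⟨hA, p, hp, h1, h2⟩
  · exact h
  · simp at hp; subst hp
    have : x = b := hk.inj (h1.trans hb.symm)
    subst this
    exact absurd hA (hc y hb h2 hab)

theorem rvk_at (hk : St G k) {b : V} {r : ℕ} (hr : r < 8) (h : rvk k b = (-s, rvr r)) : k b = (s, r) := by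
  rw [← rvk_rvk hk]
  unfold rvk at h ⊢
  simp only [Prod.mk.injEq] at h
  simp [h.1, h.2, rvr_rvr r hr]

theorem rvk_at' {b : V} {r : ℕ} (h : k b = (s, r)) : rvk k b = (-s, rvr r) := by
  unfold rvk; rw [h]

theorem Mn.n1' (hm : Mn G k) {a : V} (ha : k a = (s, 3)) :
    ∃ b c, k b = (s, 2) ∧ k c = (s, 1) ∧ G.Adj a b ∧ G.Adj b c := by
  obtain ⟨b, c, hb, hc, h1, h2⟩ := (rvk_Mn hm).n1 (rvk_at' ha)
  exact ⟨b, c, rvk_at hm.st (by norm_num) hb, rvk_at hm.st (by norm_num) hc, h1, h2⟩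

/-- star centres have at least two upper neighbours -/
theorem Mn.cup (hm : Mn G k) {c : V} (hc : k c = (s, 7)) :
    2 ≤ (Finset.univ.filter fun b => UU G k c b).card := by
  by_contra hlt
  have hk := hm.st
  have hL := star_roles hk (s := s) (a := c) (by rw [hc]) (by rw [hc]; simp)
  obtain ⟨v, hv⟩ := hk.full c (by rw [hc]; simp) 6 (by norm_num) (by norm_num)
  rw [hc] at hv
  simp only at hv
  refine hm.weak hv (tb := [(4, 8), (7, 9), (5, 10), (6, 17)]) (L := [4, 5, 6, 7]) (by decide) hL
    (by decide) [7, 6] (by decide) (by simp; exact ⟨⟨c, hc⟩, ⟨v, hv⟩⟩) ?_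
  have tr := weak_tr (X := [(7, 6)]) (L := [4, 5, 6, 7]) (tb := [(4, 8), (7, 9), (5, 10), (6, 17)])
    hk hv (adjp := []) (prs := []) (by decide) (by decide) hL (by decide)
  apply df_weak {c} ∅ _ (by simp)
  · intro x y hxy hx _
    rcases tr x y hxy with h | ⟨hA, p, hp, h1, h2⟩
    · exact h
    · simp at hp; subst hp
      have : x = c := hk.inj (h1.trans hc.symm)
      exact absurd this (by simpa using hx)
  · intro a ha
    simp only [Finset.mem_singleton] at ha
    subst ha
    have : (Finset.univ.filter fun b => UU G (mv k s (k v).1 [(4, 8), (7, 9), (5, 10), (6, 17)] id) a b) ⊆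
        insert v (Finset.univ.filter fun b => UU G k a b) := by
      intro b hb
      rw [Finset.mem_filter] at hb
      rw [Finset.mem_insert, Finset.mem_filter]
      rcases tr a b hb.2 with h | ⟨hA, p, hp, h1, h2⟩
      · exact Or.inr ⟨Finset.mem_univ _, h⟩
      · simp at hp; subst hp
        exact Or.inl (hk.inj (h2.trans hv.symm))
    have h1 := Finset.card_le_card this
    have h2 := Finset.card_insert_le v (Finset.univ.filter fun b => UU G k a b)
    omega

theorem Mn.cdn (hm : Mn G k) {c : V} (hc : k c = (s, 7)) :
    2 ≤ (Finset.univ.filter fun a => UU G k a c).card := by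
  have := (rvk_Mn hm).cup (rvk_at' hc)
  rw [rvk_UU hm.st] at this
  exact this

/-- the three leaves are not related to the centre -/
theorem St.cdeg (hk : St G k) {c : V} (hc : k c = (s, 7)) (hdeg : vdeg G c ≤ 7) :
    (Finset.univ.filter fun b => UU G k c b).card + (Finset.univ.filter fun a => UU G k a c).card ≤ 4 := by
  have hf := hk.full c (by rw [hc]; simp)
  rw [hc] at hf
  obtain ⟨l1, h1⟩ := hf 4 (by norm_num) (by norm_num)
  obtain ⟨l2, h2⟩ := hf 5 (by norm_num) (by norm_num)
  obtain ⟨l3, h3⟩ := hf 6 (by norm_num) (by norm_num)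
  simp only at h1 h2 h3
  have n12 : l1 ≠ l2 := by rintro rfl; rw [h1] at h2; simp at h2
  have n13 : l1 ≠ l3 := by rintro rfl; rw [h1] at h3; simp at h3
  have n23 : l2 ≠ l3 := by rintro rfl; rw [h2] at h3; simp at h3
  have hadj : ∀ l r, k l = (s, r) → 4 ≤ r → r < 7 → G.Adj c l := by
    intro l r hl hr hr'
    refine hk.adj c l (by rw [hc, hl]) (by rw [hc]) (by rw [hl]; exact hr) ?_
    rintro rfl
    rw [hc] at hl
    simp at hl
    omega
  have hnu : ∀ r, 4 ≤ r → r < 7 → up r 7 = false ∧ up 7 r = false := by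
    intro r h1 h2
    interval_cases r <;> decide
  have hnU : ∀ l r, k l = (s, r) → 4 ≤ r → r < 7 → ¬ UU G k c l ∧ ¬ UU G k l c := by
    intro l r hl hr hr'
    have := hnu r hr hr'
    unfold UU
    rw [hl, hc]
    simp [this.1, this.2]
  have key := card_nb hdeg (((Finset.univ.filter fun b => UU G k c b) ∪ (Finset.univ.filter fun a => UU G k a c)) ∪
    {l1, l2, l3}) (by
      intro b hb
      simp only [Finset.mem_union, Finset.mem_filter, Finset.mem_insert, Finset.mem_singleton] at hb
      rcases hb with (hb | hb) | rfl | rfl | rfl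
      · exact hb.2.1
      · exact hb.2.1.symm
      · exact hadj _ _ h1 (by norm_num) (by norm_num)
      · exact hadj _ _ h2 (by norm_num) (by norm_num)
      · exact hadj _ _ h3 (by norm_num) (by norm_num))
  rw [Finset.card_union_of_disjoint, Finset.card_union_of_disjoint] at key
  · have : ({l1, l2, l3} : Finset V).card = 3 := by
      rw [Finset.card_insert_of_notMem, Finset.card_insert_of_notMem, Finset.card_singleton] <;>
        simp [n12, n13, n23]
    omega
  · rw [Finset.disjoint_left]
    intro a ha hb
    rw [Finset.mem_filter] at ha hb
    exact ha.2.ne hb.2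
  · rw [Finset.disjoint_left]
    intro a ha hb
    simp only [Finset.mem_union, Finset.mem_filter, Finset.mem_insert, Finset.mem_singleton,
      Finset.mem_univ, true_and] at ha hb
    have : ¬ UU G k c a ∧ ¬ UU G k a c := by
      rcases hb with rfl | rfl | rfl
      · exact hnU _ _ h1 (by norm_num) (by norm_num)
      · exact hnU _ _ h2 (by norm_num) (by norm_num)
      · exact hnU _ _ h3 (by norm_num) (by norm_num)
    rcases ha with ha | ha
    · exact this.1 ha
    · exact this.2 ha

def ownTab (vr r : ℕ) : ℕ := if r = 7 then 9 else if r = 4 ∨ (r = 5 ∧ vr = 4) then 8 else 10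

theorem own_ex (hk : St G k) (v : V) (hv : (k v).2 ≠ 7) : ∃ g, Own k v g := by
  by_cases h4 : 4 ≤ (k v).2
  · have hlt := hk.lt v
    have role : ∀ a, a ≠ v → (k a).1 = (k v).1 → (k a).2 ∈ [4, 5, 6, 7] ∧ (k a).2 ≠ (k v).2 := by
      intro a ha h
      refine ⟨star_roles hk rfl h4 a h, fun h' => ha (hk.inj (Prod.ext h h'))⟩
    have hvr : (k v).2 ∈ [4, 5, 6] := by simp; omega
    have t1 : ∀ vr ∈ [4, 5, 6], ∀ r ∈ [4, 5, 6, 7], r ≠ vr → 8 ≤ ownTab vr r ∧ ownTab vr r < 12 ∧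
        ∀ r' ∈ [4, 5, 6, 7], r' ≠ vr → (ownTab vr r = ownTab vr r' → r = r') ∧
        (up (ownTab vr r) (ownTab vr r') = true → up r r' = true) := by
      unfold ownTab; decide
    have t2 : ∀ r ∈ [4, 5, 6, 7], wtb r = true := by decide
    refine ⟨ownTab (k v).2, ?_, ?_, ?_, ?_⟩
    · intro a ha h
      obtain ⟨m, n⟩ := role a ha h
      have := t1 _ hvr _ m n
      exact ⟨this.1, this.2.1⟩
    · intro a b ha hb h h' he
      obtain ⟨m, n⟩ := role a ha h
      obtain ⟨m', n'⟩ := role b hb h'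
      exact hk.inj (Prod.ext (h.trans h'.symm) (((t1 _ hvr _ m n).2.2 _ m' n').1 he))
    · intro a b ha hb h h' he
      obtain ⟨m, n⟩ := role a ha h
      obtain ⟨m', n'⟩ := role b hb h'
      exact ((t1 _ hvr _ m n).2.2 _ m' n').2 he
    · intro a ha h _
      exact t2 _ (role a ha h).1
  · have role := path_roles hk (s := (k v).1) (a := v) rfl (by omega)
    refine ⟨fun r => 8 + r, ?_, ?_, ?_, ?_⟩
    · intro a _ h
      have := role a h
      simp at this
      omega
    · intro a b _ _ h h' he
      exact hk.inj (Prod.ext (h.trans h'.symm) (by simpa using he))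
    · intro a b _ _ h h' he
      exact up8 (hk.lt a) (hk.lt b) he
    · intro a _ h hw
      have := hk.lt a
      rw [Nat.add_mod_left, Nat.mod_eq_of_lt this] at hw
      exact hw

def ckA (L um : List ℕ) (vr r0 : ℕ) (tb adjp : List (ℕ × ℕ)) (prs : List ℕ) (Xc Y : List (ℕ × ℕ))
    (El : List ℕ) : Bool :=
  (L.all fun r => tb.any fun e => e.1 == r) && (tb.any fun e => e.1 == vr) && ck1 tb adjp prs &&
  ck2 tb vr um (Xc ++ Y) r0 && (Xc.isEmpty || (Xc.length == 1 && ck3 tb vr El))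

theorem Ctx.fin (c : Ctx G k v P Q) {vr : ℕ} {loc : V → ℤ × ℕ} (D : MvData k v s vr loc g)
    (L um : List ℕ) (r0 : ℕ) (tb adjp : List (ℕ × ℕ)) (prs : List ℕ) (Xc Y : List (ℕ × ℕ)) (El : List ℕ)
    (hck : ckA L um vr r0 tb adjp prs Xc Y El = true)
    (hL : ∀ a, (k a).1 = s → (k a).2 ∈ L)
    (hum : ∀ u ∈ Q, UU G k v u → s ≤ (k u).1 ∧ ((k u).1 = s → (k u).2 ∈ um))
    (h0 : ∃ u0 ∈ Q, UU G k v u0 ∧ k u0 = (s, r0) ∧ (Y = [] ∨ Y = [(7, 6)] ∧ Xc = [] ∧ r0 = 7 ∧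
      (Finset.univ.filter fun b => UU G k u0 b).card ≤ 1))
    (hprs : ∀ r ∈ prs, ∃ a, loc a = (s, r))
    (hadj : ∀ p ∈ adjp, ∃ a b, loc a = (s, p.1) ∧ loc b = (s, p.2) ∧ G.Adj a b)
    (hE : ∀ r ∈ El, ∃ a, k a = (s, r)) : False := by
  have hk := c.mn.st
  simp only [ckA, Bool.and_eq_true, Bool.or_eq_true, List.any_eq_true, beq_iff_eq, List.isEmpty_iff] at hck
  obtain ⟨⟨⟨⟨q1, q2⟩, q3⟩, q4⟩, q5⟩ := hck
  have hkey : ∀ a, (loc a).1 = s → ∃ e ∈ tb, e.1 = (loc a).2 := by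
    intro a ha
    by_cases hav : a = v
    · rw [hav, D.loc_v]; exact q2
    · rw [D.loc_ne a hav] at ha ⊢
      exact keyOf q1 _ (hL a ha)
  obtain ⟨u0, hu0, hvu0, hku0, hY⟩ := h0
  have C := CK1.of q3
  have hd := c.drop D C hkey um Xc Y r0 q4 hum u0 hu0 hvu0 hku0 hY
  have hst := D.mv_St hk C hkey hprs (by
    intro r r' hrr a b ha hb
    obtain ⟨a', b', h1, h2, h3⟩ := hadj _ hrr
    rw [D.loc_inj hk (ha.trans h1.symm), D.loc_inj hk (hb.trans h2.symm)]
    exact h3)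
  rcases q5 with q5 | ⟨q5, q6⟩
  · rw [q5] at hd
    simp only [List.length_nil] at hd
    exact c.mn.absurd_df hst (by omega)
  · refine c.mn.absurd_Psi hst (by omega) ?_
    exact D.Psi_drop hk C hkey El q6 hE

def inU (G : SimpleGraph V) (k : V → ℤ × ℕ) (v : V) (Q : Finset V) (s : ℤ) (r : ℕ) : Prop :=
  ∃ u ∈ Q, UU G k v u ∧ k u = (s, r)

theorem Ctx.goI (c : Ctx G k v P Q) (hs : (k v).1 < s) (O : Own k v g)
    (hmin : ∀ u ∈ Q, UU G k v u → s ≤ (k u).1) (L : List ℕ) (hL : ∀ a, (k a).1 = s → (k a).2 ∈ L)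
    (N : List ℕ) (hN : ∀ r ∈ N, ¬ inU G k v Q s r) (r0 : ℕ) (tb adjp : List (ℕ × ℕ)) (prs : List ℕ)
    (Xc Y : List (ℕ × ℕ)) (El : List ℕ)
    (hck : ckA L (L.filter fun r => !N.elem r) 8 r0 tb adjp prs Xc Y El = true)
    (h0 : inU G k v Q s r0)
    (hY : Y = [] ∨ Y = [(7, 6)] ∧ Xc = [] ∧ r0 = 7 ∧
      ∀ u ∈ Q, k u = (s, 7) → (Finset.univ.filter fun b => UU G k u b).card ≤ 1)
    (hprs : ∀ r ∈ prs, r = 8 ∨ ∃ a, k a = (s, r))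
    (hadj : ∀ p ∈ adjp, ∃ a b, k a = (s, p.1) ∧ (b = v ∧ p.2 = 8 ∨ k b = (s, p.2)) ∧ G.Adj a b)
    (hE : ∀ r ∈ El, ∃ a, k a = (s, r)) : False := by
  have D : MvData k v s 8 (Function.update k v (s, 8)) g :=
    ⟨fun a ha => Function.update_of_ne ha _ _, Function.update_self _ _ _, Or.inr ⟨hs, rfl, O⟩⟩
  have hl : ∀ a r, k a = (s, r) → Function.update k v (s, 8) a = (s, r) := by
    intro a r h
    rw [← h]
    apply Function.update_of_ne
    rintro rfl
    rw [h] at hs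
    simp at hs
  obtain ⟨u0, hu0, hvu0, hku0⟩ := h0
  refine c.fin D L _ r0 tb adjp prs Xc Y El hck hL ?_ ⟨u0, hu0, hvu0, hku0, ?_⟩ ?_ ?_ hE
  · intro u hu hvu
    refine ⟨hmin u hu hvu, fun h => ?_⟩
    rw [List.mem_filter]
    refine ⟨hL u h, ?_⟩
    simp only [List.elem_eq_mem, Bool.not_eq_true', decide_eq_false_iff_not]
    intro hn
    exact hN _ hn ⟨u, hu, hvu, Prod.ext h rfl⟩
  · rcases hY with h | ⟨h1, h2, h3, h4⟩
    · exact Or.inl h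
    · exact Or.inr ⟨h1, h2, h3, h4 u0 hu0 (by rw [hku0, h3])⟩
  · intro r hr
    rcases hprs r hr with rfl | ⟨a, ha⟩
    · exact ⟨v, D.loc_v⟩
    · exact ⟨a, hl a r ha⟩
  · intro p hp
    obtain ⟨a, b, h1, h2, h3⟩ := hadj p hp
    refine ⟨a, b, hl _ _ h1, ?_, h3⟩
    rcases h2 with ⟨rfl, h2⟩ | h2
    · rw [h2]; exact D.loc_v
    · exact hl _ _ h2

theorem Ctx.goII (c : Ctx G k v P Q) {vr : ℕ} (hv : k v = (s, vr)) (L : List ℕ)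
    (hL : ∀ a, (k a).1 = s → (k a).2 ∈ L)
    (N : List ℕ) (hN : ∀ r ∈ N, ¬ inU G k v Q s r) (r0 : ℕ) (tb adjp : List (ℕ × ℕ)) (prs : List ℕ)
    (Xc : List (ℕ × ℕ)) (El : List ℕ)
    (hck : ckA L (L.filter fun r => up vr r && !N.elem r) vr r0 tb adjp prs Xc [] El = true)
    (h0 : inU G k v Q s r0)
    (hprs : ∀ r ∈ prs, ∃ a, k a = (s, r))
    (hadj : ∀ p ∈ adjp, ∃ a b, k a = (s, p.1) ∧ k b = (s, p.2) ∧ G.Adj a b)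
    (hE : ∀ r ∈ El, ∃ a, k a = (s, r)) : False := by
  obtain ⟨u0, hu0, hvu0, hku0⟩ := h0
  refine c.fin (mvTriv hv) L _ r0 tb adjp prs Xc [] El hck hL ?_ ⟨u0, hu0, hvu0, hku0, Or.inl rfl⟩ hprs hadj hE
  intro u hu hvu
  have h1 := hvu.2
  rw [hv] at h1
  simp only at h1
  refine ⟨by omega, fun h => ?_⟩
  rw [List.mem_filter]
  refine ⟨hL u h, ?_⟩
  simp only [List.elem_eq_mem, Bool.and_eq_true, Bool.not_eq_true', decide_eq_false_iff_not]
  refine ⟨by rcases h1 with h1 | h1; omega; exact h1.2, ?_⟩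
  intro hn
  exact hN _ hn ⟨u, hu, hvu, Prod.ext h rfl⟩

end Layout

set_option linter.unusedSectionVars false
section Layout
variable {V : Type} [Fintype V] {G : SimpleGraph V}
variable {k : V → ℤ × ℕ} {v : V} {s : ℤ} {P Q : Finset V}

theorem Ctx.vne7 (c : Ctx G k v P Q) : (k v).2 ≠ 7 := by
  intro h
  have h1 := c.mn.st.cdeg (s := (k v).1) (c := v) (Prod.ext rfl h) (c.deg v)
  have h2 : (Q.filter fun b => UU G k v b).card ≤ (Finset.univ.filter fun b => UU G k v b).card :=
    Finset.card_le_card (Finset.filter_subset_filter _ (Finset.subset_univ _))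
  have := c.five
  omega

theorem Ctx.caseI (c : Ctx G k v P Q) (hs : (k v).1 < s) (hmin : ∀ u ∈ Q, UU G k v u → s ≤ (k u).1)
    (h0 : ∃ r, inU G k v Q s r) : False := by
  have hk := c.mn.st
  obtain ⟨g, O⟩ := own_ex hk v c.vne7
  obtain ⟨r0, u0, hu0, hvu0, hku0⟩ := h0
  have e1 : (k u0).1 = s := by rw [hku0]
  have inr : ∀ L : List ℕ, (∀ a, (k a).1 = s → (k a).2 ∈ L) → r0 ∈ L := by
    intro L hL; have := hL u0 e1; rw [hku0] at this; exact this
  have hin : inU G k v Q s r0 := ⟨u0, hu0, hvu0, hku0⟩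
  have nN : ∀ r ∈ ([] : List ℕ), ¬ inU G k v Q s r := by simp
  by_cases h4 : 4 ≤ r0
  · -- star target
    have hL := star_roles hk (s := s) (a := u0) e1 (by rw [hku0]; exact h4)
    have hp : ∀ r, 4 ≤ r → r < 8 → ∃ a, k a = (s, r) := by
      intro r h1 h2
      have := hk.full u0 (by rw [hku0]; exact h4) r h1 h2
      rwa [e1] at this
    obtain ⟨l1, hl1⟩ := hp 4 (by norm_num) (by norm_num)
    obtain ⟨l2, hl2⟩ := hp 5 (by norm_num) (by norm_num)
    obtain ⟨l3, hl3⟩ := hp 6 (by norm_num) (by norm_num)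
    obtain ⟨z, hz⟩ := hp 7 (by norm_num) (by norm_num)
    have ha1 : G.Adj z l1 := hk.adj z l1 (by rw [hz, hl1]) (by rw [hz]) (by rw [hl1])
      (by rintro rfl; rw [hz] at hl1; simp at hl1)
    have ha2 : G.Adj z l2 := hk.adj z l2 (by rw [hz, hl2]) (by rw [hz]) (by rw [hl2]; simp)
      (by rintro rfl; rw [hz] at hl2; simp at hl2)
    by_cases i7 : inU G k v Q s 7
    · refine c.goI hs O hmin [4, 5, 6, 7] hL [] nN 7 [(8, 12), (4, 13), (5, 14), (7, 15), (6, 17)]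
        [(7, 8), (7, 4), (7, 5)] [8, 4, 5, 7] [] [(7, 6)] [] (by decide) i7 (Or.inr ⟨rfl, rfl, rfl, ?_⟩) ?_ ?_ (by simp)
      · intro u hu hku
        have h1 := hk.cdeg hku (c.deg u)
        have h2 := c.crit.dn u hu
        have h3 : (P.filter fun a => UU G k a u).card ≤ (Finset.univ.filter fun a => UU G k a u).card :=
          Finset.card_le_card (Finset.filter_subset_filter _ (Finset.subset_univ _))
        omega
      · simp; exact ⟨⟨l1, hl1⟩, ⟨l2, hl2⟩, ⟨z, hz⟩⟩
      · obtain ⟨u, hu, hvu, hku⟩ := i7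
        simp only [List.forall_mem_cons]
        refine ⟨⟨u, v, hku, Or.inl ⟨rfl, trivial⟩, hvu.1.symm⟩, ⟨z, l1, hz, Or.inr hl1, ha1⟩,
          ⟨z, l2, hz, Or.inr hl2, ha2⟩, by simp⟩
    by_cases i4 : inU G k v Q s 4
    · exact c.goI hs O hmin [4, 5, 6, 7] hL [7] (by simpa using i7) 4
        [(8, 17), (4, 18), (5, 24), (7, 25), (6, 26)] [] [] [(4, 7)] [] [4] (by decide) i4 (Or.inl rfl)
        (by simp) (by simp) (by simp; exact ⟨l1, hl1⟩)
    by_cases i5 : inU G k v Q s 5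
    · exact c.goI hs O hmin [4, 5, 6, 7] hL [7, 4] (by simp [i7, i4]) 5
        [(4, 17), (8, 24), (5, 25), (7, 26), (6, 27)] [] [] [(4, 7)] [] [4, 5] (by decide) i5 (Or.inl rfl)
        (by simp) (by simp) (by simp; exact ⟨⟨l1, hl1⟩, ⟨l2, hl2⟩⟩)
    by_cases i6 : inU G k v Q s 6
    · exact c.goI hs O hmin [4, 5, 6, 7] hL [7, 4, 5] (by simp [i7, i4, i5]) 6
        [(4, 16), (7, 17), (5, 18), (8, 25), (6, 26)] [] [] [(7, 6)] [] [7, 6] (by decide) i6 (Or.inl rfl)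
        (by simp) (by simp) (by simp; exact ⟨⟨z, hz⟩, ⟨l3, hl3⟩⟩)
    have := inr _ hL
    simp only [List.mem_cons, List.not_mem_nil, or_false] at this
    rcases this with rfl | rfl | rfl | rfl <;> contradiction
  · -- path target
    have hL := path_roles hk (s := s) (a := u0) e1 (by rw [hku0]; simpa using h4)
    by_cases p0 : ∃ a, k a = (s, 0) <;> by_cases p3 : ∃ a, k a = (s, 3)
    · by_cases i0 : inU G k v Q s 0
      · exact c.goI hs O hmin [0, 1, 2, 3] hL [] nN 0
          [(8, 0), (0, 1), (1, 2), (2, 9), (3, 10)] [] [] [(1, 2)] [] [0, 3] (by decide) i0 (Or.inl rfl)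
          (by simp) (by simp) (by simp; exact ⟨p0, p3⟩)
      by_cases i1 : inU G k v Q s 1
      · exact c.goI hs O hmin [0, 1, 2, 3] hL [0] (by simp [i0]) 1
          [(0, 1), (1, 2), (8, 3), (2, 9), (3, 10)] [] [] [(1, 2)] [] [0, 3] (by decide) i1 (Or.inl rfl)
          (by simp) (by simp) (by simp; exact ⟨p0, p3⟩)
      by_cases i2 : inU G k v Q s 2
      · exact c.goI hs O hmin [0, 1, 2, 3] hL [0, 1] (by simp [i0, i1]) 2
          [(0, 1), (1, 2), (8, 8), (2, 9), (3, 10)] [] [] [(1, 2)] [] [0, 3] (by decide) i2 (Or.inl rfl)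
          (by simp) (by simp) (by simp; exact ⟨p0, p3⟩)
      by_cases i3 : inU G k v Q s 3
      · exact c.goI hs O hmin [0, 1, 2, 3] hL [0, 1, 2] (by simp [i0, i1, i2]) 3
          [(0, 1), (1, 2), (2, 9), (3, 10), (8, 11)] [] [] [(1, 2)] [] [0, 3] (by decide) i3 (Or.inl rfl)
          (by simp) (by simp) (by simp; exact ⟨p0, p3⟩)
      have := inr _ hL
      simp only [List.mem_cons, List.not_mem_nil, or_false] at this
      rcases this with rfl | rfl | rfl | rfl <;> contradiction
    · have hL' : ∀ a, (k a).1 = s → (k a).2 ∈ [0, 1, 2] := by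
        intro a ha
        have h1 := hL a ha
        have h2 : (k a).2 ≠ 3 := fun h => p3 ⟨a, Prod.ext ha h⟩
        simp at h1 ⊢
        omega
      obtain ⟨x, hx⟩ := p0
      obtain ⟨m, y, hm, hy, hxm, hmy⟩ := c.mn.n1 hx
      by_cases i0 : inU G k v Q s 0
      · exact c.goI hs O hmin [0, 1, 2] hL' [] nN 0
          [(8, 1), (0, 2), (1, 9), (2, 10)] [] [] [(0, 1)] [] [0] (by decide) i0 (Or.inl rfl)
          (by simp) (by simp) (by simp; exact ⟨x, hx⟩)
      by_cases i1 : inU G k v Q s 1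
      · refine c.goI hs O hmin [0, 1, 2] hL' [0] (by simp [i0]) 1
          [(0, 4), (8, 5), (2, 6), (1, 7)] [(1, 8), (1, 0), (1, 2)] [8, 0, 1, 2] [] [] [] (by decide) i1 (Or.inl rfl)
          (by simp; exact ⟨⟨x, hx⟩, ⟨m, hm⟩, ⟨y, hy⟩⟩) ?_ (by simp)
        obtain ⟨u, hu, hvu, hku⟩ := i1
        simp only [List.forall_mem_cons]
        refine ⟨⟨u, v, hku, Or.inl ⟨rfl, trivial⟩, hvu.1.symm⟩, ⟨m, x, hm, Or.inr hx, hxm.symm⟩,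
          ⟨m, y, hm, Or.inr hy, hmy⟩, by simp⟩
      by_cases i2 : inU G k v Q s 2
      · exact c.goI hs O hmin [0, 1, 2] hL' [0, 1] (by simp [i0, i1]) 2
          [(0, 1), (1, 2), (8, 9), (2, 10)] [] [] [(1, 2)] [] [0] (by decide) i2 (Or.inl rfl)
          (by simp) (by simp) (by simp; exact ⟨x, hx⟩)
      have := inr _ hL'
      simp only [List.mem_cons, List.not_mem_nil, or_false] at this
      rcases this with rfl | rfl | rfl <;> contradiction
    · have hL' : ∀ a, (k a).1 = s → (k a).2 ∈ [1, 2, 3] := by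
        intro a ha
        have h1 := hL a ha
        have h2 : (k a).2 ≠ 0 := fun h => p0 ⟨a, Prod.ext ha h⟩
        simp at h1 ⊢
        omega
      obtain ⟨y, hy⟩ := p3
      obtain ⟨m, x, hm, hx, hym, hmx⟩ := c.mn.n1' hy
      by_cases i1 : inU G k v Q s 1
      · exact c.goI hs O hmin [1, 2, 3] hL' [] nN 1
          [(8, 1), (1, 2), (2, 9), (3, 10)] [] [] [(1, 2)] [] [3] (by decide) i1 (Or.inl rfl)
          (by simp) (by simp) (by simp; exact ⟨y, hy⟩)
      by_cases i2 : inU G k v Q s 2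
      · refine c.goI hs O hmin [1, 2, 3] hL' [1] (by simp [i1]) 2
          [(1, 4), (8, 5), (3, 6), (2, 7)] [(2, 8), (2, 1), (2, 3)] [8, 1, 2, 3] [] [] [] (by decide) i2 (Or.inl rfl)
          (by simp; exact ⟨⟨x, hx⟩, ⟨m, hm⟩, ⟨y, hy⟩⟩) ?_ (by simp)
        obtain ⟨u, hu, hvu, hku⟩ := i2
        simp only [List.forall_mem_cons]
        refine ⟨⟨u, v, hku, Or.inl ⟨rfl, trivial⟩, hvu.1.symm⟩, ⟨m, x, hm, Or.inr hx, hmx⟩,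
          ⟨m, y, hm, Or.inr hy, hym.symm⟩, by simp⟩
      by_cases i3 : inU G k v Q s 3
      · exact c.goI hs O hmin [1, 2, 3] hL' [1, 2] (by simp [i1, i2]) 3
          [(1, 1), (2, 2), (8, 9), (3, 10)] [] [] [(2, 3)] [] [3] (by decide) i3 (Or.inl rfl)
          (by simp) (by simp) (by simp; exact ⟨y, hy⟩)
      have := inr _ hL'
      simp only [List.mem_cons, List.not_mem_nil, or_false] at this
      rcases this with rfl | rfl | rfl <;> contradiction
    · have hL' : ∀ a, (k a).1 = s → (k a).2 ∈ [1, 2] := by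
        intro a ha
        have h1 := hL a ha
        have h2 : (k a).2 ≠ 0 := fun h => p0 ⟨a, Prod.ext ha h⟩
        have h3 : (k a).2 ≠ 3 := fun h => p3 ⟨a, Prod.ext ha h⟩
        simp at h1 ⊢
        omega
      by_cases i1 : inU G k v Q s 1
      · exact c.goI hs O hmin [1, 2] hL' [] nN 1
          [(8, 8), (1, 9), (2, 10)] [] [] [] [] [] (by decide) i1 (Or.inl rfl)
          (by simp) (by simp) (by simp)
      by_cases i2 : inU G k v Q s 2
      · exact c.goI hs O hmin [1, 2] hL' [1] (by simp [i1]) 2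
          [(1, 9), (2, 10), (8, 11)] [] [] [] [] [] (by decide) i2 (Or.inl rfl)
          (by simp) (by simp) (by simp)
      have := inr _ hL'
      simp only [List.mem_cons, List.not_mem_nil, or_false] at this
      rcases this with rfl | rfl <;> contradiction

theorem Ctx.caseII (c : Ctx G k v P Q) (h0 : ∃ r, inU G k v Q (k v).1 r) : False := by
  have hk := c.mn.st
  obtain ⟨r0, hin⟩ := h0
  have hin0 := hin
  obtain ⟨u0, hu0, hvu0, hku0⟩ := hin0
  have e1 : (k u0).1 = (k v).1 := by rw [hku0]
  have hup : up (k v).2 r0 = true := by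
    rcases hvu0.2 with h | h
    · rw [hku0] at h; simp at h
    · rw [hku0] at h; exact h.2
  have nN : ∀ r ∈ ([] : List ℕ), ¬ inU G k v Q (k v).1 r := by simp
  have hvlt := hk.lt v
  generalize hvr : (k v).2 = vr at *
  generalize hs : (k v).1 = s at *
  have hv : k v = (s, vr) := Prod.ext hs hvr
  have t0 : ∀ vr < 4, ∀ r ∈ [0, 1, 2, 3], up vr r = true → vr = 0 ∧ (r = 2 ∨ r = 3) ∨ vr = 1 ∧ r = 3 := by
    decide
  have t1 : ∀ vr ∈ [4, 5, 6, 7], ∀ r ∈ [4, 5, 6, 7], up vr r = true →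
      vr = 4 ∧ (r = 5 ∨ r = 6) ∨ vr = 5 ∧ r = 6 := by
    decide
  by_cases h4 : 4 ≤ vr
  · have hL := star_roles hk (s := s) (a := v) hs (by rw [hvr]; exact h4)
    have hp : ∀ r, 4 ≤ r → r < 8 → ∃ a, k a = (s, r) := by
      intro r h1 h2
      have := hk.full v (by rw [hvr]; exact h4) r h1 h2
      rwa [hs] at this
    have m1 := hL v hs
    have m2 := hL u0 e1
    rw [hvr] at m1
    rw [hku0] at m2
    rcases t1 vr m1 r0 m2 hup with ⟨rfl, h⟩ | ⟨rfl, rfl⟩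
    · by_cases i5 : inU G k v Q s 5
      · exact c.goII hv [4, 5, 6, 7] hL [] nN 5 [(4, 16), (5, 17), (7, 18), (6, 19)] [] [] [(4, 7)] [5, 7]
          (by decide) i5 (by simp) (by simp)
          (by simp; exact ⟨hp 5 (by norm_num) (by norm_num), hp 7 (by norm_num) (by norm_num)⟩)
      · rcases h with rfl | rfl
        · exact i5 hin
        · exact c.goII hv [4, 5, 6, 7] hL [5] (by simp [i5]) 6 [(5, 17), (7, 18), (4, 25), (6, 26)] [] []
            [(7, 6)] [5, 7] (by decide) hin (by simp) (by simp)
            (by simp; exact ⟨hp 5 (by norm_num) (by norm_num), hp 7 (by norm_num) (by norm_num)⟩)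
    · exact c.goII hv [4, 5, 6, 7] hL [] nN 6 [(4, 17), (7, 18), (5, 25), (6, 26)] [] []
        [(7, 6)] [4, 7] (by decide) hin (by simp) (by simp)
        (by simp; exact ⟨hp 4 (by norm_num) (by norm_num), hp 7 (by norm_num) (by norm_num)⟩)
  · have hL := path_roles hk (s := s) (a := v) hs (by rw [hvr]; omega)
    have m2 := hL u0 e1
    rw [hku0] at m2
    rcases t0 vr (by omega) r0 m2 hup with ⟨rfl, h⟩ | ⟨rfl, rfl⟩
    · obtain ⟨x, m, hx, hm, hvx, hxm⟩ := c.mn.n1 hv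
      by_cases p3 : ∃ a, k a = (s, 3)
      · obtain ⟨y, hy⟩ := p3
        obtain ⟨m', x', hm', hx', hym, hmx⟩ := c.mn.n1' hy
        have : m' = m := hk.inj (hm'.trans hm.symm)
        subst this
        by_cases i2 : inU G k v Q s 2
        · refine c.goII hv [0, 1, 2, 3] hL [] nN 2 [(1, 4), (0, 5), (3, 6), (2, 7)] [(2, 1), (2, 0), (2, 3)]
            [0, 1, 2, 3] [] [] (by decide) i2 (by simp; exact ⟨⟨v, hv⟩, ⟨x, hx⟩, ⟨m', hm⟩, ⟨y, hy⟩⟩) ?_ (by simp)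
          obtain ⟨u, hu, hvu, hku⟩ := i2
          simp only [List.forall_mem_cons]
          exact ⟨⟨m', x, hm, hx, hxm.symm⟩, ⟨u, v, hku, hv, hvu.1.symm⟩, ⟨m', y, hm, hy, hym.symm⟩, by simp⟩
        · rcases h with rfl | rfl
          · exact i2 hin
          · exact c.goII hv [0, 1, 2, 3] hL [2] (by simp [i2]) 3 [(1, 1), (2, 2), (0, 9), (3, 10)] [] []
              [(2, 3)] [0, 3] (by decide) hin (by simp) (by simp) (by simp; exact ⟨⟨v, hv⟩, ⟨y, hy⟩⟩)
      · have hL' : ∀ a, (k a).1 = s → (k a).2 ∈ [0, 1, 2] := by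
          intro a ha
          have h1 := hL a ha
          have h2 : (k a).2 ≠ 3 := fun h => p3 ⟨a, Prod.ext ha h⟩
          simp at h1 ⊢
          omega
        rcases h with rfl | rfl
        · exact c.goII hv [0, 1, 2] hL' [] nN 2 [(1, 9), (2, 10), (0, 11)] [] []
            [] [] (by decide) hin (by simp) (by simp) (by simp)
        · exact p3 ⟨u0, hku0⟩
    · exact c.goII hv [0, 1, 2, 3] hL [] nN 3 [(0, 1), (2, 9), (3, 10), (1, 11)] [] []
        [] [] (by decide) hin (by simp) (by simp) (by simp)

theorem Ctx.false (c : Ctx G k v P Q) : False := by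
  have hne : (Q.filter fun b => UU G k v b).Nonempty := by
    rw [← Finset.card_pos]; have := c.five; omega
  obtain ⟨u0, hu0, hmin⟩ := Finset.exists_min_image _ (fun u => (k u).1) hne
  rw [Finset.mem_filter] at hu0
  have hle : (k v).1 ≤ (k u0).1 := by
    have := hu0.2.2
    omega
  have hin : inU G k v Q (k u0).1 (k u0).2 := ⟨u0, hu0.1, hu0.2, rfl⟩
  rcases hle.lt_or_eq with h | h
  · exact c.caseI h (fun u hu hvu => hmin u (Finset.mem_filter.2 ⟨hu, hvu⟩)) ⟨_, hin⟩
  · rw [← h] at hin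
    exact c.caseII ⟨_, hin⟩

theorem UU_deg (hdeg : ∀ a, vdeg G a ≤ 7) (v : V) : (Finset.univ.filter fun b => UU G k v b).card +
      (Finset.univ.filter fun a => UU G k a v).card ≤ 7 := by
  rw [← Finset.card_union_of_disjoint]
  · apply card_nb (hdeg v)
    intro b hb
    rw [Finset.mem_union, Finset.mem_filter, Finset.mem_filter] at hb
    rcases hb with hb | hb
    · exact hb.2.1
    · exact hb.2.1.symm
  · rw [Finset.disjoint_left]
    intro a ha hb
    rw [Finset.mem_filter] at ha hb
    exact ha.2.ne hb.2

theorem Mn.df_zero (hm : Mn G k) (hdeg : ∀ a, vdeg G a ≤ 7) : df (UU G k) = 0 := by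
  by_contra h
  have hpos : 0 < df (UU G k) := Nat.pos_of_ne_zero h
  obtain ⟨P, Q, hC, ⟨v, hv, -, h5⟩ | ⟨v, hv, -, h5⟩⟩ := exists_crit (UU G k) hpos (UU_deg hdeg)
  · exact (Ctx.mk hm hdeg hC hv h5 hpos : Ctx G k v P Q).false
  · refine (Ctx.mk (rvk_Mn hm) hdeg ?_ hv ?_ ?_ : Ctx G (rvk k) v Q P).false
    · rw [rvk_UU hm.st]
      refine ⟨hC.dn, hC.up, ?_⟩
      intro P' Q' h1
      rw [df_flip, ← ee_comm] at h1
      have := hC.sub Q' P' (by rw [h1]; ring)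
      exact ⟨this.2, this.1⟩
    · rw [rvk_UU hm.st]
      exact h5
    · rw [rvk_UU hm.st, df_flip]
      exact hpos

end Layout

/-! ### Claims and pages -/

set_option linter.unusedSectionVars false
section Pages
variable {V : Type} [Fintype V] {G : SimpleGraph V} {k : V → ℤ × ℕ}

theorem hall_slots (R : V → V → Prop) (h0 : df R = 0) :
    ∃ (cl : V → V → Prop) (q : V → V → Bool),
      (∀ a b b', R a b → R a b' → cl a b → cl a b' → q a b = q a b' → b = b') ∧
      (∀ a a' b, R a b → R a' b → ¬ cl a b → ¬ cl a' b → q a b = q a' b → a = a') := by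
  let ι := {p : V × V // R p.1 p.2}
  let t : ι → Finset (V × Bool × Bool) := fun p =>
    ({p.1.1} ×ˢ {true} ×ˢ Finset.univ) ∪ ({p.1.2} ×ˢ {false} ×ˢ Finset.univ)
  have hall : ∀ s : Finset ι, s.card ≤ (s.biUnion t).card := by
    intro s
    let P : Finset V := s.image fun p => p.1.1
    let Q : Finset V := s.image fun p => p.1.2
    have h1 : s.card ≤ ee R P Q := by
      have : ee R P Q = ((P ×ˢ Q).filter fun p => R p.1 p.2).card := by
        unfold ee
        rw [Finset.card_filter, Finset.sum_product]
      rw [this]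
      apply Finset.card_le_card_of_injOn (fun p => p.1)
      · intro p hp
        simp only [Finset.coe_filter, Finset.mem_product, Set.mem_ofPred_eq]
        exact ⟨⟨Finset.mem_image_of_mem (fun p : ι => p.1.1) hp,
          Finset.mem_image_of_mem (fun p : ι => p.1.2) hp⟩, p.2⟩
      · intro p _ p' _ h
        exact Subtype.ext h
    have h2 := le_df R P Q
    have h3 : (P ×ˢ ({true} : Finset Bool) ×ˢ (Finset.univ : Finset Bool)) ∪
        (Q ×ˢ ({false} : Finset Bool) ×ˢ (Finset.univ : Finset Bool)) ⊆ s.biUnion t := by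
      intro z hz
      rw [Finset.mem_biUnion]
      rw [Finset.mem_union] at hz
      rcases hz with hz | hz
      · rw [Finset.mem_product] at hz
        obtain ⟨p, hp, hpz⟩ := Finset.mem_image.1 hz.1
        refine ⟨p, hp, Finset.mem_union_left _ ?_⟩
        rw [Finset.mem_product]
        exact ⟨by simp [← hpz], hz.2⟩
      · rw [Finset.mem_product] at hz
        obtain ⟨p, hp, hpz⟩ := Finset.mem_image.1 hz.1
        refine ⟨p, hp, Finset.mem_union_right _ ?_⟩
        rw [Finset.mem_product]
        exact ⟨by simp [← hpz], hz.2⟩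
    have h4 := Finset.card_le_card h3
    rw [Finset.card_union_of_disjoint] at h4
    · simp only [Finset.card_product, Finset.card_singleton, Finset.card_univ, Fintype.card_bool] at h4
      omega
    · rw [Finset.disjoint_left]
      intro z hz hz'
      simp only [Finset.mem_product, Finset.mem_singleton, Finset.mem_univ, and_true] at hz hz'
      rw [hz.2] at hz'
      simp at hz'
  obtain ⟨f, hf, hft⟩ := (Finset.all_card_le_biUnion_card_iff_exists_injective t).1 hall
  have key : ∀ p : ι, ((f p).1 = p.1.1 ∧ (f p).2.1 = true) ∨ ((f p).1 = p.1.2 ∧ (f p).2.1 = false) := by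
    intro p
    have := hft p
    simp only [t, Finset.mem_union, Finset.mem_product, Finset.mem_singleton, Finset.mem_univ, and_true] at this
    exact this
  refine ⟨fun a b => ∃ h : R a b, (f ⟨(a, b), h⟩).2.1 = true,
    fun a b => if h : R a b then (f ⟨(a, b), h⟩).2.2 else false, ?_, ?_⟩
  · rintro a b b' h h' ⟨_, hc⟩ ⟨_, hc'⟩ hq
    simp only [h, h', dif_pos] at hq
    have k1 := key ⟨(a, b), h⟩
    have k2 := key ⟨(a, b'), h'⟩
    simp only [hc, hc'] at k1 k2
    simp at k1 k2
    have : f ⟨(a, b), h⟩ = f ⟨(a, b'), h'⟩ :=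
      Prod.ext (k1.trans k2.symm) (Prod.ext (hc.trans hc'.symm) hq)
    have := congrArg Subtype.val (hf this)
    simpa using this
  · intro a a' b h h' hc hc' hq
    simp only [h, h', dif_pos] at hq
    have k1 := key ⟨(a, b), h⟩
    have k2 := key ⟨(a', b), h'⟩
    have hd : (f ⟨(a, b), h⟩).2.1 = false := by
      cases hh : (f ⟨(a, b), h⟩).2.1
      · rfl
      · exact (hc ⟨h, hh⟩).elim
    have hd' : (f ⟨(a', b), h'⟩).2.1 = false := by
      cases hh : (f ⟨(a', b), h'⟩).2.1
      · rfl
      · exact (hc' ⟨h', hh⟩).elim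
    simp only [hd, hd'] at k1 k2
    simp at k1 k2
    have : f ⟨(a, b), h⟩ = f ⟨(a', b), h'⟩ :=
      Prod.ext (k1.trans k2.symm) (Prod.ext (hd.trans hd'.symm) hq)
    have := congrArg Subtype.val (hf this)
    simpa using this

theorem two_bits (D : Finset V) (hD : D.card ≤ 2) (C : V → Prop) (q : V → Bool)
    (hq : ∀ d ∈ D, ∀ d' ∈ D, C d → C d' → d ≠ d' → q d ≠ q d') :
    ∃ g : V → Bool, (∀ d ∈ D, ∀ d' ∈ D, g d = g d' → d = d') ∧ ∀ d ∈ D, C d → g d = q d := by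
  by_cases hC : ∀ d ∈ D, C d
  · refine ⟨q, fun d hd d' hd' h => ?_, fun _ _ _ => rfl⟩
    by_contra hne
    exact hq d hd d' hd' (hC d hd) (hC d' hd') hne h
  · push Not at hC
    obtain ⟨d0, hd0, hn⟩ := hC
    have h1 : (D.erase d0).card ≤ 1 := by rw [Finset.card_erase_of_mem hd0]; omega
    rw [Finset.card_le_one] at h1
    by_cases he : ∃ d1 ∈ D, d1 ≠ d0
    · obtain ⟨d1, hd1, hne⟩ := he
      have hall : ∀ d ∈ D, d = d0 ∨ d = d1 := by
        intro d hd
        by_cases h : d = d0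
        · exact Or.inl h
        · exact Or.inr (h1 d (Finset.mem_erase.2 ⟨h, hd⟩) d1 (Finset.mem_erase.2 ⟨hne, hd1⟩))
      refine ⟨fun v => if v = d0 then !(q d1) else q v, ?_, ?_⟩
      · intro d hd d' hd' h
        rcases hall d hd with rfl | rfl <;> rcases hall d' hd' with rfl | rfl <;> simp_all
      · intro d hd hCd
        have : d ≠ d0 := by rintro rfl; exact hn hCd
        simp [this]
    · push Not at he
      refine ⟨q, fun d hd d' hd' _ => (he d hd).trans (he d' hd').symm, fun _ _ _ => rfl⟩

theorem card_two_third {D : Finset V} (hD : D.card ≤ 2) {d d' e e' : V} (hd : d ∈ D) (hd' : d' ∈ D)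
    (he : e ∈ D) (he' : e' ∈ D) (h : d ≠ d') (h' : e ≠ e') : (e = d ∧ e' = d') ∨ (e = d' ∧ e' = d) := by
  have h1 : ({d, d'} : Finset V) ⊆ D := by
    intro z hz; simp at hz; rcases hz with rfl | rfl <;> assumption
  have h2 : ({d, d'} : Finset V) = D := Finset.eq_of_subset_of_card_le h1 (by
    rw [Finset.card_pair h]; exact hD)
  rw [← h2] at he he'
  simp at he he'
  rcases he with rfl | rfl <;> rcases he' with rfl | rfl <;> simp_all

theorem bool_card {S : Finset V} (f : V → Bool) (h : ∀ a ∈ S, ∀ b ∈ S, f a = f b → a = b) : S.card ≤ 2 := by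
  have := Finset.card_le_card_of_injOn (s := S) (t := (Finset.univ : Finset Bool)) f (fun _ _ => Finset.mem_coe.2 (Finset.mem_univ _))
    (fun a ha b hb e => h a ha b hb e)
  simpa using this

theorem Mn.ups_le (hm : Mn G k) (hdeg : ∀ a, vdeg G a ≤ 7) {c : V} (hc : (k c).2 = 7) :
    (Finset.univ.filter fun b => UU G k c b).card ≤ 2 := by
  have hc' : k c = ((k c).1, 7) := Prod.ext rfl hc
  have h1 := hm.st.cdeg hc' (hdeg c)
  have h2 := hm.cdn hc'
  omega

theorem Mn.downs_le (hm : Mn G k) (hdeg : ∀ a, vdeg G a ≤ 7) {c : V} (hc : (k c).2 = 7) :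
    (Finset.univ.filter fun b => UU G k b c).card ≤ 2 := by
  have hc' : k c = ((k c).1, 7) := Prod.ext rfl hc
  have h1 := hm.st.cdeg hc' (hdeg c)
  have h2 := hm.cup hc'
  omega

theorem good_leaf (hm : Mn G k) (hdeg : ∀ a, vdeg G a ≤ 7) {cl : V → V → Prop} {q : V → V → Bool}
    (h1 : ∀ a b b', UU G k a b → UU G k a b' → cl a b → cl a b' → q a b = q a b' → b = b')
    {c : V} (hc : (k c).2 = 7) :
    ∃ r, 4 ≤ r ∧ r < 7 ∧ ∀ l, k l = ((k c).1, r) →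
      (∀ d, UU G k d c → UU G k d l → (k d).2 ≠ 7) ∧
      (∀ d d', d ≠ d' → UU G k d c → UU G k d' c → UU G k d l → UU G k d' l → cl d l → ¬ cl d' l) := by
  by_contra hcon
  push Not at hcon
  have hf := hm.st.full c (by omega)
  let D := Finset.univ.filter fun d => UU G k d c
  have hD : D.card ≤ 2 := hm.downs_le hdeg hc
  let w : V → V → ℕ := fun d l => if UU G k d l then (if (k d).2 = 7 then 2 else if cl d l then 1 else 0) else 0
  obtain ⟨S, hS, hSk⟩ : ∃ S : Finset V, S.card = 3 ∧ ∀ l ∈ S, (k l).2 < 7 ∧ 2 ≤ ∑ d ∈ D, w d l := by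
    have bad : ∀ r, 4 ≤ r → r < 7 → ∃ l, k l = ((k c).1, r) ∧ 2 ≤ ∑ d ∈ D, w d l := by
      intro r hr hr'
      obtain ⟨l, hl, hb⟩ := hcon r hr hr'
      refine ⟨l, hl, ?_⟩
      by_cases h : ∀ d, UU G k d c → UU G k d l → (k d).2 ≠ 7
      · obtain ⟨d, d', hne, a1, a2, a3, a4, a5, a6⟩ := hb h
        have hs : ({d, d'} : Finset V) ⊆ D := by
          intro z hz; simp at hz; rcases hz with rfl | rfl <;> simp [D, a1, a2]
        refine le_trans ?_ (Finset.sum_le_sum_of_subset hs)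
        rw [Finset.sum_pair hne]
        have : 1 ≤ w d l := by simp only [w, a3, a5, if_true]; split <;> omega
        have : 1 ≤ w d' l := by simp only [w, a4, a6, if_true]; split <;> omega
        omega
      · push Not at h
        obtain ⟨d, a1, a2, a3⟩ := h
        have : w d l = 2 := by simp [w, a2, a3]
        rw [← this]
        exact Finset.single_le_sum (f := fun d => w d l) (fun _ _ => Nat.zero_le _) (by simp [D, a1])
    obtain ⟨l1, k1, b1⟩ := bad 4 (by norm_num) (by norm_num)
    obtain ⟨l2, k2, b2⟩ := bad 5 (by norm_num) (by norm_num)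
    obtain ⟨l3, k3, b3⟩ := bad 6 (by norm_num) (by norm_num)
    refine ⟨{l1, l2, l3}, ?_, ?_⟩
    · rw [Finset.card_eq_three]
      refine ⟨l1, l2, l3, ?_, ?_, ?_, rfl⟩
      · rintro rfl; rw [k1] at k2; simp at k2
      · rintro rfl; rw [k1] at k3; simp at k3
      · rintro rfl; rw [k2] at k3; simp at k3
    · intro l hl
      simp at hl
      rcases hl with rfl | rfl | rfl
      · exact ⟨by rw [k1]; norm_num, b1⟩
      · exact ⟨by rw [k2]; norm_num, b2⟩
      · exact ⟨by rw [k3]; norm_num, b3⟩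
  have t1 : S.card * 2 ≤ ∑ l ∈ S, ∑ d ∈ D, w d l := by
    rw [← smul_eq_mul]
    exact Finset.card_nsmul_le_sum _ _ _ fun l hl => (hSk l hl).2
  rw [Finset.sum_comm] at t1
  have t2 : ∑ d ∈ D, ∑ l ∈ S, w d l ≤ D.card * 2 := by
    rw [← smul_eq_mul]
    apply Finset.sum_le_card_nsmul
    intro d hd
    have hdc : UU G k d c := by simpa [D] using hd
    by_cases h7 : (k d).2 = 7
    · have e : ∀ l ∈ S, w d l = if UU G k d l then 2 else 0 := by
        intro l _; simp [w, h7]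
      rw [Finset.sum_congr rfl e, ← Finset.sum_filter, Finset.sum_const, smul_eq_mul]
      have : insert c (S.filter fun l => UU G k d l) ⊆ Finset.univ.filter fun b => UU G k d b := by
        intro z hz
        simp at hz ⊢
        rcases hz with rfl | hz
        · exact hdc
        · exact hz.2
      have h3 := Finset.card_le_card this
      rw [Finset.card_insert_of_notMem] at h3
      · have := hm.ups_le hdeg h7
        omega
      · intro h
        have := (hSk c (Finset.mem_filter.1 h).1).1
        omega
    · have e : ∀ l ∈ S, w d l = if UU G k d l ∧ cl d l then 1 else 0 := by
        intro l _; simp only [w, h7, if_false]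
        split_ifs <;> tauto
      rw [Finset.sum_congr rfl e, ← Finset.card_filter]
      apply bool_card (q d)
      intro a ha b hb
      simp at ha hb
      exact h1 d a b ha.2.1 hb.2.1 ha.2.2 hb.2.2
  omega

/-- The final choice of claims, pages, pendant leaves and star orientations. -/
structure Pages (G : SimpleGraph V) (k : V → ℤ × ℕ) (cl : V → V → Prop) (pg : V → V → Bool)
    (pr : ℤ → ℕ) (o : ℤ → Bool) : Prop where
  c1 : ∀ a b b', UU G k a b → UU G k a b' → cl a b → cl a b' → pg a b = pg a b' → b = b'
  c2 : ∀ a a' b, UU G k a b → UU G k a' b → ¬ cl a b → ¬ cl a' b → pg a b = pg a' b → a = a'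
  prr : ∀ s, 4 ≤ pr s ∧ pr s < 7
  dn : ∀ c l u, (k c).2 = 7 → k l = ((k c).1, pr (k c).1) → UU G k u c → UU G k u l → pg u c = pg u l
  up : ∀ c l u, (k c).2 = 7 → k l = ((k c).1, pr (k c).1) → UU G k c u → UU G k l u →
    pg c u = pg l u ∨ pg l u = o (k c).1

theorem exists_pages (hm : Mn G k) (hdeg : ∀ a, vdeg G a ≤ 7) : ∃ cl pg pr o, Pages G k cl pg pr o := by
  obtain ⟨cl, q, h1, h2⟩ := hall_slots (UU G k) (hm.df_zero hdeg)
  have hk := hm.st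
  -- pendant leaves
  have hpr : ∀ s : ℤ, ∃ r, 4 ≤ r ∧ r < 7 ∧ ∀ c, k c = (s, 7) → ∀ l, k l = (s, r) →
      (∀ d, UU G k d c → UU G k d l → (k d).2 ≠ 7) ∧
      (∀ d d', d ≠ d' → UU G k d c → UU G k d' c → UU G k d l → UU G k d' l → cl d l → ¬ cl d' l) := by
    intro s
    by_cases hs : ∃ c, k c = (s, 7)
    · obtain ⟨c, hc⟩ := hs
      obtain ⟨r, r4, r7, hr⟩ := good_leaf hm hdeg h1 (c := c) (by rw [hc])
      refine ⟨r, r4, r7, ?_⟩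
      intro c' hc'
      have : c' = c := hk.inj (hc'.trans hc.symm)
      subst this
      rw [hc] at hr
      exact hr
    · exact ⟨4, le_rfl, by norm_num, fun c hc => (hs ⟨c, hc⟩).elim⟩
  choose pr pr4 pr7 hpr using hpr
  -- flips at pendant leaves
  have hF : ∀ l : V, ∃ F : Bool, ∀ c, k c = ((k l).1, 7) → (k l).2 = pr (k l).1 → ∀ d d', d ≠ d' →
      UU G k d c → UU G k d' c → UU G k d l → UU G k d' l →
      (if cl d l then q d l else (q d l ^^ F)) ≠ (if cl d' l then q d' l else (q d' l ^^ F)) := by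
    intro l
    by_cases hex : ∃ c d d', k c = ((k l).1, 7) ∧ (k l).2 = pr (k l).1 ∧ d ≠ d' ∧
        UU G k d c ∧ UU G k d' c ∧ UU G k d l ∧ UU G k d' l ∧ cl d l ∧ ¬ cl d' l
    · obtain ⟨c, d, d', hc, hl, hne, a1, a2, a3, a4, a5, a6⟩ := hex
      refine ⟨q d l == q d' l, ?_⟩
      intro c' hc' _ e e' hne' b1 b2 b3 b4
      have : c' = c := hk.inj (hc'.trans hc.symm)
      subst this
      have hD := hm.downs_le hdeg (c := c') (by rw [hc])
      rcases card_two_third hD (d := d) (d' := d') (e := e) (e' := e') (by simp [a1]) (by simp [a2])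
        (by simp [b1]) (by simp [b2]) hne hne' with ⟨rfl, rfl⟩ | ⟨rfl, rfl⟩
      · simp only [a5, a6, if_true, if_false]
        cases q e l <;> cases q e' l <;> simp
      · simp only [a5, a6, if_true, if_false]
        cases q e l <;> cases q e' l <;> simp
    · refine ⟨false, ?_⟩
      intro c hc hl d d' hne a1 a2 a3 a4
      have hg := (hpr (k l).1 c hc l (Prod.ext rfl hl)).2
      by_cases x1 : cl d l <;> by_cases x2 : cl d' l
      · exact (hg d d' hne a1 a2 a3 a4 x1 x2).elim
      · exact (hex ⟨c, d, d', hc, hl, hne, a1, a2, a3, a4, x1, x2⟩).elim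
      · exact (hex ⟨c, d', d, hc, hl, hne.symm, a2, a1, a4, a3, x2, x1⟩).elim
      · simp only [x1, x2, if_false, Bool.xor_false]
        intro h
        exact hne (h2 d d' l a3 a4 x1 x2 h)
  choose F hF using hF
  let q1 : V → V → Bool := fun a b => if cl a b then q a b else (q a b ^^ F b)
  -- pages below centres
  have hg : ∀ c : V, ∃ g : V → Bool, (k c).2 = 7 →
      (∀ d d', UU G k d c → UU G k d' c → g d = g d' → d = d') ∧
      ∀ l d, k l = ((k c).1, pr (k c).1) → UU G k d c → UU G k d l → g d = q1 d l := by
    intro c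
    by_cases hc : (k c).2 = 7
    · have hc' : k c = ((k c).1, 7) := Prod.ext rfl hc
      obtain ⟨l, hl⟩ := hk.full c (by omega) (pr (k c).1) (pr4 _) (by have := pr7 (k c).1; omega)
      obtain ⟨g, g1, g2⟩ := two_bits (Finset.univ.filter fun d => UU G k d c) (hm.downs_le hdeg hc)
        (fun d => UU G k d l) (fun d => q1 d l) (by
          intro d hd d' hd' hdl hdl' hne
          simp at hd hd'
          exact hF l c (by rw [hl]; exact hc') (by rw [hl]) d d' hne hd hd' hdl hdl')
      refine ⟨g, fun _ => ⟨fun d d' hd hd' => g1 d (by simp [hd]) d' (by simp [hd']), ?_⟩⟩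
      intro l' d hl' hd hdl
      have : l' = l := hk.inj (hl'.trans hl.symm)
      subst this
      exact g2 d (by simp [hd]) hdl
    · exact ⟨fun _ => false, fun h => (hc h).elim⟩
  choose g hg using hg
  let q2 : V → V → Bool := fun a b => if (k b).2 = 7 then g b a else q1 a b
  -- pages above centres, and orientations
  have hh : ∀ s : ℤ, ∃ (o : Bool) (h : V → Bool), ∀ c, k c = (s, 7) →
      (∀ u u', UU G k c u → UU G k c u' → h u = h u' → u = u') ∧
      ∀ l u, k l = (s, pr s) → UU G k c u → UU G k l u → h u = q2 l u ∨ q2 l u = o := by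
    intro s
    by_cases hs : ∃ c, k c = (s, 7)
    · obtain ⟨c, hc⟩ := hs
      have hc7 : (k c).2 = 7 := by rw [hc]
      have hcu : ∀ c', k c' = (s, 7) → c' = c := fun c' hc' => hk.inj (hc'.trans hc.symm)
      have hU := hm.ups_le hdeg hc7
      obtain ⟨l, hl⟩ := hk.full c (by omega) (pr s) (pr4 _) (by have := pr7 s; omega)
      rw [hc] at hl
      have hlu : ∀ l', k l' = (s, pr s) → l' = l := fun l' hl' => hk.inj (hl'.trans hl.symm)
      by_cases hinj : ∀ u u', UU G k c u → UU G k c u' → UU G k l u → UU G k l u' → u ≠ u' → q2 l u ≠ q2 l u'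
      · obtain ⟨h, g1, g2⟩ := two_bits (Finset.univ.filter fun u => UU G k c u) hU
          (fun u => UU G k l u) (fun u => q2 l u) (by
            intro d hd d' hd' hdl hdl' hne
            simp at hd hd'
            exact hinj d d' hd hd' hdl hdl' hne)
        refine ⟨false, h, ?_⟩
        intro c' hc'
        rw [hcu c' hc']
        refine ⟨fun d d' hd hd' => g1 d (by simp [hd]) d' (by simp [hd']), ?_⟩
        intro l' u hl' hu hlu'
        rw [hlu l' hl'] at hlu' ⊢
        exact Or.inl (g2 u (by simp [hu]) hlu')
      · push Not at hinj
        obtain ⟨u, u', a1, a2, a3, a4, hne, he⟩ := hinj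
        obtain ⟨h, g1, -⟩ := two_bits (Finset.univ.filter fun u => UU G k c u) hU
          (fun _ => False) (fun _ => false) (by simp)
        refine ⟨q2 l u, h, ?_⟩
        intro c' hc'
        rw [hcu c' hc']
        refine ⟨fun d d' hd hd' => g1 d (by simp [hd]) d' (by simp [hd']), ?_⟩
        intro l' v hl' hv hlv
        rw [hlu l' hl'] at hlv ⊢
        right
        by_cases hvu : v = u
        · rw [hvu]
        · rcases card_two_third hU (d := u) (d' := u') (e := v) (e' := u) (by simp [a1]) (by simp [a2])
            (by simp [hv]) (by simp [a1]) hne hvu with ⟨h1, h2⟩ | ⟨h1, h2⟩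
          · exact (hvu h1).elim
          · rw [h1]; exact he.symm
    · exact ⟨false, fun _ => false, fun c hc => (hs ⟨c, hc⟩).elim⟩
  choose o h hh using hh
  refine ⟨fun a b => (k a).2 = 7 ∨ ((k b).2 ≠ 7 ∧ cl a b),
    fun a b => if (k a).2 = 7 then h (k a).1 b else q2 a b, pr, o, ?_, ?_, fun s => ⟨pr4 s, pr7 s⟩, ?_, ?_⟩
  · intro a b b' hb hb' hc hc' he
    by_cases ha : (k a).2 = 7
    · simp only [ha, if_true] at he
      exact (hh (k a).1 a (Prod.ext rfl ha)).1 b b' hb hb' he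
    · simp only [ha, false_or] at hc hc'
      simp only [ha, if_false, q2, hc.1, hc'.1, q1, hc.2, hc'.2, if_true] at he
      exact h1 a b b' hb hb' hc.2 hc'.2 he
  · intro a a' b ha ha' hc hc' he
    push Not at hc hc'
    simp only [hc.1, hc'.1, if_false, q2] at he
    by_cases hb : (k b).2 = 7
    · simp only [hb, if_true] at he
      exact (hg b hb).1 a a' ha ha' he
    · have n1 := hc.2 hb
      have n2 := hc'.2 hb
      simp only [hb, if_false, q1, n1, n2] at he
      exact h2 a a' b ha ha' n1 n2 (by simpa using he)
  · intro c l u hc hl huc hul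
    have hc' : k c = ((k c).1, 7) := Prod.ext rfl hc
    have n7 := (hpr (k c).1 c hc' l hl).1 u huc hul
    have l7 : (k l).2 ≠ 7 := by rw [hl]; have := pr7 (k c).1; simp only; omega
    simp only [n7, if_false, q2, hc, if_true, l7]
    exact (hg c hc).2 l u hl huc hul
  · intro c l u hc hl hcu hlu
    have hc' : k c = ((k c).1, 7) := Prod.ext rfl hc
    have l7 : (k l).2 ≠ 7 := by rw [hl]; have := pr7 (k c).1; simp only; omega
    simp only [hc, if_true, l7, if_false]
    exact (hh (k c).1 c hc').2 l u hl hcu hlu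

end Pages

/-! ### Coordinates -/

/-- position inside a block with pendant role `p` and orientation `o` -/
def xi (p : ℕ) (o : Bool) (r : ℕ) : ℕ :=
  if r < 4 then r else if r = 7 then (if o then 1 else 2) else if r = p then (if o then 2 else 1)
  else if r = (if p = 4 then 5 else 4) then 0 else 3

theorem xi_lt : ∀ p ∈ [4, 5, 6], ∀ o : Bool, ∀ r < 8, xi p o r < 4 := by decide

theorem xi_inj : ∀ p ∈ [4, 5, 6], ∀ o : Bool, ∀ r < 8, ∀ r' < 8, (4 ≤ r ↔ 4 ≤ r') →
    xi p o r = xi p o r' → r = r' := by decide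

set_option synthInstance.maxHeartbeats 400000 in
set_option synthInstance.maxSize 2000 in
theorem xi_ord : ∀ p ∈ [4, 5, 6], ∀ o : Bool, ∀ r < 8, ∀ r' < 8, (4 ≤ r ↔ 4 ≤ r') →
    up r r' = true → r ≠ p → r' ≠ p → xi p o r < xi p o r' := by decide

set_option synthInstance.maxHeartbeats 400000 in
set_option synthInstance.maxSize 2000 in
theorem xi_cover : ∀ p ∈ [4, 5, 6], ∀ o : Bool, ∀ r < 8, ∀ r' < 8, (4 ≤ r ↔ 4 ≤ r') → r ≠ r' →
    (xi p o r' = xi p o r + 1) ∨ (xi p o r = xi p o r' + 1) ∨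
    (xi p (!o) r' = xi p (!o) r + 1 ∧ (xi p o r' + 2 ≤ xi p o r ∨ xi p o r + 2 ≤ xi p o r')) ∨
    (xi p (!o) r = xi p (!o) r' + 1 ∧ (xi p o r + 2 ≤ xi p o r' ∨ xi p o r' + 2 ≤ xi p o r)) ∨
    (up r r' = true ∧ r ≠ p ∧ r' ≠ p) ∨ (up r' r = true ∧ r' ≠ p ∧ r ≠ p) := by decide

set_option synthInstance.maxHeartbeats 400000 in
set_option synthInstance.maxSize 2000 in
theorem xi_anti : ∀ p ∈ [4, 5, 6], ∀ o : Bool, ∀ r < 8, ∀ r' < 8, (4 ≤ r ↔ 4 ≤ r') →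
    xi p o r < xi p o r' → xi p (!o) r' < xi p (!o) r →
    (o = true ∧ r = 7 ∧ r' = p) ∨ (o = false ∧ r = p ∧ r' = 7) := by decide

set_option synthInstance.maxHeartbeats 400000 in
set_option synthInstance.maxSize 2000 in
theorem up_ne7 : ∀ r < 8, ∀ r' < 8, (4 ≤ r ↔ 4 ≤ r') → up r r' = true → r ≠ 7 ∧ r' ≠ 7 := by decide

set_option linter.unusedSectionVars false
section Coords
variable {V : Type} [Fintype V] {G : SimpleGraph V} {k : V → ℤ × ℕ}
  {cl : V → V → Prop} {pg : V → V → Bool} {pr : ℤ → ℕ} {o : ℤ → Bool}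

/-- rank of a block -/
def brk (k : V → ℤ × ℕ) (s : ℤ) : ℕ := ((Finset.univ.image fun a => (k a).1).filter fun t => t < s).card

theorem brk_lt (a : V) : brk k (k a).1 < Fintype.card V := by
  have h1 : ((Finset.univ.image fun a => (k a).1).filter fun t => t < (k a).1).card <
      (Finset.univ.image fun a => (k a).1).card := by
    apply Finset.card_lt_card
    refine Finset.filter_ssubset.2 ⟨(k a).1, Finset.mem_image_of_mem (fun a => (k a).1) (Finset.mem_univ a), by simp⟩
  exact h1.trans_le Finset.card_image_le

theorem brk_mono {a b : V} (h : (k a).1 < (k b).1) : brk k (k a).1 < brk k (k b).1 := by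
  apply Finset.card_lt_card
  rw [Finset.ssubset_iff_of_subset]
  · exact ⟨(k a).1, by simp [h], by simp⟩
  · intro u hu
    simp only [Finset.mem_filter] at hu ⊢
    exact ⟨hu.1, hu.2.trans h⟩

def xc (k : V → ℤ × ℕ) (pr : ℤ → ℕ) (o : ℤ → Bool) (a : V) : ℤ :=
  8 * (brk k (k a).1 : ℤ) + (xi (pr (k a).1) (o (k a).1) (k a).2 : ℤ)

/-- a proper pair: not drawn inside a star with the pendant leaf -/
def NP (k : V → ℤ × ℕ) (pr : ℤ → ℕ) (a b : V) : Prop :=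
  (k a).1 = (k b).1 → (k a).2 ≠ pr (k a).1 ∧ (k b).2 ≠ pr (k a).1

theorem pmem (h : ∀ s, 4 ≤ pr s ∧ pr s < 7) (s : ℤ) : pr s ∈ [4, 5, 6] := by
  have := h s
  simp; omega

theorem St.iff4 (hk : St G k) {a b : V} (h : (k a).1 = (k b).1) : 4 ≤ (k a).2 ↔ 4 ≤ (k b).2 :=
  ⟨hk.nopath a b h, hk.nopath b a h.symm⟩

theorem xc_lt_of_block (hk : St G k) (hp : ∀ s, 4 ≤ pr s ∧ pr s < 7) {a b : V} (h : (k a).1 < (k b).1) :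
    xc k pr o a < xc k pr o b := by
  have h1 := brk_mono (k := k) h
  have h2 := xi_lt _ (pmem hp (k a).1) (o (k a).1) _ (hk.lt a)
  unfold xc
  omega

theorem block_of_xc (hk : St G k) (hp : ∀ s, 4 ≤ pr s ∧ pr s < 7) {a b : V}
    (h : xc k pr o a ≤ xc k pr o b) : (k a).1 ≤ (k b).1 := by
  by_contra hlt
  have := xc_lt_of_block (o := o) hk hp (a := b) (b := a) (by omega)
  omega

theorem xc_inj (hk : St G k) (hp : ∀ s, 4 ≤ pr s ∧ pr s < 7) : Function.Injective (xc k pr o) := by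
  intro a b h
  have h1 := block_of_xc hk hp h.le
  have h2 := block_of_xc hk hp h.ge
  have e : (k a).1 = (k b).1 := le_antisymm h1 h2
  unfold xc at h
  rw [← e] at h
  have := xi_inj _ (pmem hp (k a).1) (o (k a).1) _ (hk.lt a) _ (hk.lt b) (hk.iff4 e) (by omega)
  exact hk.inj (Prod.ext e this)

theorem xc_bd (hk : St G k) (hp : ∀ s, 4 ≤ pr s ∧ pr s < 7) (a : V) :
    0 ≤ xc k pr o a ∧ xc k pr o a < 8 * Fintype.card V := by
  have h1 := brk_lt (k := k) a
  have h2 := xi_lt _ (pmem hp (k a).1) (o (k a).1) _ (hk.lt a)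
  unfold xc
  omega

theorem xc_ord (hk : St G k) (hp : ∀ s, 4 ≤ pr s ∧ pr s < 7) {a b : V} (h : UU G k a b)
    (hn : NP k pr a b) : xc k pr o a < xc k pr o b := by
  rcases h.2 with h1 | ⟨h1, h2⟩
  · exact xc_lt_of_block hk hp h1
  · have := xi_ord _ (pmem hp (k a).1) (o (k a).1) _ (hk.lt a) _ (hk.lt b) (hk.iff4 h1) h2 (hn h1).1 (hn h1).2
    unfold xc
    rw [← h1]
    omega

theorem same_roles (hk : St G k) {a b : V} (h : UU G k a b) (hn : NP k pr a b)
    (e : (k a).1 = (k b).1) :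
    ((k a).2 ≠ 7 ∧ (k a).2 ≠ pr (k a).1) ∧ ((k b).2 ≠ 7 ∧ (k b).2 ≠ pr (k b).1) := by
  rcases h.2 with h1 | ⟨-, h2⟩
  · omega
  · have := up_ne7 _ (hk.lt a) _ (hk.lt b) (hk.iff4 e) h2
    exact ⟨⟨this.1, (hn e).1⟩, ⟨this.2, e ▸ (hn e).2⟩⟩

theorem anti (hk : St G k) (hp : ∀ s, 4 ≤ pr s ∧ pr s < 7) {a b : V}
    (h1 : xc k pr o a < xc k pr o b) (h2 : xc k pr (fun s => !(o s)) b < xc k pr (fun s => !(o s)) a) :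
    (k a).1 = (k b).1 ∧ ((o (k a).1 = true ∧ (k a).2 = 7 ∧ (k b).2 = pr (k a).1) ∨
      (o (k a).1 = false ∧ (k a).2 = pr (k a).1 ∧ (k b).2 = 7)) := by
  have e : (k a).1 = (k b).1 := le_antisymm (block_of_xc hk hp h1.le) (block_of_xc hk hp h2.le)
  refine ⟨e, ?_⟩
  unfold xc at h1 h2
  beta_reduce at h1 h2
  rw [← e] at h1 h2
  exact xi_anti _ (pmem hp (k a).1) _ _ (hk.lt a) _ (hk.lt b) (hk.iff4 e) (by omega) (by omega)

theorem sg_lt {a b c : ℤ} (h : sg a b = sg a c) (hb : a < b) : a < c := by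
  unfold sg at h
  by_contra hc
  simp [hb, hc] at h

theorem sg_gt {a b c : ℤ} (h : sg a b = sg a c) (hb : b < a) (hc : a ≠ c) : c < a := by
  unfold sg at h
  by_contra hc'
  have : a < c := by omega
  simp [this, hb.not_gt] at h

set_option maxHeartbeats 1000000 in
theorem draw_of_pages (hdeg : ∀ v, vdeg G v ≤ 7) (hk : St G k) (P : Pages G k cl pg pr o) :
    ∃ (p : V → Pt) (poly : Sym2 V → List Pt), IsBendRACDrawing 2 G p poly ∧
          InGridSquare (5000 * (Fintype.card V : ℝ)) (drawingPoints G p poly) := by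
  have hp := P.prr
  set x := xc k pr o with hx
  set y := xc k pr (fun s => !(o s)) with hy
  have xinj : Function.Injective x := xc_inj hk hp
  have yinj : Function.Injective y := xc_inj hk hp
  have xo : ∀ {a b}, UU G k a b → NP k pr a b → x a < x b := fun h hn => xc_ord hk hp h hn
  have yo : ∀ {a b}, UU G k a b → NP k pr a b → y a < y b := fun h hn => xc_ord hk hp h hn
  -- the two stars' special vertices are never properly related inside their block
  have antiD : ∀ {a b : V}, x a < x b → y b < y a →
      (k a).1 = (k b).1 ∧ ((o (k a).1 = true ∧ (k a).2 = 7 ∧ (k b).2 = pr (k a).1) ∨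
      (o (k a).1 = false ∧ (k a).2 = pr (k a).1 ∧ (k b).2 = 7)) := fun h1 h2 => anti hk hp h1 h2
  let T : V → V → Prop := fun s t => (UU G k s t ∧ NP k pr s t ∧ pg s t = true) ∨
    (UU G k t s ∧ NP k pr t s ∧ pg t s = false)
  let A : V → V → Prop := fun u v => (k u).1 = (k v).1 ∧ x v = x u + 1
  let B : V → V → Prop := fun u v => (k u).1 = (k v).1 ∧ y v = y u + 1 ∧ (x v ≤ x u - 2 ∨ x u + 2 ≤ x v)
  refine draw_of_claims G hdeg x y T A B
    (fun s t => (UU G k s t ∧ cl s t) ∨ (UU G k t s ∧ ¬ cl t s))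
    (fun s t => (UU G k s t ∧ ¬ cl s t) ∨ (UU G k t s ∧ cl t s)) xinj yinj
    (xc_bd hk hp) (xc_bd hk hp) ?_ ?_ (fun u v h => h.2) (fun u v h => h.2.1) (fun u v h => h.2.2) ?_ ?_ ?_ ?_
  · rintro s t (h | h)
    · exact h.1.1
    · exact h.1.1.symm
  · intro u v huv
    have tt : ∀ a b, UU G k a b → NP k pr a b → T a b ∨ T b a := by
      intro a b h hn
      cases hpg : pg a b
      · exact Or.inr (Or.inr ⟨h, hn, hpg⟩)
      · exact Or.inl (Or.inl ⟨h, hn, hpg⟩)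
    have fwd : ∀ {C : Prop}, T u v ∨ T v u → T u v ∨ T v u ∨ C := by
      rintro C (h | h)
      · exact Or.inl h
      · exact Or.inr (Or.inl h)
    rcases lt_trichotomy (k u).1 (k v).1 with h | h | h
    · exact fwd (tt u v ⟨huv, Or.inl h⟩ (fun e => by omega))
    · have hne : (k u).2 ≠ (k v).2 := fun e => huv.ne (hk.inj (Prod.ext h e))
      have hc := xi_cover _ (pmem hp (k u).1) (o (k u).1) _ (hk.lt u) _ (hk.lt v) (hk.iff4 h) hne
      have ex : ∀ a, (k a).1 = (k u).1 →
          x a = 8 * (brk k (k u).1 : ℤ) + (xi (pr (k u).1) (o (k u).1) (k a).2 : ℤ) := by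
        intro a ha; rw [hx]; unfold xc; rw [ha]
      have ey : ∀ a, (k a).1 = (k u).1 →
          y a = 8 * (brk k (k u).1 : ℤ) + (xi (pr (k u).1) (!(o (k u).1)) (k a).2 : ℤ) := by
        intro a ha; rw [hy]; unfold xc; rw [ha]
      have e1 := ex u rfl
      have e2 := ex v h.symm
      have e3 := ey u rfl
      have e4 := ey v h.symm
      rcases hc with hc | hc | hc | hc | hc | hc
      · exact Or.inr (Or.inr (Or.inl ⟨h, by omega⟩))
      · exact Or.inr (Or.inr (Or.inr (Or.inl ⟨h.symm, by omega⟩)))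
      · exact Or.inr (Or.inr (Or.inr (Or.inr (Or.inl ⟨h, by omega, by omega⟩))))
      · exact Or.inr (Or.inr (Or.inr (Or.inr (Or.inr ⟨h.symm, by omega, by omega⟩))))
      · exact fwd (tt u v ⟨huv, Or.inr ⟨h, hc.1⟩⟩ (fun _ => hc.2))
      · exact fwd (tt v u ⟨huv.symm, Or.inr ⟨h.symm, hc.1⟩⟩ (fun _ => by rw [← h]; exact hc.2)).symm
    · exact fwd (tt v u ⟨huv.symm, Or.inl h⟩ (fun e => by omega)).symm
  · rintro s t (⟨h, -, -⟩ | ⟨h, -, -⟩)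
    · by_cases hc : cl s t
      · exact Or.inl (Or.inl ⟨h, hc⟩)
      · exact Or.inr (Or.inl ⟨h, hc⟩)
    · by_cases hc : cl t s
      · exact Or.inr (Or.inr ⟨h, hc⟩)
      · exact Or.inl (Or.inr ⟨h, hc⟩)
  · rintro s t t' (⟨h, hn, hg⟩ | ⟨h, hn, hg⟩) (⟨h', hn', hg'⟩ | ⟨h', hn', hg'⟩) hE hE' hs
    · have := h.ne
      have := h'.ne
      exact P.c1 s t t' h h' (by tauto) (by tauto) (hg.trans hg'.symm)
    · have := sg_lt hs (xo h hn)
      have := xo h' hn'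
      omega
    · have := sg_lt hs.symm (xo h' hn')
      have := xo h hn
      omega
    · have := h.ne
      have := h'.ne
      exact P.c2 t t' s h h' (by tauto) (by tauto) (hg.trans hg'.symm)
  · rintro s s' t (⟨h, hn, hg⟩ | ⟨h, hn, hg⟩) (⟨h', hn', hg'⟩ | ⟨h', hn', hg'⟩) hE hE' hs
    · have := h.ne
      have := h'.ne
      exact P.c2 s s' t h h' (by tauto) (by tauto) (hg.trans hg'.symm)
    · have := sg_lt hs.symm (yo h' hn')
      have := yo h hn
      omega
    · have := sg_lt hs (yo h hn)
      have := yo h' hn'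
      omega
    · have := h.ne
      have := h'.ne
      exact P.c1 t s s' h h' (by tauto) (by tauto) (hg.trans hg'.symm)
  · intro u v z hyp sx sy dx dy
    have zu : z ≠ u := by
      rintro rfl
      simp at dx
      have := abs_nonneg (x v - x z)
      omega
    have vu : v ≠ u := by
      rintro rfl
      simp at dy
      have := abs_nonneg (y z - y v)
      omega
    have fin1 : ∀ w, (k v).1 = (k z).1 → w = v ∨ w = z → ((k w).2 = 7 ∨ (k w).2 = pr (k w).1) →
        (UU G k u w ∧ NP k pr u w ∨ UU G k w u ∧ NP k pr w u) → (k u).1 ≠ (k v).1 := by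
      intro w hvz hw hr hU e
      have ew : (k u).1 = (k w).1 := by rcases hw with rfl | rfl <;> omega
      rcases hU with ⟨h, hn⟩ | ⟨h, hn⟩
      · have := (same_roles hk h hn ew).2
        tauto
      · have := (same_roles hk h hn ew.symm).1
        tauto
    rcases hyp with ⟨⟨h, hn, hg⟩ | ⟨h, hn, hg⟩, h2⟩ | ⟨hA, ⟨h, hn, hg⟩ | ⟨h, hn, hg⟩⟩
    · have x1 := xo h hn
      have y1 := yo h hn
      have x2 := sg_lt sx x1
      have y2 := sg_lt sy y1
      rw [abs_of_pos (by omega), abs_of_pos (by omega)] at dx dy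
      obtain ⟨e, ha⟩ := antiD (a := v) (b := z) (by omega) (by omega)
      have hb := fin1 v e (Or.inl rfl) (by tauto) (Or.inl ⟨h, hn⟩)
      rcases h2 with (⟨h', hn', hg'⟩ | ⟨h', hn', hg'⟩) | hB | hB
      · have := xo h' hn'
        omega
      · rcases ha with ⟨-, r1, r2⟩ | ⟨-, r1, r2⟩
        · have := P.dn v z u r1 (Prod.ext e.symm r2) h h'
          rw [hg, hg'] at this
          exact absurd this (by decide)
        · have := P.dn z v u r2 (by rw [← e]; exact Prod.ext rfl r1) h' h
          rw [hg, hg'] at this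
          exact absurd this (by decide)
      · exact hb (hB.1.trans e.symm)
      · exact hb (hB.1.symm.trans e.symm)
    · have x1 := xo h hn
      have y1 := yo h hn
      have x2 := sg_gt sx x1 (fun e => zu (xinj e).symm)
      have y2 := sg_gt sy y1 (fun e => zu (yinj e).symm)
      rw [abs_of_neg (by omega), abs_of_neg (by omega)] at dx dy
      obtain ⟨e, ha⟩ := antiD (a := z) (b := v) (by omega) (by omega)
      have hb := fin1 v e.symm (Or.inl rfl) (by rw [← e]; tauto) (Or.inr ⟨h, hn⟩)
      rcases h2 with (⟨h', hn', hg'⟩ | ⟨h', hn', hg'⟩) | hB | hB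
      · rcases ha with ⟨ho, r1, r2⟩ | ⟨ho, r1, r2⟩
        · have := P.up z v u r1 (Prod.ext e.symm r2) h' h
          rw [hg, hg', ho] at this
          simp at this
        · have := P.up v z u r2 (by rw [← e]; exact Prod.ext rfl r1) h h'
          rw [hg, hg', ← e, ho] at this
          simp at this
      · have := xo h' hn'
        omega
      · exact hb (hB.1.trans e)
      · exact hb (hB.1.symm.trans e)
    · have x1 := xo h hn
      have y1 := yo h hn
      have x2 := sg_gt sx.symm x1 (fun e => vu (xinj e).symm)
      have y2 := sg_gt sy.symm y1 (fun e => vu (yinj e).symm)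
      rw [abs_of_neg (by omega), abs_of_neg (by omega)] at dx dy
      obtain ⟨e, ha⟩ := antiD (a := z) (b := v) (by omega) (by omega)
      have hb := fin1 z e.symm (Or.inr rfl) (by tauto) (Or.inr ⟨h, hn⟩)
      rcases hA with hA | hA
      · exact hb hA.1
      · exact hb hA.1.symm
    · have x1 := xo h hn
      have y1 := yo h hn
      have x2 := sg_lt sx.symm x1
      have y2 := sg_lt sy.symm y1
      rw [abs_of_pos (by omega), abs_of_pos (by omega)] at dx dy
      obtain ⟨e, ha⟩ := antiD (a := v) (b := z) (by omega) (by omega)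
      have hb := fin1 z e (Or.inr rfl) (by rw [← e]; tauto) (Or.inl ⟨h, hn⟩)
      rcases hA with hA | hA
      · exact hb hA.1
      · exact hb hA.1.symm

end Coords

/-- There is an absolute constant `c` such that every 7-edge-colorable
graph with maximum degree 7 on `n` vertices admits a 2-bend RAC drawing with all vertex
and bend points on integer grid points inside a square of side `c * n`
(i.e. of `O(n²)` area). -/
theorem stmt3 :
    ∃ c : ℝ, 0 < c ∧
      ∀ (V : Type) [Fintype V] (G : SimpleGraph V),
        (∀ v : V, vdeg G v ≤ 7) → EdgeColorable G 7 →
        ∃ (p : V → Pt) (poly : Sym2 V → List Pt),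
          IsBendRACDrawing 2 G p poly ∧
          InGridSquare (c * (Fintype.card V : ℝ)) (drawingPoints G p poly) := by
  refine ⟨5000, by norm_num, ?_⟩
  intro V _ G hdeg _
  obtain ⟨k, hm⟩ := exists_mn G
  obtain ⟨cl, pg, pr, o, P⟩ := exists_pages hm hdeg
  exact draw_of_pages hdeg hm.st P
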